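/- arXiv:2508.13643 — 2 statements merged into one kernel-verified Lean document; each statement's English description precedes it below -/
import Mathlib

section
/- Let r ≥ 3 and let G be an n-vertex simple graph with e(G) ≥ ⌊(n−r+1)²/4⌋ + C(r,2). If G does not belong to the family 𝒢_{n,r} and G is not obtained from the bipartite Turán graph T_{n−r+1,2} by suspending K_r, then for every integer k with r ≤ 2k and 100k ≤ n, the graph G contains a cycle of length 2k+1. -/
/-- A graph is `m`-cycle-free if it contains no cycle of length `m`. -/
def SimpleGraph.CycleFree {V : Type*} (G : SimpleGraph V) (m : ℕ) : Prop :=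
  ∀ ⦃v : V⦄ (w : G.Walk v v), w.IsCycle → w.length ≠ m

/-- The spectral radius of a finite graph: the largest (real) eigenvalue of its
adjacency matrix, i.e. the supremum of the set of real eigenvalues. -/
noncomputable def SimpleGraph.specRad {V : Type*} [Fintype V] (G : SimpleGraph V) : ℝ :=
  letI : DecidableRel G.Adj := Classical.decRel _
  sSup {μ : ℝ | ∃ x : V → ℝ, x ≠ 0 ∧ (SimpleGraph.adjMatrix ℝ G).mulVec x = μ • x}

/-- A graph is 2-connected if it has at least 3 vertices, is connected, and removing
any single vertex leaves it connected. -/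
def SimpleGraph.TwoConnected {V : Type*} (G : SimpleGraph V) : Prop :=
  3 ≤ Nat.card V ∧ G.Connected ∧
    ∀ v : V, (G.induce (({v} : Set V)ᶜ)).Connected

/-- `turanSuspAt n q v0`: the `n`-vertex graph obtained from the complete bipartite graph
with parts `{0, …, q/2 - 1}` and `{q/2, …, q-1}` (the bipartite Turán graph `T_{q,2}`)
by putting a clique on `{v0} ∪ {q, …, n-1}`; for `v0 < q` this is `T_{q,2}` with a
clique `K_{n-q+1}` suspended at the vertex `v0`. -/
def turanSuspAt (n q v0 : ℕ) : SimpleGraph (Fin n) :=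
  SimpleGraph.fromRel (fun i j =>
    ((i : ℕ) < q / 2 ∧ q / 2 ≤ (j : ℕ) ∧ (j : ℕ) < q) ∨
    (((i : ℕ) = v0 ∨ q ≤ (i : ℕ)) ∧ ((j : ℕ) = v0 ∨ q ≤ (j : ℕ))))

/-- The family `𝒢_{n,r}`: graphs obtained from a bipartite graph by suspending graphs
`G_1, …, G_s` whose parts outside the bipartite graph have at most `r - 2` vertices
in total. -/
def FamilyG (n r : ℕ) (G : SimpleGraph (Fin n)) : Prop :=
  ∃ (s : ℕ) (W : Fin s → Finset (Fin n)) (v : Fin s → Fin n),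
    (∀ i j, i ≠ j → Disjoint (W i) (W j)) ∧
    (Finset.univ.biUnion W).card ≤ r - 2 ∧
    (∀ i, v i ∉ Finset.univ.biUnion W) ∧
    (∃ A : Set (Fin n), ∀ x y, G.Adj x y →
        x ∉ Finset.univ.biUnion W → y ∉ Finset.univ.biUnion W →
        ((x ∈ A ∧ y ∉ A) ∨ (x ∉ A ∧ y ∈ A))) ∧
    (∀ i j, i ≠ j → ∀ x ∈ W i, ∀ y ∈ W j, ¬ G.Adj x y) ∧
    (∀ i, ∀ x ∈ W i, ∀ y, G.Adj x y → y ∉ Finset.univ.biUnion W → y = v i)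

/-- The family `𝒢*_{n,r}`: as `FamilyG`, but with exactly `r - 2` vertices outside the
bipartite part. -/
def FamilyGStar (n r : ℕ) (G : SimpleGraph (Fin n)) : Prop :=
  ∃ (s : ℕ) (W : Fin s → Finset (Fin n)) (v : Fin s → Fin n),
    (∀ i j, i ≠ j → Disjoint (W i) (W j)) ∧
    (Finset.univ.biUnion W).card = r - 2 ∧
    (∀ i, v i ∉ Finset.univ.biUnion W) ∧
    (∃ A : Set (Fin n), ∀ x y, G.Adj x y →
        x ∉ Finset.univ.biUnion W → y ∉ Finset.univ.biUnion W →
        ((x ∈ A ∧ y ∉ A) ∨ (x ∉ A ∧ y ∈ A))) ∧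
    (∀ i j, i ≠ j → ∀ x ∈ W i, ∀ y ∈ W j, ¬ G.Adj x y) ∧
    (∀ i, ∀ x ∈ W i, ∀ y, G.Adj x y → y ∉ Finset.univ.biUnion W → y = v i)

/-- `H` is a `k`-dense bipartite graph: bipartite, 2-connected, any two distinct vertices
in the same part are joined by paths of every odd order `5 ≤ h ≤ 2k+1`, and any two
vertices in different parts are joined by paths of every even order `6 ≤ s ≤ 2k+2`. -/
def KDenseBip {V : Type*} (k : ℕ) (H : SimpleGraph V) : Prop :=
  H.TwoConnected ∧
  ∃ A : Set V,
    (∀ ⦃x y : V⦄, H.Adj x y → ((x ∈ A ∧ y ∉ A) ∨ (x ∉ A ∧ y ∈ A))) ∧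
    (∀ u v : V, u ≠ v → (u ∈ A ↔ v ∈ A) → ∀ h : ℕ, Odd h → 5 ≤ h → h ≤ 2 * k + 1 →
      ∃ p : H.Walk u v, p.IsPath ∧ p.length + 1 = h) ∧
    (∀ u v : V, ¬(u ∈ A ↔ v ∈ A) → ∀ s : ℕ, Even s → 6 ≤ s → s ≤ 2 * k + 2 →
      ∃ p : H.Walk u v, p.IsPath ∧ p.length + 1 = s)

/-- The graph obtained from the complete bipartite graph with parts `{0, …, a}` (size `a+1`)
and `{a+1, …, a+b}` (size `b`) by identifying the vertex `0` with one vertex of a clique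
on `r-1` vertices whose remaining `r-2` vertices `{a+b+1, …, a+b+r-2}` are new. -/
def bipCliqueGraph (a b r : ℕ) : SimpleGraph (Fin (a + b + r - 1)) :=
  SimpleGraph.fromRel (fun i j =>
    ((i : ℕ) ≤ a ∧ a + 1 ≤ (j : ℕ) ∧ (j : ℕ) ≤ a + b) ∨
    (((i : ℕ) = 0 ∨ a + b + 1 ≤ (i : ℕ)) ∧ ((j : ℕ) = 0 ∨ a + b + 1 ≤ (j : ℕ))))

namespace OddCycle

open Finset

section Lists

variable {V : Type*} {G : SimpleGraph V}

/-- A duplicate-free list of vertices which is a closed chain of adjacencies yields a cycle. -/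
lemma exists_cycle_of_list {L : List V} (hc : L.IsChain G.Adj) (hn : L.Nodup)
    (hlen : 3 ≤ L.length) (hclose : ∀ y ∈ L.getLast?, ∀ x ∈ L.head?, G.Adj y x) :
    ∃ (v : V) (w : G.Walk v v), w.IsCycle ∧ w.length = L.length := by
  have hne : L ≠ [] := by rintro rfl; simp at hlen
  set p := SimpleGraph.Walk.ofSupport L hne hc with hp
  have hsupp : p.support = L := SimpleGraph.Walk.support_ofSupport hne hc
  have hpath : p.IsPath := by rw [SimpleGraph.Walk.isPath_def, hsupp]; exact hn
  have hl : p.length + 1 = L.length := by rw [← SimpleGraph.Walk.length_support, hsupp]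
  have hadj : G.Adj (L.getLast hne) (L.head hne) :=
    hclose _ (by simp [List.getLast?_eq_getLast_of_ne_nil hne]) _
      (by simp [List.head?_eq_some_head hne])
  refine ⟨_, SimpleGraph.Walk.cons hadj p, ?_, by simpa using hl⟩
  rw [SimpleGraph.Walk.cons_isCycle_iff]
  refine ⟨hpath, fun he => ?_⟩
  have := hpath.length_eq_one_of_mem_edges (by rwa [Sym2.eq_swap])
  omega

variable [DecidableRel G.Adj]

/-- The number of neighbours of `x` in `T`, as an integer. -/
def degIn (G : SimpleGraph V) [DecidableRel G.Adj] (x : V) (T : Finset V) : ℤ :=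
  ∑ y ∈ T, if G.Adj x y then 1 else 0

lemma degIn_eq_card (x : V) (T : Finset V) :
    degIn G x T = ((T.filter (G.Adj x)).card : ℤ) := by
  rw [degIn, sum_boole]

variable [DecidableEq V]

/-- A vertex with many neighbours in `T` has a neighbour in `T` off a given short list. -/
lemma exists_adj_notMem {x : V} {T : Finset V} {L : List V}
    (h : (L.length : ℤ) < degIn G x T) : ∃ y ∈ T, G.Adj x y ∧ y ∉ L := by
  rw [degIn_eq_card] at h
  by_contra! hcon
  have : T.filter (G.Adj x) ⊆ L.toFinset := by
    intro y hy
    rw [mem_filter] at hy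
    exact List.mem_toFinset.2 (hcon y hy.1 hy.2)
  have := (card_le_card this).trans (List.toFinset_card_le L)
  omega

/-- Greedy alternating paths between `X` and `Y`, grown backwards from `x₀ ∈ X`. -/
lemma exists_alternating {X Y : Finset V} {d : ℕ}
    (hX : ∀ x ∈ X, (d : ℤ) ≤ degIn G x Y) (hY : ∀ y ∈ Y, (d : ℤ) ≤ degIn G y X)
    {x₀ : V} (hx₀ : x₀ ∈ X) (j : ℕ) (hj : 2 * j ≤ d) :
    ∃ x M, x ∈ X ∧ (x :: M).IsChain G.Adj ∧ (x :: M).Nodup ∧ (x :: M).length = 2 * j + 1 ∧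
      (x :: M).getLast? = some x₀ ∧ ∀ z ∈ x :: M, z ∈ X ∪ Y := by
  induction j with
  | zero => exact ⟨x₀, [], hx₀, by simp, by simp, by simp, by simp, by simp [hx₀]⟩
  | succ j ih =>
    obtain ⟨x, M, hx, hc, hn, hl, hlast, hm⟩ := ih (by omega)
    have hl' : M.length = 2 * j := by simpa using hl
    obtain ⟨y, hy, hxy, hyM⟩ := exists_adj_notMem (G := G) (x := x) (T := Y) (L := M) (by
      have := hX x hx; omega)
    obtain ⟨z, hz, hyz, hzM⟩ := exists_adj_notMem (G := G) (x := y) (T := X) (L := x :: M) (by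
      have := hY y hy; omega)
    refine ⟨z, y :: x :: M, hz, ?_, ?_, by simp; omega, ?_, ?_⟩
    · simp only [List.isChain_cons_cons]
      exact ⟨hyz.symm, hxy.symm, hc⟩
    · have h1 := hyz.ne
      have h2 := hxy.ne
      simp only [List.nodup_cons, List.mem_cons] at *
      tauto
    · simpa using hlast
    · intro w hw
      simp only [List.mem_cons] at hw
      rcases hw with rfl | rfl | hw
      · simp [hz]
      · simp [hy]
      · exact hm w (by simpa using hw)

end Lists

section Counting

variable {V : Type*} {G : SimpleGraph V} [DecidableRel G.Adj]

/-- The number of ordered adjacent pairs in `S ×ˢ T`, as an integer. -/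
def adjPairs (G : SimpleGraph V) [DecidableRel G.Adj] (S T : Finset V) : ℤ :=
  ∑ x ∈ S, degIn G x T

lemma degIn_le_card (x : V) (T : Finset V) : degIn G x T ≤ T.card := by
  rw [degIn_eq_card]; exact_mod_cast card_filter_le _ _

lemma adjPairs_comm (S T : Finset V) : adjPairs G S T = adjPairs G T S := by
  simp only [adjPairs, degIn]
  rw [sum_comm]
  simp only [G.adj_comm]

lemma adjPairs_le (S T : Finset V) : adjPairs G S T ≤ S.card * T.card := by
  refine (sum_le_card_nsmul _ _ _ fun x _ => degIn_le_card (G := G) x T).trans ?_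
  simp

lemma adjPairs_singleton_left (x : V) (T : Finset V) : adjPairs G {x} T = degIn G x T := by
  simp [adjPairs]

lemma degIn_eq_zero {x : V} {T : Finset V} (h : ∀ y ∈ T, ¬ G.Adj x y) : degIn G x T = 0 :=
  sum_eq_zero fun y hy => if_neg (h y hy)

lemma adjPairs_eq_zero {S T : Finset V} (h : ∀ x ∈ S, ∀ y ∈ T, ¬ G.Adj x y) :
    adjPairs G S T = 0 :=
  sum_eq_zero fun x hx => degIn_eq_zero (h x hx)

lemma degIn_triple_le (x y z : V) (S : Finset V) :
    degIn G x S + degIn G y S + degIn G z S ≤ S.card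
      + (S.filter fun w => G.Adj x w ∧ G.Adj y w).card
      + (S.filter fun w => G.Adj y w ∧ G.Adj z w).card
      + (S.filter fun w => G.Adj x w ∧ G.Adj z w).card := by
  simp only [degIn, card_eq_sum_ones, sum_filter]
  push_cast
  rw [← sum_add_distrib, ← sum_add_distrib, ← sum_add_distrib, ← sum_add_distrib,
    ← sum_add_distrib]
  refine sum_le_sum fun w _ => ?_
  by_cases h1 : G.Adj x w <;> by_cases h2 : G.Adj y w <;> by_cases h3 : G.Adj z w <;>
    simp [h1, h2, h3]

lemma adjPairs_univ [Fintype V] : adjPairs G univ univ = 2 * (G.edgeSet.ncard : ℤ) := by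
  have h1 : G.edgeSet.ncard = G.edgeFinset.card := by
    rw [← SimpleGraph.coe_edgeFinset, Set.ncard_coe_finset]
  have h2 := G.sum_degrees_eq_twice_card_edges
  have h3 : adjPairs G univ univ = ((∑ v, G.degree v : ℕ) : ℤ) := by
    rw [adjPairs]; push_cast
    refine sum_congr rfl fun x _ => ?_
    rw [degIn_eq_card, ← SimpleGraph.neighborFinset_eq_filter, SimpleGraph.card_neighborFinset_eq_degree]
  rw [h3, h2, h1]; push_cast; ring

/-- Some edge inside `S` has degree sum at least four times the edge density. -/
lemma exists_adj_degree_sum {S : Finset V} (h : 0 < adjPairs G S S) :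
    ∃ x ∈ S, ∃ y ∈ S, G.Adj x y ∧
      2 * adjPairs G S S ≤ S.card * (degIn G x S + degIn G y S) := by
  by_contra! hcon
  have hS : 0 < (S.card : ℤ) := by
    rcases S.eq_empty_or_nonempty with rfl | hne
    · simp [adjPairs] at h
    · exact_mod_cast hne.card_pos
  have hcs : adjPairs G S S ^ 2 ≤ S.card * ∑ x ∈ S, degIn G x S ^ 2 := sq_sum_le_card_mul_sum_sq
  have e1 : ∑ x ∈ S, ∑ y ∈ S, (if G.Adj x y then degIn G x S else 0)
      = ∑ x ∈ S, degIn G x S ^ 2 := by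
    refine sum_congr rfl fun x _ => ?_
    rw [sq]; nth_rw 2 [degIn]
    rw [sum_mul]
    refine sum_congr rfl fun y _ => ?_
    split_ifs <;> simp
  have e2 : ∑ x ∈ S, ∑ y ∈ S, (if G.Adj x y then degIn G y S else 0)
      = ∑ x ∈ S, degIn G x S ^ 2 := by
    rw [sum_comm, ← e1]
    simp only [G.adj_comm]
  have e3 : ∑ x ∈ S, ∑ y ∈ S, (if G.Adj x y then (S.card : ℤ) * (degIn G x S + degIn G y S) else 0)
      = 2 * (S.card * ∑ x ∈ S, degIn G x S ^ 2) := by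
    rw [two_mul]; nth_rw 1 [← e1]; rw [← e2, mul_sum, mul_sum, ← sum_add_distrib]
    refine sum_congr rfl fun x _ => ?_
    rw [mul_sum, mul_sum, ← sum_add_distrib]
    refine sum_congr rfl fun y _ => ?_
    split_ifs <;> ring
  have e4 : ∑ x ∈ S, ∑ y ∈ S, (if G.Adj x y then (2 * adjPairs G S S - 1) else 0)
      = (2 * adjPairs G S S - 1) * adjPairs G S S := by
    nth_rw 3 [adjPairs]
    simp only [degIn, mul_sum]
    refine sum_congr rfl fun x _ => sum_congr rfl fun y _ => ?_
    split_ifs <;> simp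
  have e5 : ∑ x ∈ S, ∑ y ∈ S, (if G.Adj x y then (S.card : ℤ) * (degIn G x S + degIn G y S) else 0)
      ≤ ∑ x ∈ S, ∑ y ∈ S, (if G.Adj x y then (2 * adjPairs G S S - 1) else 0) := by
    refine sum_le_sum fun x hx => sum_le_sum fun y hy => ?_
    split_ifs with hxy
    · have := hcon x hx y hy hxy; omega
    · rfl
  rw [e3, e4] at e5
  nlinarith

variable [DecidableEq V]

lemma degIn_union (x : V) {S T : Finset V} (h : Disjoint S T) :
    degIn G x (S ∪ T) = degIn G x S + degIn G x T := sum_union h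

lemma adjPairs_union_left {S S' : Finset V} (h : Disjoint S S') (T : Finset V) :
    adjPairs G (S ∪ S') T = adjPairs G S T + adjPairs G S' T := sum_union h

lemma adjPairs_union_right (S : Finset V) {T T' : Finset V} (h : Disjoint T T') :
    adjPairs G S (T ∪ T') = adjPairs G S T + adjPairs G S T' := by
  rw [adjPairs_comm, adjPairs_union_left h, adjPairs_comm T, adjPairs_comm T']

lemma adjPairs_union_self {S T : Finset V} (h : Disjoint S T) :
    adjPairs G (S ∪ T) (S ∪ T) = adjPairs G S S + adjPairs G T T + 2 * adjPairs G S T := by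
  rw [adjPairs_union_left h, adjPairs_union_right _ h, adjPairs_union_right _ h,
    adjPairs_comm T S]
  ring

lemma degIn_self_mem {x : V} {S : Finset V} (hx : x ∈ S) : degIn G x S ≤ S.card - 1 := by
  rw [degIn_eq_card]
  have : S.filter (G.Adj x) ⊆ S.erase x := by
    intro y hy
    rw [mem_filter] at hy
    exact mem_erase.2 ⟨hy.2.ne', hy.1⟩
  have h1 := card_le_card this
  have h2 := card_erase_add_one hx
  omega

lemma adjPairs_self_le (S : Finset V) : adjPairs G S S ≤ S.card * (S.card - 1) := by
  refine (sum_le_card_nsmul _ _ _ fun x hx => degIn_self_mem hx).trans ?_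
  simp

lemma adjPairs_erase {x : V} {S : Finset V} (hx : x ∈ S) :
    adjPairs G S S = adjPairs G (S.erase x) (S.erase x) + 2 * degIn G x S := by
  have hd : Disjoint (S.erase x) {x} := by simp
  have h := adjPairs_union_self (G := G) hd
  have hS : S.erase x ∪ {x} = S := by
    rw [union_comm, ← insert_eq, insert_erase hx]
  have h0 : degIn G x {x} = 0 := degIn_eq_zero (by simp)
  rw [hS, adjPairs_comm (S.erase x) {x}, adjPairs_singleton_left, adjPairs_singleton_left] at h
  have h1 : degIn G x S = degIn G x (S.erase x) + degIn G x {x} := by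
    rw [← degIn_union _ hd, hS]
  omega

lemma adjPairs_insert {x : V} {S : Finset V} (hx : x ∉ S) :
    adjPairs G (insert x S) (insert x S) = adjPairs G S S + 2 * degIn G x S := by
  have h := adjPairs_erase (G := G) (mem_insert_self x S)
  rw [erase_insert hx] at h
  have h0 : degIn G x {x} = 0 := degIn_eq_zero (by simp)
  rw [h, insert_eq, degIn_union _ (by simpa using hx), h0]
  ring

/-- Inclusion-exclusion for neighbourhoods inside `S`. -/
lemma degIn_add_degIn_le (x y : V) (S : Finset V) :
    degIn G x S + degIn G y S ≤
      S.card + (S.filter fun z => G.Adj x z ∧ G.Adj y z).card := by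
  rw [degIn_eq_card, degIn_eq_card, filter_and]
  have h1 := card_union_add_card_inter (S.filter (G.Adj x)) (S.filter (G.Adj y))
  have h2 : (S.filter (G.Adj x) ∪ S.filter (G.Adj y)).card ≤ S.card :=
    card_le_card (union_subset (filter_subset _ _) (filter_subset _ _))
  omega

end Counting

section Core

variable {V : Type*} {G : SimpleGraph V} [DecidableRel G.Adj] [DecidableEq V]

/-- A pair `(C, Z)` with more than `t (|C| + |Z|)` adjacencies contains a sub-pair of minimum
degree at least `t`. -/
lemma exists_subpair_minDegree {C Z : Finset V} {t : ℕ}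
    (h : (t : ℤ) * (C.card + Z.card) < adjPairs G C Z) :
    ∃ C₀ ⊆ C, ∃ Z₀ ⊆ Z, C₀.Nonempty ∧ (∀ x ∈ C₀, (t : ℤ) ≤ degIn G x Z₀) ∧
      ∀ y ∈ Z₀, (t : ℤ) ≤ degIn G y C₀ := by
  obtain ⟨⟨C₀, Z₀⟩, hmem, hmax⟩ := exists_max_image (C.powerset ×ˢ Z.powerset)
    (fun p => adjPairs G p.1 p.2 - (t : ℤ) * (p.1.card + p.2.card))
    ⟨(∅, ∅), by simp⟩
  simp only [mem_product, mem_powerset] at hmem hmax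
  have hpos := hmax (C, Z) ⟨Subset.rfl, Subset.rfl⟩
  simp only at hpos
  refine ⟨C₀, hmem.1, Z₀, hmem.2, ?_, ?_, ?_⟩
  · rw [nonempty_iff_ne_empty]
    rintro rfl
    have : adjPairs G ∅ Z₀ = 0 := by simp [adjPairs]
    rw [this] at hpos
    have : (0 : ℤ) ≤ t * (((∅ : Finset V).card : ℤ) + Z₀.card) := by positivity
    omega
  · intro x hx
    have h1 := hmax (C₀.erase x, Z₀) ⟨(erase_subset _ _).trans hmem.1, hmem.2⟩
    have h2 := card_erase_add_one hx
    have h3 : adjPairs G C₀ Z₀ = adjPairs G (C₀.erase x) Z₀ + degIn G x Z₀ :=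
      (sum_erase_add _ _ hx).symm
    simp only [h3, ← h2] at h1
    push_cast at h1
    linarith
  · intro y hy
    have h1 := hmax (C₀, Z₀.erase y) ⟨hmem.1, (erase_subset _ _).trans hmem.2⟩
    have h2 := card_erase_add_one hy
    have h3 : adjPairs G C₀ Z₀ = adjPairs G C₀ (Z₀.erase y) + degIn G y C₀ := by
      rw [adjPairs_comm, adjPairs_comm C₀]
      exact (sum_erase_add _ _ hy).symm
    simp only [h3, ← h2] at h1
    push_cast at h1
    linarith

/-- An edge whose common neighbourhood is densely attached to the rest lies on an odd cycle. -/
lemma exists_cycle_of_codegree {x y : V} {C Z : Finset V} {k : ℕ} (hk : 2 ≤ k)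
    (hxy : G.Adj x y) (hC : ∀ c ∈ C, G.Adj x c ∧ G.Adj y c)
    (hZ : x ∉ Z ∧ y ∉ Z)
    (h : (2 * k - 1 : ℤ) * (C.card + Z.card) < adjPairs G C Z) :
    ∃ (v : V) (w : G.Walk v v), w.IsCycle ∧ w.length = 2 * k + 1 := by
  obtain ⟨C₀, hC₀, Z₀, hZ₀, ⟨c, hc⟩, h1, h2⟩ := exists_subpair_minDegree (G := G) (C := C) (Z := Z)
    (t := 2 * k - 1) (by rw [Nat.cast_sub (by omega)]; push_cast; exact h)
  obtain ⟨a, M, ha, hch, hnd, hlen, hlast, hmem⟩ := exists_alternating h1 h2 hc (k - 1) (by omega)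
  have hx : x ∉ a :: M := fun hx => by
    rcases mem_union.1 (hmem x hx) with h' | h'
    · exact G.irrefl (hC x (hC₀ h')).1
    · exact hZ.1 (hZ₀ h')
  have hy : y ∉ a :: M := fun hy => by
    rcases mem_union.1 (hmem y hy) with h' | h'
    · exact G.irrefl (hC y (hC₀ h')).2
    · exact hZ.2 (hZ₀ h')
  have hL : (x :: ((a :: M) ++ [y])).length = 2 * k + 1 := by
    rw [List.length_cons, List.length_append, hlen]; simp; omega
  rw [← hL]
  refine exists_cycle_of_list ?_ ?_ (by omega) ?_
  · rw [List.cons_append, List.isChain_cons_cons]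
    refine ⟨(hC a (hC₀ ha)).1, ?_⟩
    rw [← List.cons_append, List.isChain_append]
    refine ⟨hch, by simp, ?_⟩
    rw [hlast]
    rintro _ ⟨⟩ _ ⟨⟩
    exact (hC c (hC₀ hc)).2.symm
  · rw [List.nodup_cons, List.nodup_append]
    refine ⟨?_, hnd, by simp, ?_⟩
    · rw [List.mem_append]; simp only [List.mem_singleton]
      rintro (h' | rfl)
      · exact hx h'
      · exact G.irrefl hxy
    · rintro b hb d hd rfl
      exact hy (by simpa [List.mem_singleton.1 hd] using hb)
  · intro u hu v hv
    rw [← List.cons_append, List.getLast?_append] at hu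
    simp only [List.getLast?_singleton, Option.some_or, Option.mem_def, Option.some.injEq,
      List.head?_cons] at hu hv
    subst hu; subst hv
    exact hxy.symm

/-- In a set of large minimum degree of a graph without a long odd cycle, codegrees are small. -/
lemma codegree_le {S : Finset V} {k : ℕ} (hk : 2 ≤ k)
    (hS : ∀ x ∈ S, 22 * (S.card : ℤ) - 11 ≤ 50 * degIn G x S)
    (hno : ¬ ∃ (v : V) (w : G.Walk v v), w.IsCycle ∧ w.length = 2 * k + 1)
    {x y : V} (hx : x ∈ S) (hy : y ∈ S) (hxy : G.Adj x y) :
    ((S.filter fun z => G.Adj x z ∧ G.Adj y z).card : ℤ) * (22 * S.card - 100 * k - 61)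
      ≤ (100 * k - 50) * (S.card - 2) := by
  set C := S.filter fun z => G.Adj x z ∧ G.Adj y z with hC
  set Z := (S.erase x).erase y with hZ
  have hyx : y ∈ S.erase x := mem_erase.2 ⟨hxy.ne', hy⟩
  have hZc : (Z.card : ℤ) = S.card - 2 := by
    have h1 := card_erase_add_one hx
    have h2 := card_erase_add_one hyx
    rw [← hZ] at h2
    omega
  by_contra! hcon
  refine hno (exists_cycle_of_codegree (C := C) (Z := Z) hk hxy
    (fun c hc => (mem_filter.1 hc).2) (by simp [hZ]) ?_)
  have hdeg : ∀ c ∈ C, 22 * (S.card : ℤ) - 111 ≤ 50 * degIn G c Z := by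
    intro c hc
    have hcS := (mem_filter.1 hc).1
    have h1 := hS c hcS
    have h2 : degIn G c S ≤ degIn G c Z + 2 := by
      have e1 : degIn G c S = degIn G c (S.erase x) + if G.Adj c x then 1 else 0 :=
        (sum_erase_add _ _ hx).symm
      have e2 : degIn G c (S.erase x) = degIn G c Z + if G.Adj c y then 1 else 0 :=
        (sum_erase_add _ _ hyx).symm
      split_ifs at e1 e2 <;> omega
    omega
  have hsum : (C.card : ℤ) * (22 * S.card - 111) ≤ 50 * adjPairs G C Z := by
    rw [adjPairs, mul_sum]
    refine le_trans ?_ (card_nsmul_le_sum C _ (22 * (S.card : ℤ) - 111) hdeg)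
    simp
  rw [hZc]
  nlinarith

variable [Fintype V]

/-- A vertex set of large minimum degree maximising `25 * adjPairs S S - 11 * |S| ^ 2`. -/
lemma exists_dense_core (G : SimpleGraph V) [DecidableRel G.Adj] :
    ∃ S : Finset V,
      (∀ T : Finset V, 25 * adjPairs G T T - 11 * (T.card : ℤ) ^ 2
        ≤ 25 * adjPairs G S S - 11 * (S.card : ℤ) ^ 2) ∧
      (∀ x ∈ S, 22 * (S.card : ℤ) - 11 ≤ 50 * degIn G x S) ∧
      (∀ x ∉ S, 50 * degIn G x S ≤ 22 * (S.card : ℤ) + 11) := by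
  obtain ⟨S, -, hmax⟩ := exists_max_image (univ : Finset (Finset V))
    (fun T => 25 * adjPairs G T T - 11 * (T.card : ℤ) ^ 2) ⟨∅, by simp⟩
  refine ⟨S, fun T => hmax T (mem_univ _), fun x hx => ?_, fun x hx => ?_⟩
  · have h1 := hmax (S.erase x) (mem_univ _)
    have h2 := card_erase_add_one hx
    simp only [adjPairs_erase hx, ← h2] at h1
    rw [← h2]
    push_cast at h1 ⊢
    linarith
  · have h1 := hmax (insert x S) (mem_univ _)
    simp only [adjPairs_insert hx, card_insert_of_notMem hx] at h1
    push_cast at h1 ⊢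
    linarith

end Core

section CoreBipartite

variable {V : Type*} {G : SimpleGraph V} [DecidableRel G.Adj] [DecidableEq V]

lemma no_triangle_of_dense {S : Finset V} {n k : ℕ} (hk : 2 ≤ k) (hn : 100 * k ≤ n)
    (hD : 2200 * (S.card : ℤ) ^ 2 + 201 * (n : ℤ) ^ 2 ≤ 5000 * adjPairs G S S)
    (hS : ∀ x ∈ S, 22 * (S.card : ℤ) - 11 ≤ 50 * degIn G x S)
    (hno : ¬ ∃ (v : V) (w : G.Walk v v), w.IsCycle ∧ w.length = 2 * k + 1)
    {x y z : V} (hx : x ∈ S) (hy : y ∈ S) (hz : z ∈ S)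
    (hxy : G.Adj x y) (hyz : G.Adj y z) (hxz : G.Adj x z) : False := by
  have hle := adjPairs_le (G := G) S S
  have hm26 : 26 * (k : ℤ) ≤ S.card := by
    by_contra! hcon
    have hk' : (100 * k : ℤ) ≤ n := by exact_mod_cast hn
    have hkp : (0 : ℤ) < k := by positivity
    have hmp : (0 : ℤ) ≤ S.card := by positivity
    nlinarith
  set m : ℤ := (S.card : ℤ) with hm
  have hk2 : (2 : ℤ) ≤ k := by exact_mod_cast hk
  have hn' : (100 * k : ℤ) ≤ n := by exact_mod_cast hn
  rcases le_or_gt (60 * (k : ℤ)) m with h60 | h60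
  · have key : ∀ c : ℤ, 16 * m - 33 ≤ 150 * c →
        c * (22 * m - 100 * k - 61) ≤ (100 * k - 50) * (m - 2) → False := by
      intro c h1 h2
      have p : 0 ≤ 22 * m - 100 * k - 61 := by linarith
      have h3 := mul_le_mul_of_nonneg_right h1 p
      nlinarith
    have c1 := codegree_le hk hS hno hx hy hxy
    have c2 := codegree_le hk hS hno hy hz hyz
    have c3 := codegree_le hk hS hno hx hz hxz
    have t := degIn_triple_le (G := G) x y z S
    have d1 := hS x hx
    have d2 := hS y hy
    have d3 := hS z hz
    rw [← hm] at t
    by_contra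
    refine key _ (by_contra fun h1 => ?_) c1
    refine key _ (by_contra fun h2 => ?_) c2
    refine key _ (by_contra fun h3 => ?_) c3
    linarith
  · have hpos : 0 < adjPairs G S S := by nlinarith
    obtain ⟨a, ha, b, hb, hab, h⟩ := exists_adj_degree_sum hpos
    have h' := degIn_add_degIn_le (G := G) a b S
    have hc := codegree_le hk hS hno ha hb hab
    rw [← hm] at h h'
    set c : ℤ := ((S.filter fun z => G.Adj a z ∧ G.Adj b z).card : ℤ)
    have e1 : 2 * adjPairs G S S ≤ m * (m + c) :=
      h.trans (mul_le_mul_of_nonneg_left h' (by linarith))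
    have e2 : 20100 * (k : ℤ) ^ 2 - 3 * m ^ 2 ≤ 25 * (m * c) := by nlinarith
    have p : 0 ≤ 22 * m - 100 * k - 61 := by linarith
    have e3 := mul_le_mul_of_nonneg_right e2 p
    have e4 : 25 * (m * c) * (22 * m - 100 * k - 61) ≤ 25 * m * ((100 * k - 50) * (m - 2)) := by
      have := mul_le_mul_of_nonneg_left hc (show 0 ≤ 25 * m by linarith)
      linarith
    have e5 : 25 * m * ((100 * k - 50) * (m - 2)) ≤ 2500 * k * m ^ 2 := by nlinarith
    have q : 0 < 20100 * (k : ℤ) ^ 2 - 3 * m ^ 2 := by nlinarith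
    have e6 : (20100 * (k : ℤ) ^ 2 - 3 * m ^ 2) * (44 * m - 261 * k)
        ≤ 2 * ((20100 * (k : ℤ) ^ 2 - 3 * m ^ 2) * (22 * m - 100 * k - 61)) := by
      nlinarith [mul_le_mul_of_nonneg_left (show 44 * m - 261 * k ≤ 2 * (22 * m - 100 * k - 61)
        by linarith) q.le]
    have e7 : 5000 * k * m ^ 2 < (20100 * (k : ℤ) ^ 2 - 3 * m ^ 2) * (44 * m - 261 * k) := by
      obtain ⟨u, hu⟩ : ∃ u, u = m - 26 * k := ⟨_, rfl⟩
      obtain ⟨w, hw⟩ : ∃ w, w = 60 * k - m := ⟨_, rfl⟩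
      have hu0 : 0 ≤ u := by linarith
      have hw0 : 0 < w := by linarith
      have hm' : m = u + 26 * k := by linarith
      have hw' : w = 34 * k - u := by linarith
      have k0 : (0 : ℤ) < k := by linarith
      rw [hm']
      have p1 : 0 ≤ u * w * k := by positivity
      have p2 : 0 ≤ u * u * w := by positivity
      have p3 : 0 ≤ u * w * w := by positivity
      have p4 : 0 < w * k * k := by positivity
      have p5 : 0 ≤ u * k * k := by positivity
      rw [hw'] at p1 p2 p3 p4
      nlinarith [pow_pos k0 3]
    linarith

/-- The dense core of a graph with an odd cycle length missing is bipartite. -/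
lemma exists_twoColoring_of_dense {S : Finset V} {n k : ℕ} (hk : 2 ≤ k) (hn : 100 * k ≤ n)
    (hD : 2200 * (S.card : ℤ) ^ 2 + 201 * (n : ℤ) ^ 2 ≤ 5000 * adjPairs G S S)
    (hS : ∀ x ∈ S, 22 * (S.card : ℤ) - 11 ≤ 50 * degIn G x S)
    (hno : ¬ ∃ (v : V) (w : G.Walk v v), w.IsCycle ∧ w.length = 2 * k + 1) :
    ∃ χ : V → Bool, ∀ x ∈ S, ∀ y ∈ S, G.Adj x y → χ x ≠ χ y := by
  set H := G.induce (S : Set V) with hH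
  have hfree : H.CliqueFree 3 := by
    intro s hs
    rw [SimpleGraph.is3Clique_iff] at hs
    obtain ⟨a, b, c, hab, hac, hbc, -⟩ := hs
    exact no_triangle_of_dense hk hn hD hS hno a.2 b.2 c.2 hab hbc hac
  have hn2 : (0 : ℤ) < (n : ℤ) ^ 2 := by
    have : 0 < n := by omega
    positivity
  have hle := adjPairs_le (G := G) S S
  have hcard : Fintype.card (S : Set V) = S.card := by simp
  have hm : 10 < S.card := by
    have hk' : (200 : ℤ) ≤ n := by exact_mod_cast (show 200 ≤ n by omega)
    have : (10 : ℤ) < S.card := by nlinarith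
    exact_mod_cast this
  have hdeg : ∀ x : (S : Set V), (H.degree x : ℤ) = degIn G x S := by
    intro x
    rw [degIn_eq_card, ← SimpleGraph.card_neighborFinset_eq_degree]
    norm_cast
    refine card_bij (fun y _ => y.1) ?_ ?_ ?_
    · intro y hy
      rw [SimpleGraph.mem_neighborFinset] at hy
      exact mem_filter.2 ⟨y.2, hy⟩
    · intro a _ b _ h
      exact Subtype.ext h
    · intro b hb
      rw [mem_filter] at hb
      exact ⟨⟨b, hb.1⟩, by rw [SimpleGraph.mem_neighborFinset]; exact hb.2, rfl⟩
  have hne : Nonempty (S : Set V) := by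
    obtain ⟨x, hx⟩ := card_pos.1 (show 0 < S.card by omega)
    exact ⟨⟨x, hx⟩⟩
  have hmin : (3 * 2 - 4) * Fintype.card (S : Set V) / (3 * 2 - 1) < H.minDegree := by
    obtain ⟨v, hv⟩ := H.exists_minimal_degree_vertex
    rw [hv, hcard]
    have h1 := hdeg v
    have h2 := hS v.1 v.2
    omega
  have hcol := SimpleGraph.colorable_of_cliqueFree_lt_minDegree (r := 2) hfree hmin
  obtain ⟨f⟩ := hcol
  refine ⟨fun v => if h : v ∈ S then f ⟨v, h⟩ = 0 else true, fun x hx y hy hxy => ?_⟩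
  have : f ⟨x, hx⟩ ≠ f ⟨y, hy⟩ := f.valid (show H.Adj ⟨x, hx⟩ ⟨y, hy⟩ from hxy)
  simp only [hx, hy, dif_pos]
  intro h
  apply this
  have h' := decide_eq_decide.1 h
  generalize f ⟨x, hx⟩ = a at *
  generalize f ⟨y, hy⟩ = b at *
  revert h'
  fin_cases a <;> fin_cases b <;> simp

end CoreBipartite

section DenseCore

variable {V : Type*} {G : SimpleGraph V} [DecidableRel G.Adj]

/-- A maximal dense bipartite vertex set `H`, properly coloured by `χ`, in a graph without a
cycle of length `2 * k + 1`. -/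
structure DenseCore (G : SimpleGraph V) [DecidableRel G.Adj] (k : ℕ) (H : Finset V)
    (χ : V → Bool) : Prop where
  two_le : 2 ≤ k
  proper : ∀ x ∈ H, ∀ y ∈ H, G.Adj x y → χ x ≠ χ y
  deg : ∀ x ∈ H, 22 * (H.card : ℤ) - 11 ≤ 50 * degIn G x H
  deg_out : ∀ x ∉ H, 50 * degIn G x H ≤ 22 * (H.card : ℤ) + 11
  maximal : ∀ T : Finset V, 25 * adjPairs G T T - 11 * (T.card : ℤ) ^ 2
    ≤ 25 * adjPairs G H H - 11 * (H.card : ℤ) ^ 2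
  large : 81 * (k : ℤ) ≤ H.card
  no_cycle : ¬ ∃ (v : V) (w : G.Walk v v), w.IsCycle ∧ w.length = 2 * k + 1

variable {k : ℕ} {H : Finset V} {χ : V → Bool}

/-- The vertices of `H` of colour `c`. -/
def side (H : Finset V) (χ : V → Bool) (c : Bool) : Finset V := H.filter fun x => χ x = c

lemma mem_side {H : Finset V} {χ : V → Bool} {c : Bool} {x : V} :
    x ∈ side H χ c ↔ x ∈ H ∧ χ x = c := mem_filter

lemma disjoint_side (H : Finset V) (χ : V → Bool) (c : Bool) :
    Disjoint (side H χ c) (side H χ !c) := by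
  rw [disjoint_left]
  intro x hx hx'
  rw [mem_side] at hx hx'
  rw [hx.2] at hx'
  exact absurd hx'.2 (by cases c <;> simp)

lemma DenseCore.le_card (h : DenseCore G k H χ) : 162 ≤ (H.card : ℤ) := by
  have := h.large
  have := h.two_le
  omega

variable [DecidableEq V]

lemma side_union (H : Finset V) (χ : V → Bool) (c : Bool) :
    side H χ c ∪ side H χ (!c) = H := by
  ext x
  simp only [mem_union, mem_side]
  cases χ x <;> cases c <;> simp

lemma card_side_add (H : Finset V) (χ : V → Bool) (c : Bool) :
    (side H χ c).card + (side H χ !c).card = H.card := by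
  rw [← card_union_of_disjoint (disjoint_side H χ c), side_union]

lemma degIn_eq_side {H : Finset V} {χ : V → Bool}
    {x : V} {c : Bool} (h : ∀ y ∈ H, G.Adj x y → χ y = c) :
    degIn G x H = degIn G x (side H χ c) := by
  conv_lhs => rw [← side_union H χ c]
  rw [degIn_union _ (disjoint_side H χ c),
    degIn_eq_zero (T := side H χ !c), add_zero]
  intro y hy hxy
  rw [mem_side] at hy
  have := h y hy.1 hxy
  rw [hy.2] at this
  cases c <;> simp at this

/-- Adjacent pairs of a properly two-coloured set are counted by its bipartition. -/
lemma adjPairs_eq_side {B : Finset V} {f : V → Bool}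
    (hpr : ∀ x ∈ B, ∀ y ∈ B, G.Adj x y → f x ≠ f y) (c : Bool) :
    adjPairs G B B = 2 * adjPairs G (side B f c) (side B f !c) := by
  have h0 : ∀ d, adjPairs G (side B f d) (side B f d) = 0 := fun d =>
    adjPairs_eq_zero fun x hx y hy hxy => by
      rw [mem_side] at hx hy
      exact hpr x hx.1 y hy.1 hxy (hx.2.trans hy.2.symm)
  conv_lhs => rw [← side_union B f c]
  rw [adjPairs_union_self (disjoint_side B f c), h0, h0]
  ring

lemma two_mul_adjPairs_le_sq {B : Finset V} {f : V → Bool}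
    (hpr : ∀ x ∈ B, ∀ y ∈ B, G.Adj x y → f x ≠ f y) :
    2 * adjPairs G B B ≤ (B.card : ℤ) ^ 2 := by
  have h1 : ((side B f true).card : ℤ) + (side B f !true).card = B.card := by
    exact_mod_cast card_side_add B f true
  have h2 := adjPairs_le (G := G) (side B f true) (side B f !true)
  rw [adjPairs_eq_side hpr true, ← h1]
  nlinarith [sq_nonneg (((side B f true).card : ℤ) - (side B f !true).card)]

namespace DenseCore

lemma degIn_side (h : DenseCore G k H χ) {x : V} (hx : x ∈ H) :
    degIn G x H = degIn G x (side H χ !χ x) :=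
  degIn_eq_side fun y hy hxy => by
    have := h.proper x hx y hy hxy
    cases h1 : χ x <;> cases h2 : χ y <;> simp_all

lemma card_side_le (h : DenseCore G k H χ) (c : Bool) :
    50 * ((side H χ c).card : ℤ) ≤ 28 * H.card + 11 := by
  have h1 := card_side_add H χ c
  have h3 := h.le_card
  by_cases hne : (side H χ c).Nonempty
  · obtain ⟨x, hx⟩ := hne
    rw [mem_side] at hx
    have h2 := h.deg x hx.1
    rw [h.degIn_side hx.1, hx.2] at h2
    have := degIn_le_card (G := G) x (side H χ !c)
    omega
  · rw [not_nonempty_iff_eq_empty] at hne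
    rw [hne]
    simp; omega

lemma exists_common_neighbor (h : DenseCore G k H χ) {u v : V} (hu : u ∈ H) (hv : v ∈ H)
    (huv : χ u = χ v) {L : List V} (hL : L.length ≤ 2 * k + 2) :
    ∃ c ∈ side H χ (!χ u), G.Adj u c ∧ G.Adj v c ∧ c ∉ L := by
  have h1 := h.deg u hu
  have h2 := h.deg v hv
  rw [h.degIn_side hu] at h1
  rw [h.degIn_side hv, ← huv] at h2
  have h3 := degIn_add_degIn_le (G := G) u v (side H χ !χ u)
  have h4 := h.card_side_le (!χ u)
  have h5 := h.large
  have h6 := h.two_le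
  by_contra! hcon
  have h7 : ((side H χ !χ u).filter fun z => G.Adj u z ∧ G.Adj v z) ⊆ L.toFinset := by
    intro y hy
    rw [mem_filter] at hy
    exact List.mem_toFinset.2 (hcon y hy.1 hy.2.1 hy.2.2)
  have := (card_le_card h7).trans (List.toFinset_card_le L)
  omega

lemma exists_path_same (h : DenseCore G k H χ) {u v : V} (hu : u ∈ H) (hv : v ∈ H)
    (hne : u ≠ v) (huv : χ u = χ v) (t : V) {j : ℕ} (hj : 1 ≤ j) (hjk : j ≤ k) :
    ∃ L : List V, L.IsChain G.Adj ∧ L.Nodup ∧ L.length = 2 * j + 1 ∧ L.head? = some u ∧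
      L.getLast? = some v ∧ (∀ z ∈ L, z ∈ H) ∧ (χ t ≠ χ u → t ∉ L) := by
  set X := (side H χ (χ u)).erase u with hX
  set Y := (side H χ (!χ u)).erase t with hY
  have hlarge := h.large
  have h2 := h.two_le
  have hdel : ∀ (x s : V) (T : Finset V), degIn G x T ≤ degIn G x (T.erase s) + 1 := by
    intro x s T
    by_cases hs : s ∈ T
    · have e1 : degIn G x T = degIn G x (T.erase s) + if G.Adj x s then 1 else 0 :=
        (sum_erase_add _ _ hs).symm
      split_ifs at e1 <;> omega
    · rw [erase_eq_of_notMem hs]; omega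
  have hXd : ∀ x ∈ X, ((2 * k : ℕ) : ℤ) ≤ degIn G x Y := by
    intro x hx
    have hx' := mem_side.1 (mem_of_mem_erase hx)
    have d := h.deg x hx'.1
    rw [h.degIn_side hx'.1, hx'.2] at d
    have := hdel x t (side H χ !χ u)
    rw [← hY] at this
    omega
  have hYd : ∀ y ∈ Y, ((2 * k : ℕ) : ℤ) ≤ degIn G y X := by
    intro y hy
    have hy' := mem_side.1 (mem_of_mem_erase hy)
    have d := h.deg y hy'.1
    rw [h.degIn_side hy'.1, hy'.2, Bool.not_not] at d
    have := hdel y u (side H χ (χ u))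
    rw [← hX] at this
    omega
  have hvX : v ∈ X := mem_erase.2 ⟨hne.symm, mem_side.2 ⟨hv, huv.symm⟩⟩
  obtain ⟨x, M, hx, hc, hn, hl, hlast, hm⟩ :=
    exists_alternating hXd hYd hvX (j - 1) (by omega)
  have hxs := mem_side.1 (mem_of_mem_erase hx)
  obtain ⟨c, hcs, huc, hxc, hcL⟩ := h.exists_common_neighbor (L := t :: x :: M) hu hxs.1
    hxs.2.symm (by rw [List.length_cons, hl]; omega)
  have hcs' := mem_side.1 hcs
  have hu_not : u ∉ x :: M := by
    intro hmem
    rcases mem_union.1 (hm u hmem) with h' | h'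
    · simp [hX] at h'
    · have := (mem_side.1 (mem_of_mem_erase h')).2
      cases hh : χ u <;> simp [hh] at this
  refine ⟨u :: c :: x :: M, ?_, ?_, by simp only [List.length_cons] at hl ⊢; omega, by simp, ?_,
    ?_, ?_⟩
  · simp only [List.isChain_cons_cons]
    exact ⟨huc, hxc.symm, hc⟩
  · have := huc.ne
    simp only [List.nodup_cons, List.mem_cons] at *
    tauto
  · simpa using hlast
  · intro z hz
    simp only [List.mem_cons] at hz
    rcases hz with rfl | rfl | hz
    · exact hu
    · exact hcs'.1
    · rcases mem_union.1 (hm z (by simpa using hz)) with h' | h' <;>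
        exact (mem_side.1 (mem_of_mem_erase h')).1
  · intro ht hmem
    rw [List.mem_cons, List.mem_cons] at hmem
    rcases hmem with rfl | rfl | hmem
    · exact ht rfl
    · simp at hcL
    · rcases mem_union.1 (hm t hmem) with h' | h'
      · exact ht (mem_side.1 (mem_of_mem_erase h')).2
      · simp [hY] at h'

/-- Any two vertices of the core are joined, inside the core, by paths of every order of the
right parity in the range from `3` to `2 * k + 1`. -/
lemma exists_path (h : DenseCore G k H χ) {u v : V} (hu : u ∈ H) (hv : v ∈ H)
    (hne : u ≠ v) {N : ℕ} (hN : 3 ≤ N) (hNk : N ≤ 2 * k + 1) (hpar : χ u = χ v ↔ Odd N) :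
    ∃ L : List V, L.IsChain G.Adj ∧ L.Nodup ∧ L.length = N ∧ L.head? = some u ∧
      L.getLast? = some v ∧ ∀ z ∈ L, z ∈ H := by
  by_cases huv : χ u = χ v
  · obtain ⟨j, hj⟩ := hpar.1 huv
    obtain ⟨L, h1, h2, h3, h4, h5, h6, -⟩ :=
      h.exists_path_same hu hv hne huv u (j := j) (by omega) (by omega)
    exact ⟨L, h1, h2, by omega, h4, h5, h6⟩
  · have hev : Even N := by
      rw [← Nat.not_odd_iff_even]; exact fun ho => huv (hpar.2 ho)
    obtain ⟨j, hj⟩ := hev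
    obtain ⟨w, hw, huw, -, hwv⟩ := h.exists_common_neighbor (L := [v]) hu hu rfl (by simp)
    rw [mem_side] at hw
    have hwv' : χ w = χ v := by
      rw [hw.2]; cases h1 : χ u <;> cases h2 : χ v <;> simp_all
    have hwu : χ u ≠ χ w := h.proper u hu w hw.1 huw
    obtain ⟨L, h1, h2, h3, h4, h5, h6, h7⟩ :=
      h.exists_path_same hw.1 hv (by simpa using hwv) hwv' u (j := j - 1) (by omega) (by omega)
    refine ⟨u :: L, ?_, ?_, by simp only [List.length_cons]; omega, by simp, ?_, ?_⟩
    · rw [List.isChain_cons]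
      refine ⟨?_, h1⟩
      rw [h4]
      rintro _ ⟨⟩
      exact huw
    · exact List.nodup_cons.2 ⟨h7 hwu, h2⟩
    · rw [List.getLast?_cons, h5]; simp
    · intro z hz
      rcases List.mem_cons.1 hz with rfl | hz
      · exact hu
      · exact h6 z hz

end DenseCore

end DenseCore

section Ears

variable {V : Type*} {G : SimpleGraph V}

/-- Two disjoint paths whose ends are joined crosswise form a cycle. -/
lemma exists_cycle_of_two_paths {M L : List V} (hM : M.IsChain G.Adj) (hL : L.IsChain G.Adj)
    (hMn : M.Nodup) (hLn : L.Nodup) (hd : ∀ x ∈ M, x ∉ L) (hM0 : M ≠ []) (hL0 : L ≠ [])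
    (h1 : ∀ x ∈ M.getLast?, ∀ y ∈ L.head?, G.Adj x y)
    (h2 : ∀ x ∈ L.getLast?, ∀ y ∈ M.head?, G.Adj x y) {l : ℕ} (hl : 3 ≤ l)
    (hlen : M.length + L.length = l) :
    ∃ (v : V) (w : G.Walk v v), w.IsCycle ∧ w.length = l := by
  rw [← hlen, ← List.length_append]
  refine exists_cycle_of_list (List.isChain_append.2 ⟨hM, hL, h1⟩) ?_ ?_ ?_
  · rw [List.nodup_append]
    exact ⟨hMn, hLn, fun x hx y hy hxy => hd x hx (hxy ▸ hy)⟩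
  · rw [List.length_append]; omega
  · rw [List.getLast?_append_of_ne_nil _ hL0, List.head?_append_of_ne_nil _ hM0]
    exact h2

/-- `M` is the list of interior vertices of an ear of `H` with ends `a` and `b`. -/
structure IsEar (G : SimpleGraph V) (H : Finset V) (a b : V) (M : List V) : Prop where
  left_mem : a ∈ H
  right_mem : b ∈ H
  ne : a ≠ b
  ne_nil : M ≠ []
  nodup : M.Nodup
  out : ∀ z ∈ M, z ∉ H
  chain : M.IsChain G.Adj
  head : ∀ y ∈ M.head?, G.Adj a y
  last : ∀ x ∈ M.getLast?, G.Adj x b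

/-- An ear is wrong if closing it up inside the core gives odd cycles. -/
def IsWrongEar (G : SimpleGraph V) (H : Finset V) (χ : V → Bool) (a b : V) (M : List V) : Prop :=
  IsEar G H a b M ∧ (χ a = χ b ↔ Even M.length)

/-- `M` is a wrong ear of minimum length. -/
structure IsShortestWrongEar (G : SimpleGraph V) (H : Finset V) (χ : V → Bool) (a b : V)
    (M : List V) : Prop where
  wrong : IsWrongEar G H χ a b M
  minimal : ∀ a' b' M', IsWrongEar G H χ a' b' M' → M.length ≤ M'.length

namespace IsShortestWrongEar

variable {H : Finset V} {χ : V → Bool} {a b : V} {M : List V}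

lemma color_eq (h : IsShortestWrongEar G H χ a b M) (hM : 2 ≤ M.length) {x g g' : V}
    (hx : x ∉ H) (hg : g ∈ H) (hg' : g' ∈ H) (hxg : G.Adj x g) (hxg' : G.Adj x g') :
    χ g = χ g' := by
  by_contra hne
  have := h.minimal g g' [x] ⟨⟨hg, hg', by rintro rfl; exact hne rfl, by simp, by simp,
    by simpa using hx, by simp, by simpa using hxg.symm, by simpa using hxg'⟩, by simpa using hne⟩
  simp at this
  omega

lemma color_ne (h : IsShortestWrongEar G H χ a b M) (hM : 3 ≤ M.length) {x y g g' : V}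
    (hx : x ∉ H) (hy : y ∉ H) (hg : g ∈ H) (hg' : g' ∈ H) (hxy : G.Adj x y) (hxg : G.Adj x g)
    (hyg' : G.Adj y g') (hgg' : g ≠ g') : χ g ≠ χ g' := by
  intro heq
  have := h.minimal g g' [x, y] ⟨⟨hg, hg', hgg', by simp, by simpa using hxy.ne,
    by simp [hx, hy], by simpa using hxy, by simpa using hxg.symm, by simpa using hyg'⟩,
    by simpa using heq⟩
  simp at this
  omega

lemma eq_or_eq_of_interior {M₁ M₂ : List V} {x : V}
    (h : IsShortestWrongEar G H χ a b (M₁ ++ x :: M₂)) (h₁ : M₁ ≠ []) (h₂ : M₂ ≠ [])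
    {g : V} (hg : g ∈ H) (hxg : G.Adj x g) : g = a ∨ g = b := by
  by_contra! hcon
  obtain ⟨he, hpar⟩ := h.wrong
  have hch := List.isChain_append.1 he.chain
  have hnd := List.nodup_append.1 he.nodup
  have e1 : IsEar G H a g (M₁ ++ [x]) := by
    refine ⟨he.left_mem, hg, hcon.1.symm, by simp, ?_, ?_, ?_, ?_, ?_⟩
    · have : (M₁ ++ x :: M₂) = (M₁ ++ [x]) ++ M₂ := by simp
      exact (this ▸ he.nodup).of_append_left
    · intro z hz; exact he.out z (by simp only [List.mem_append, List.mem_cons] at hz ⊢; simp at hz; tauto)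
    · have : (M₁ ++ x :: M₂) = (M₁ ++ [x]) ++ M₂ := by simp
      exact (this ▸ he.chain).left_of_append
    · have := he.head
      rw [List.head?_append_of_ne_nil _ h₁] at this ⊢
      exact this
    · simpa using hxg
  have e2 : IsEar G H g b (x :: M₂) := by
    refine ⟨hg, he.right_mem, hcon.2, by simp, hnd.2.1, ?_, hch.2.1, ?_, ?_⟩
    · intro z hz; exact he.out z (List.mem_append_right _ hz)
    · simpa using hxg.symm
    · have := he.last
      rw [List.getLast?_append_of_ne_nil _ (by simp)] at this
      exact this
  have l1 : 0 < M₁.length := List.length_pos_iff.2 h₁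
  have l2 : 0 < M₂.length := List.length_pos_iff.2 h₂
  have w1 : ¬ (χ a = χ g ↔ Even (M₁ ++ [x]).length) := fun hw => by
    have := h.minimal _ _ _ ⟨e1, hw⟩
    simp only [List.length_append, List.length_cons, List.length_nil] at this
    omega
  have w2 : ¬ (χ g = χ b ↔ Even (x :: M₂).length) := fun hw => by
    have := h.minimal _ _ _ ⟨e2, hw⟩
    simp only [List.length_append, List.length_cons] at this
    omega
  simp only [List.length_append, List.length_cons, List.length_nil, zero_add,
    Nat.even_iff] at hpar w1 w2
  cases ha : χ a <;> cases hb : χ b <;> cases hg' : χ g <;>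
    simp only [ha, hb, hg', true_iff, false_iff, reduceCtorEq] at hpar w1 w2 <;> omega

end IsShortestWrongEar

variable [DecidableRel G.Adj] [DecidableEq V] {k : ℕ} {H : Finset V} {χ : V → Bool}

lemma DenseCore.length_of_wrongEar (h : DenseCore G k H χ) {a b : V} {M : List V}
    (hM : IsWrongEar G H χ a b M) : 2 * k - 1 ≤ M.length := by
  by_contra! hcon
  obtain ⟨he, hpar⟩ := hM
  have hk := h.two_le
  have hpos : 0 < M.length := List.length_pos_iff.2 he.ne_nil
  obtain ⟨L, h1, h2, h3, h4, h5, h6⟩ := h.exists_path he.right_mem he.left_mem he.ne.symm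
    (N := 2 * k + 1 - M.length) (by omega) (by omega) (by
      rw [eq_comm, hpar, Nat.even_iff, Nat.odd_iff]; omega)
  refine h.no_cycle (exists_cycle_of_two_paths he.chain h1 he.nodup h2
    (fun x hx hx' => he.out x hx (h6 x hx')) he.ne_nil ?_ ?_ ?_ (by omega) (by omega))
  · rintro rfl; simp at h4
  · rw [h4]; rintro x hx _ ⟨⟩; exact he.last x hx
  · rw [h5]; rintro _ ⟨⟩ y hy; exact he.head y hy

/-- The edge count outside the core: a set `P` of `2 * k - 1` or `2 * k` vertices which
contributes few edges contradicts the assumption on the number of edges. -/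
lemma DenseCore.false_of_few_edges [Fintype V] (h : DenseCore G k H χ) {P : Finset V}
    (hd : Disjoint H P) (hP1 : 2 * (k : ℤ) - 1 ≤ P.card) (hP2 : (P.card : ℤ) ≤ 2 * k)
    (hE : ((Fintype.card V : ℤ) - 2 * k + 1) ^ 2 - 1 + 4 * k * (2 * k - 1)
      ≤ 2 * adjPairs G univ univ)
    (hP : 2 * adjPairs G (H ∪ P) (H ∪ P)
      ≤ ((H.card : ℤ) + P.card - 2 * k + 1) ^ 2 + 4 * k * (2 * k - 1) - 4) : False := by
  set Q : Finset V := univ \ (H ∪ P) with hQ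
  have hd1 : Disjoint (H ∪ P) Q := disjoint_sdiff
  have hd2 : Disjoint H Q := disjoint_of_subset_left subset_union_left hd1
  have hd3 : Disjoint P Q := disjoint_of_subset_left subset_union_right hd1
  have hu : (univ : Finset V) = (H ∪ P) ∪ Q := by rw [hQ, union_sdiff_of_subset (subset_univ _)]
  have hcard : (Fintype.card V : ℤ) = H.card + P.card + Q.card := by
    rw [← card_univ, hu, card_union_of_disjoint hd1, card_union_of_disjoint hd]; push_cast; ring
  have e1 : adjPairs G univ univ
      = adjPairs G (H ∪ P) (H ∪ P) + adjPairs G Q Q + 2 * (adjPairs G H Q + adjPairs G P Q) := by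
    rw [hu, adjPairs_union_self hd1, adjPairs_union_left hd Q]
  have e2 := adjPairs_union_self (G := G) hd2
  have e3 := h.maximal (H ∪ Q)
  rw [card_union_of_disjoint hd2] at e3
  push_cast at e3
  have e4 := adjPairs_le (G := G) P Q
  have hm := h.large
  have hk : (2 : ℤ) ≤ k := by exact_mod_cast h.two_le
  have hq : (0 : ℤ) ≤ Q.card := Int.natCast_nonneg _
  rw [hcard] at hE
  rw [e1] at hE
  obtain ⟨q, hq'⟩ : ∃ q : ℤ, q = Q.card := ⟨_, rfl⟩
  obtain ⟨p, hp'⟩ : ∃ p : ℤ, p = P.card := ⟨_, rfl⟩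
  obtain ⟨m, hm'⟩ : ∃ m : ℤ, m = H.card := ⟨_, rfl⟩
  rw [← hq', ← hp', ← hm'] at hE
  rw [← hp', ← hm'] at hP
  rw [← hq', ← hm'] at e3
  rw [← hp', ← hq'] at e4
  rw [← hp'] at hP1 hP2
  rw [← hm'] at hm
  rw [← hq'] at hq
  have e5 : p * q ≤ 2 * k * q := mul_le_mul_of_nonneg_right hP2 hq
  have e6 : 25 * (adjPairs G univ univ - adjPairs G (H ∪ P) (H ∪ P))
      ≤ 11 * (2 * m * q + q ^ 2) + 100 * k * q := by
    rw [e1]; linarith [e2, e3, e4, e5]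
  have e7 : 25 * ((m + p + q - 2 * k + 1) ^ 2 - (m + p - 2 * k + 1) ^ 2)
      = 25 * (2 * (m + p - 2 * k + 1) * q + q ^ 2) := by ring
  have e8 : 2 * m * q ≤ 2 * (m + p - 2 * k + 1) * q := by nlinarith
  have e9 : 81 * k * q ≤ m * q := mul_le_mul_of_nonneg_right hm hq
  have e10 : 0 ≤ k * q := by positivity
  have e11 : 0 ≤ q ^ 2 := by positivity
  linarith

end Ears

section NoWrongEar

variable {V : Type*} {G : SimpleGraph V}

lemma IsShortestWrongEar.eq_or_eq {H : Finset V} {χ : V → Bool} {a b p : V} {N R : List V}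
    (h : IsShortestWrongEar G H χ a b (p :: (N ++ R))) (hR : R ≠ []) {x g : V} (hx : x ∈ N)
    (hg : g ∈ H) (hxg : G.Adj x g) : g = a ∨ g = b := by
  obtain ⟨s, t, rfl⟩ := List.append_of_mem hx
  have e : p :: ((s ++ x :: t) ++ R) = (p :: s) ++ x :: (t ++ R) := by simp
  rw [e] at h
  exact h.eq_or_eq_of_interior (by simp) (by simp [hR]) hg hxg

variable [DecidableRel G.Adj]

lemma degIn_le_card_of_forall {x : V} {T U : Finset V} (h : ∀ y ∈ T, G.Adj x y → y ∈ U) :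
    degIn G x T ≤ U.card := by
  rw [degIn_eq_card]
  exact_mod_cast card_le_card fun y hy => h y (mem_filter.1 hy).1 (mem_filter.1 hy).2

lemma sum_degIn_le {N T : Finset V} {c : ℤ} (h : ∀ x ∈ N, degIn G x T ≤ c) :
    adjPairs G N T ≤ N.card * c := by
  exact (sum_le_card_nsmul N _ c h).trans (by simp)

variable [DecidableEq V] {k : ℕ} {H : Finset V} {χ : V → Bool}

lemma adjPairs_add_le {A B A₁ B₁ : Finset V} (hA : A₁ ⊆ A) (hB : B₁ ⊆ B)
    (h : ∀ x ∈ A₁, ∀ y ∈ B₁, ¬ G.Adj x y) :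
    adjPairs G A B + A₁.card * B₁.card ≤ A.card * B.card := by
  have e1 : adjPairs G A B = adjPairs G A₁ (B \ B₁) + adjPairs G (A \ A₁) B := by
    have h0 : adjPairs G A₁ B = adjPairs G A₁ (B₁ ∪ (B \ B₁)) := by
      rw [union_sdiff_of_subset hB]
    have h1 : adjPairs G A B = adjPairs G (A₁ ∪ (A \ A₁)) B := by
      rw [union_sdiff_of_subset hA]
    rw [h1, adjPairs_union_left disjoint_sdiff, h0, adjPairs_union_right _ disjoint_sdiff,
      adjPairs_eq_zero h, zero_add]
  have h1 := adjPairs_le (G := G) A₁ (B \ B₁)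
  have h2 := adjPairs_le (G := G) (A \ A₁) B
  rw [card_sdiff_of_subset hB, Nat.cast_sub (card_le_card hB)] at h1
  rw [card_sdiff_of_subset hA, Nat.cast_sub (card_le_card hA)] at h2
  linarith

variable [Fintype V]

/-- There is no shortest wrong ear with `2 * k - 1` interior vertices. -/
lemma DenseCore.no_cross_ear (h : DenseCore G k H χ)
    (hE : ((Fintype.card V : ℤ) - 2 * k + 1) ^ 2 - 1 + 4 * k * (2 * k - 1)
      ≤ 2 * adjPairs G univ univ) {a b p q : V} {N : List V}
    (hM : IsShortestWrongEar G H χ a b (p :: (N ++ [q]))) (hN : N.length + 3 = 2 * k) :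
    False := by
  have hk := h.two_le
  obtain ⟨he, hpar⟩ := hM.wrong
  have hlen : (p :: (N ++ [q])).length = 2 * k - 1 := by simp; omega
  have hlen2 : 2 ≤ (p :: (N ++ [q])).length := by omega
  have hab : χ b = !χ a := by
    have : ¬ Even (p :: (N ++ [q])).length := by rw [hlen, Nat.even_iff]; omega
    have := mt hpar.1 this
    cases h1 : χ a <;> cases h2 : χ b <;> simp_all
  have hpa : G.Adj a p := he.head p (by simp)
  have hqb : G.Adj q b := he.last q (by simp [List.getLast?_cons])
  have hpH : p ∉ H := he.out p (by simp)
  have hqH : q ∉ H := he.out q (by simp)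
  have hnd := he.nodup
  rw [List.nodup_cons, List.nodup_append] at hnd
  have hpq : p ≠ q := fun e => hnd.1 (by simp [e])
  have d1 : degIn G p H = degIn G p (side H χ (χ a)) := degIn_eq_side fun y hy hxy =>
    hM.color_eq hlen2 hpH hy he.left_mem hxy hpa.symm
  have d2 : degIn G q H = degIn G q (side H χ !χ a) := degIn_eq_side fun y hy hxy => by
    rw [← hab]
    exact hM.color_eq hlen2 hqH hy he.right_mem hxy hqb
  have hnone := adjPairs_add_le (G := G) (filter_subset (G.Adj p) (side H χ (χ a)))
    (filter_subset (G.Adj q) (side H χ !χ a)) (by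
      intro x hx y hy hxy
      rw [mem_filter, mem_side] at hx hy
      refine h.no_cycle (exists_cycle_of_two_paths he.chain (L := [y, x])
        (by simpa using hxy.symm) he.nodup (by simpa using hxy.ne') ?_ he.ne_nil (by simp) ?_ ?_
        (by omega) (by rw [hlen]; simp; omega))
      · intro z hz hz'
        simp only [List.mem_cons, List.not_mem_nil, or_false] at hz'
        rcases hz' with rfl | rfl
        · exact he.out _ hz hy.1.1
        · exact he.out _ hz hx.1.1
      · simpa [List.getLast?_cons] using hy.2
      · simpa using hx.2.symm)
  rw [← degIn_eq_card, ← degIn_eq_card, ← d1, ← d2] at hnone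
  have hin : ∀ x ∈ N.toFinset, degIn G x H ≤ 1 := by
    intro x hx
    rw [List.mem_toFinset] at hx
    have hxH : x ∉ H := he.out x (by simp [hx])
    rw [degIn_eq_card]
    norm_cast
    rw [card_le_one]
    intro y hy z hz
    rw [mem_filter] at hy hz
    have hc := hM.color_eq hlen2 hxH hy.1 hz.1 hy.2 hz.2
    rcases hM.eq_or_eq (by simp) hx hy.1 hy.2 with rfl | rfl <;>
    rcases hM.eq_or_eq (by simp) hx hz.1 hz.2 with rfl | rfl
    · rfl
    · rw [hab] at hc; cases h1 : χ y <;> simp [h1] at hc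
    · rw [hab] at hc; cases h1 : χ z <;> simp [h1] at hc
    · rfl
  have g1 : 1 ≤ degIn G p H := by
    rw [degIn_eq_card]
    exact_mod_cast card_pos.2 ⟨a, mem_filter.2 ⟨he.left_mem, hpa.symm⟩⟩
  have g2 : 1 ≤ degIn G q H := by
    rw [degIn_eq_card]
    exact_mod_cast card_pos.2 ⟨b, mem_filter.2 ⟨he.right_mem, hqb⟩⟩
  set N' := N.toFinset with hN'
  have hNc : (N'.card : ℤ) = 2 * k - 3 := by
    rw [hN', List.toFinset_card_of_nodup hnd.2.1]; omega
  have hdE : Disjoint N' {p, q} := by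
    rw [disjoint_left]
    intro x hx hx'
    rw [hN', List.mem_toFinset] at hx
    rcases mem_insert.1 hx' with rfl | hx'
    · exact hnd.1 (by simp [hx])
    · rw [mem_singleton] at hx'
      exact hnd.2.2.2 x hx q (by simp) hx'
  have hEc : (({p, q} : Finset V).card : ℤ) = 2 := by rw [card_pair hpq]; rfl
  have hdH : Disjoint H (N' ∪ {p, q}) := by
    rw [disjoint_right]
    intro x hx
    apply he.out
    simp only [hN', mem_union, List.mem_toFinset, mem_insert, mem_singleton] at hx
    simp; tauto
  have hPc : ((N' ∪ {p, q}).card : ℤ) = 2 * k - 1 := by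
    rw [card_union_of_disjoint hdE]; push_cast; rw [hNc, hEc]; ring
  refine h.false_of_few_edges hdH (by omega) (by omega) hE ?_
  have f1 := adjPairs_union_self (G := G) hdH
  have f2 := adjPairs_self_le (G := G) (N' ∪ {p, q})
  have f3 : adjPairs G H (N' ∪ {p, q}) = adjPairs G N' H + (degIn G p H + degIn G q H) := by
    rw [adjPairs_comm, adjPairs_union_left hdE]
    congr 1
    exact sum_pair hpq
  have f4 := sum_degIn_le hin
  have f5 := adjPairs_eq_side h.proper (χ a)
  have f6 : ((side H χ (χ a)).card : ℤ) + (side H χ !χ a).card = H.card := by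
    exact_mod_cast card_side_add H χ (χ a)
  rw [hPc] at f2 ⊢
  rw [hNc] at f4
  rw [f1, f3, ← f6]
  nlinarith [sq_nonneg (((side H χ (χ a)).card : ℤ) - (side H χ !χ a).card),
    mul_nonneg (sub_nonneg.2 g1) (sub_nonneg.2 g2)]

/-- There is no shortest wrong ear with `2 * k` interior vertices. -/
lemma DenseCore.no_even_ear (h : DenseCore G k H χ)
    (hE : ((Fintype.card V : ℤ) - 2 * k + 1) ^ 2 - 1 + 4 * k * (2 * k - 1)
      ≤ 2 * adjPairs G univ univ) {a b p q : V} {N : List V}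
    (hM : IsShortestWrongEar G H χ a b (p :: (N ++ [q]))) (hN : N.length + 2 = 2 * k) :
    False := by
  have hk := h.two_le
  obtain ⟨he, hpar⟩ := hM.wrong
  have hlen : (p :: (N ++ [q])).length = 2 * k := by simp; omega
  have hlen3 : 3 ≤ (p :: (N ++ [q])).length := by omega
  have hab : χ a = χ b := hpar.2 (by rw [hlen, Nat.even_iff]; omega)
  have hpa : G.Adj a p := he.head p (by simp)
  have hqb : G.Adj q b := he.last q (by simp [List.getLast?_cons])
  have hpH : p ∉ H := he.out p (by simp)
  have hqH : q ∉ H := he.out q (by simp)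
  have hnd := he.nodup
  rw [List.nodup_cons, List.nodup_append] at hnd
  have hpq : p ≠ q := fun e => hnd.1 (by simp [e])
  have d1 : degIn G p H = degIn G p (side H χ (χ a)) := degIn_eq_side fun y hy hxy =>
    hM.color_eq (by omega) hpH hy he.left_mem hxy hpa.symm
  have d2 : degIn G q H = degIn G q (side H χ (χ a)) := degIn_eq_side fun y hy hxy => by
    rw [hab]
    exact hM.color_eq (by omega) hqH hy he.right_mem hxy hqb
  have hd12 : degIn G p H + degIn G q H ≤ (side H χ (χ a)).card := by
    have := degIn_add_degIn_le (G := G) p q (side H χ (χ a))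
    rw [← d1, ← d2, filter_false_of_mem, card_empty, Nat.cast_zero, add_zero] at this
    · exact this
    rintro x hx ⟨hpx, hqx⟩
    rw [mem_side] at hx
    refine h.no_cycle (exists_cycle_of_two_paths he.chain (L := [x])
        (by simp) he.nodup (by simp) ?_ he.ne_nil (by simp) ?_ ?_
        (by omega) (by rw [hlen]; simp))
    · intro z hz hz'
      rw [List.mem_singleton] at hz'
      exact he.out _ hz (hz' ▸ hx.1)
    · simpa [List.getLast?_cons] using hqx
    · simpa using hpx.symm
  have hpq' : ¬ G.Adj p q := fun hadj =>
    hM.color_ne hlen3 hpH hqH he.left_mem he.right_mem hadj hpa.symm hqb he.ne hab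
  have hin : ∀ x ∈ N.toFinset, degIn G x (H ∪ {p, q}) ≤ 2 := by
    intro x hx
    rw [List.mem_toFinset] at hx
    have hxH : x ∉ H := he.out x (by simp [hx])
    have c1 : ¬ (G.Adj x a ∧ G.Adj x q) := fun hadj =>
      hM.color_ne hlen3 hxH hqH he.left_mem he.right_mem hadj.2 hadj.1 hqb he.ne hab
    have c2 : ¬ (G.Adj x b ∧ G.Adj x p) := fun hadj =>
      hM.color_ne hlen3 hpH hxH he.left_mem he.right_mem hadj.2.symm hpa.symm hadj.1 he.ne hab
    have hsub : (H ∪ {p, q}).filter (G.Adj x) ⊆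
        (if G.Adj x a then {a} else {q}) ∪ (if G.Adj x b then {b} else {p}) := by
      intro y hy
      rw [mem_filter, mem_union, mem_insert, mem_singleton] at hy
      obtain ⟨hy, hxy⟩ := hy
      rw [mem_union]
      rcases hy with hy | rfl | rfl
      · rcases hM.eq_or_eq (by simp) hx hy hxy with rfl | rfl
        · left; simp [hxy]
        · right; simp [hxy]
      · right; rw [if_neg (fun e => c2 ⟨e, hxy⟩)]; simp
      · left; rw [if_neg (fun e => c1 ⟨e, hxy⟩)]; simp
    rw [degIn_eq_card]
    have := (card_le_card hsub).trans (card_union_le _ _)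
    split_ifs at this <;> simp only [card_singleton] at this <;> omega
  set N' := N.toFinset with hN'
  have hNc : (N'.card : ℤ) = 2 * k - 2 := by
    rw [hN', List.toFinset_card_of_nodup hnd.2.1]; omega
  have hdE : Disjoint N' {p, q} := by
    rw [disjoint_left]
    intro x hx hx'
    rw [hN', List.mem_toFinset] at hx
    rcases mem_insert.1 hx' with rfl | hx'
    · exact hnd.1 (by simp [hx])
    · rw [mem_singleton] at hx'
      exact hnd.2.2.2 x hx q (by simp) hx'
  have hEc : (({p, q} : Finset V).card : ℤ) = 2 := by rw [card_pair hpq]; rfl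
  have hdH : Disjoint H (N' ∪ {p, q}) := by
    rw [disjoint_right]
    intro x hx
    apply he.out
    simp only [hN', mem_union, List.mem_toFinset, mem_insert, mem_singleton] at hx
    simp; tauto
  have hPc : ((N' ∪ {p, q}).card : ℤ) = 2 * k := by
    rw [card_union_of_disjoint hdE]; push_cast; rw [hNc, hEc]; ring
  refine h.false_of_few_edges hdH (by omega) (by omega) hE ?_
  have f1 := adjPairs_union_self (G := G) hdH
  have f2 := adjPairs_union_self (G := G) hdE
  have f2' := adjPairs_self_le (G := G) N'
  have f2'' : adjPairs G {p, q} {p, q} = 0 := adjPairs_eq_zero (by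
    intro x hx y hy
    simp only [mem_insert, mem_singleton] at hx hy
    rcases hx with rfl | rfl <;> rcases hy with rfl | rfl
    · exact G.irrefl
    · exact hpq'
    · exact fun e => hpq' e.symm
    · exact G.irrefl)
  have f3 : adjPairs G H (N' ∪ {p, q}) = adjPairs G N' H + (degIn G p H + degIn G q H) := by
    rw [adjPairs_comm, adjPairs_union_left hdE]
    congr 1
    exact sum_pair hpq
  have f4 := sum_degIn_le hin
  rw [adjPairs_union_right N' (disjoint_of_subset_right subset_union_right hdH)] at f4
  have f5 := adjPairs_eq_side h.proper (χ a)
  have f6 : ((side H χ (χ a)).card : ℤ) + (side H χ !χ a).card = H.card := by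
    exact_mod_cast card_side_add H χ (χ a)
  have f7 := adjPairs_le (G := G) (side H χ (χ a)) (side H χ !χ a)
  rw [hPc]
  rw [hNc] at f4 f2'
  rw [f1, f2, f3, ← f6]
  nlinarith [sq_nonneg (((side H χ (χ a)).card : ℤ) - (side H χ !χ a).card - 1)]

/-- There is no shortest wrong ear with more than `2 * k` interior vertices. -/
lemma DenseCore.no_long_ear (h : DenseCore G k H χ)
    (hE : ((Fintype.card V : ℤ) - 2 * k + 1) ^ 2 - 1 + 4 * k * (2 * k - 1)
      ≤ 2 * adjPairs G univ univ) {a b p : V} {N R : List V} (hR : R ≠ [])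
    (hM : IsShortestWrongEar G H χ a b (p :: (N ++ R))) (hN : N.length + 1 = 2 * k) :
    False := by
  have hk := h.two_le
  obtain ⟨he, hpar⟩ := hM.wrong
  have hpH : p ∉ H := he.out p (by simp)
  have hnd := he.nodup
  rw [List.nodup_cons, List.nodup_append] at hnd
  have hin : ∀ x ∈ N.toFinset, degIn G x H ≤ 2 := by
    intro x hx
    rw [List.mem_toFinset] at hx
    refine (degIn_le_card_of_forall (U := {a, b}) fun y hy hxy => ?_).trans ?_
    · simpa using hM.eq_or_eq hR hx hy hxy
    · exact_mod_cast card_le_two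
  set N' := N.toFinset with hN'
  have hNc : (N'.card : ℤ) = 2 * k - 1 := by
    rw [hN', List.toFinset_card_of_nodup hnd.2.1]; omega
  have hdE : Disjoint N' {p} := by
    rw [disjoint_singleton_right, hN', List.mem_toFinset]
    exact fun e => hnd.1 (by simp [e])
  have hdH : Disjoint H (N' ∪ {p}) := by
    rw [disjoint_right]
    intro x hx
    apply he.out
    simp only [hN', mem_union, List.mem_toFinset, mem_singleton] at hx
    simp; tauto
  have hPc : ((N' ∪ {p}).card : ℤ) = 2 * k := by
    rw [card_union_of_disjoint hdE]; push_cast; rw [hNc, card_singleton]; push_cast; ring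
  refine h.false_of_few_edges hdH (by omega) (by omega) hE ?_
  have f1 := adjPairs_union_self (G := G) hdH
  have f2 := adjPairs_self_le (G := G) (N' ∪ {p})
  have f3 : adjPairs G H (N' ∪ {p}) = adjPairs G N' H + degIn G p H := by
    rw [adjPairs_comm, adjPairs_union_left hdE, adjPairs_singleton_left]
  have f4 := sum_degIn_le hin
  have f5 := two_mul_adjPairs_le_sq h.proper
  have f6 := h.deg_out p hpH
  have f7 := h.large
  have f8 : (2 : ℤ) ≤ k := by exact_mod_cast hk
  rw [hPc] at f2 ⊢
  rw [hNc] at f4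
  rw [f1, f3]
  nlinarith

/-- A dense core in a graph with many edges has no wrong ear. -/
lemma DenseCore.not_isWrongEar (h : DenseCore G k H χ)
    (hE : ((Fintype.card V : ℤ) - 2 * k + 1) ^ 2 - 1 + 4 * k * (2 * k - 1)
      ≤ 2 * adjPairs G univ univ) (a b : V) (M : List V) : ¬ IsWrongEar G H χ a b M := by
  intro hw
  have hk := h.two_le
  classical
  have hex : ∃ l, ∃ a b M, IsWrongEar G H χ a b M ∧ M.length = l := ⟨_, a, b, M, hw, rfl⟩
  obtain ⟨a, b, M, hw, hl⟩ := Nat.find_spec hex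
  have hM : IsShortestWrongEar G H χ a b M :=
    ⟨hw, fun a' b' M' hw' => hl ▸ Nat.find_min' hex ⟨a', b', M', hw', rfl⟩⟩
  clear hl
  have hlen := h.length_of_wrongEar hw
  rcases M with _ | ⟨p, M⟩
  · exact hw.1.ne_nil rfl
  rw [List.length_cons] at hlen
  rcases le_or_gt (2 * k) M.length with hlong | hshort
  · have e := List.take_append_drop (2 * k - 1) M
    rw [← e] at hM
    refine h.no_long_ear hE (fun e' => ?_) hM ?_
    · have := congrArg List.length e'
      rw [List.length_drop] at this
      simp at this
      omega
    · rw [List.length_take]; omega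
  · have hne : M ≠ [] := by rintro rfl; simp at hlen; omega
    have e := List.dropLast_append_getLast hne
    rw [← e] at hM
    rcases (show M.length + 2 = 2 * k ∨ M.length + 1 = 2 * k by omega) with hc | hc
    · exact h.no_cross_ear hE hM (by rw [List.length_dropLast]; omega)
    · exact h.no_even_ear hE hM (by rw [List.length_dropLast]; omega)

end NoWrongEar

section Block

variable {V : Type*} {G : SimpleGraph V} {H B B' : Finset V} {χ χ' f : V → Bool}

/-- Adjacency between vertices of different colours. -/
def ProperAdj (G : SimpleGraph V) (χ : V → Bool) (x y : V) : Prop := G.Adj x y ∧ χ x ≠ χ y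

lemma ProperAdj.symm {x y : V} (h : ProperAdj G χ x y) : ProperAdj G χ y x :=
  ⟨h.1.symm, h.2.symm⟩

lemma color_eq_iff_odd_length {L : List V} (hL : L.IsChain (ProperAdj G χ)) {x y : V}
    (hx : L.head? = some x) (hy : L.getLast? = some y) : χ x = χ y ↔ Odd L.length := by
  induction L generalizing x with
  | nil => simp at hx
  | cons a L ih =>
    simp only [List.head?_cons, Option.some.injEq] at hx
    subst hx
    rcases L with _ | ⟨b, L⟩
    · simp only [List.getLast?_singleton, Option.some.injEq] at hy
      simp [hy]
    · rw [List.isChain_cons_cons] at hL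
      have := ih hL.2 (x := b) (by simp) (by simpa [List.getLast?_cons] using hy)
      have hab := hL.1.2
      rw [List.length_cons, Nat.odd_add_one, ← this]
      cases h1 : χ a <;> cases h2 : χ b <;> cases h3 : χ y <;> simp_all

lemma isChain_reverse_properAdj {L : List V} (hL : L.IsChain (ProperAdj G χ)) :
    L.reverse.IsChain (ProperAdj G χ) := by
  rw [List.isChain_reverse]
  exact hL.imp fun _ _ h => h.symm

/-- Vertices of a path can be recoloured alternately. -/
lemma exists_alternating_coloring (χ : V → Bool) {x : V} {Z : List V}
    (hc : (x :: Z).IsChain G.Adj) (hn : (x :: Z).Nodup) :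
    ∃ f : V → Bool, (∀ v ∉ Z, f v = χ v) ∧ (x :: Z).IsChain (ProperAdj G f) := by
  classical
  induction Z generalizing x χ with
  | nil => exact ⟨χ, fun _ _ => rfl, by simp⟩
  | cons z Z ih =>
    rw [List.isChain_cons_cons] at hc
    have hn' := List.nodup_cons.1 hn
    have hn'' := List.nodup_cons.1 hn'.2
    obtain ⟨f, hf, hch⟩ := ih (Function.update χ z (!χ x)) hc.2 hn'.2
    have hxz : x ≠ z := fun e => hn'.1 (by simp [e])
    have fz : f z = !χ x := by rw [hf z hn''.1]; simp
    have fx : f x = χ x := by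
      rw [hf x (fun e => hn'.1 (by simp [e]))]
      simp [hxz]
    refine ⟨f, fun v hv => ?_, ?_⟩
    · rw [List.mem_cons, not_or] at hv
      rw [hf v hv.2, Function.update_of_ne hv.1]
    · rw [List.isChain_cons_cons]
      exact ⟨⟨hc.1, by rw [fx, fz]; simp⟩, hch⟩

/-- `P ++ [h]` is a properly coloured path in `B` from `x` to `H` meeting `H` only in `h`. -/
structure IsLeg (G : SimpleGraph V) (H B : Finset V) (χ : V → Bool) (x : V) (P : List V)
    (h : V) : Prop where
  last_mem : h ∈ H
  subset : ∀ z ∈ P ++ [h], z ∈ B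
  out : ∀ z ∈ P, z ∉ H
  nodup : (P ++ [h]).Nodup
  chain : (P ++ [h]).IsChain (ProperAdj G χ)
  head : (P ++ [h]).head? = some x

lemma IsLeg.mono {x h : V} {P : List V} (hP : IsLeg G H B χ x P h) (hB : B ⊆ B')
    (hf : ∀ v ∈ B, f v = χ v) : IsLeg G H B' f x P h := by
  refine ⟨hP.last_mem, fun z hz => hB (hP.subset z hz), hP.out, hP.nodup, ?_, hP.head⟩
  refine hP.chain.imp_of_mem_imp ?_
  intro a b ha hb hab
  exact ⟨hab.1, by rw [hf a (hP.subset a ha), hf b (hP.subset b hb)]; exact hab.2⟩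

/-- Two disjoint legs from `x` and `y`. -/
def Linked (G : SimpleGraph V) (H B : Finset V) (χ : V → Bool) (x y : V) : Prop :=
  ∃ P h Q h', IsLeg G H B χ x P h ∧ IsLeg G H B χ y Q h' ∧ ∀ z ∈ P ++ [h], z ∉ Q ++ [h']

lemma Linked.symm {x y : V} (h : Linked G H B χ x y) : Linked G H B χ y x := by
  obtain ⟨P, h, Q, h', hP, hQ, hd⟩ := h
  exact ⟨Q, h', P, h, hQ, hP, fun z hz hz' => hd z hz' hz⟩

lemma Linked.mono {x y : V} (h : Linked G H B χ x y) (hB : B ⊆ B')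
    (hf : ∀ v ∈ B, f v = χ v) : Linked G H B' f x y := by
  obtain ⟨P, h, Q, h', hP, hQ, hd⟩ := h
  exact ⟨P, h, Q, h', hP.mono hB hf, hQ.mono hB hf, hd⟩

/-- A leg may be prolonged by a path `T` leaving `B`. -/
lemma IsLeg.prolong {x h y : V} {P T : List V} (hP : IsLeg G H B f x P h) (hHB : H ⊆ B)
    (hB : B ⊆ B') (hT : ∀ z ∈ T, z ∈ B' ∧ z ∉ B) (hTn : T.Nodup)
    (hTc : (T ++ [x]).IsChain (ProperAdj G f)) (hy : T.head? = some y) :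
    IsLeg G H B' f y (T ++ P) h := by
  have hT0 : T ≠ [] := by rintro rfl; simp at hy
  refine ⟨hP.last_mem, ?_, ?_, ?_, ?_, ?_⟩
  · intro z hz
    rw [List.append_assoc, List.mem_append] at hz
    rcases hz with hz | hz
    · exact (hT z hz).1
    · exact hB (hP.subset z hz)
  · intro z hz
    rcases List.mem_append.1 hz with hz | hz
    · exact fun e => (hT z hz).2 (hHB e)
    · exact hP.out z hz
  · rw [List.append_assoc, List.nodup_append]
    refine ⟨hTn, hP.nodup, ?_⟩
    rintro z hz w hw rfl
    exact (hT z hz).2 (hP.subset z hw)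
  · rw [List.isChain_append] at hTc
    rw [List.append_assoc, List.isChain_append]
    refine ⟨hTc.1, hP.chain, ?_⟩
    rw [hP.head]
    simpa using hTc.2.2
  · rw [List.append_assoc, List.head?_append_of_ne_nil _ hT0, hy]

/-- In the absence of wrong ears, an edge between disjoint legs is properly coloured. -/
lemma color_ne_of_linked (hno : ∀ a b M, ¬ IsWrongEar G H f a b M)
    (hpr : ∀ x ∈ H, ∀ y ∈ H, G.Adj x y → f x ≠ f y) {x y : V}
    (hl : Linked G H B f x y) (hxy : G.Adj x y) : f x ≠ f y := by
  obtain ⟨P, h, Q, h', hP, hQ, hd⟩ := hl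
  intro heq
  by_cases hnil : P = [] ∧ Q = []
  · obtain ⟨rfl, rfl⟩ := hnil
    have e1 : h = x := by simpa using hP.head
    have e2 : h' = y := by simpa using hQ.head
    exact hpr x (e1 ▸ hP.last_mem) y (e2 ▸ hQ.last_mem) hxy heq
  have hfull : (h :: ((P.reverse ++ Q) ++ [h'])).IsChain G.Adj := by
    have e : h :: ((P.reverse ++ Q) ++ [h']) = (P ++ [h]).reverse ++ (Q ++ [h']) := by simp
    rw [e, List.isChain_append]
    refine ⟨(isChain_reverse_properAdj hP.chain).imp fun _ _ h => h.1,
      hQ.chain.imp fun _ _ h => h.1, ?_⟩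
    rw [List.getLast?_reverse, hP.head, hQ.head]
    rintro _ ⟨⟩ _ ⟨⟩
    exact hxy
  rw [List.isChain_cons, List.isChain_append] at hfull
  have hM0 : P.reverse ++ Q ≠ [] := by
    intro e
    rw [List.append_eq_nil_iff, List.reverse_eq_nil_iff] at e
    exact hnil e
  have c1 := color_eq_iff_odd_length hP.chain hP.head (y := h) (by simp)
  have c2 := color_eq_iff_odd_length hQ.chain hQ.head (y := h') (by simp)
  refine hno h h' (P.reverse ++ Q) ⟨⟨hP.last_mem, hQ.last_mem, ?_, hM0, ?_, ?_, hfull.2.1, ?_,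
    ?_⟩, ?_⟩
  · rintro rfl
    exact hd h (by simp) (by simp)
  · rw [List.nodup_append, List.nodup_reverse]
    refine ⟨hP.nodup.of_append_left, hQ.nodup.of_append_left, ?_⟩
    rintro z hz w hw rfl
    exact hd z (by simp at hz; simp [hz]) (by simp [hw])
  · intro z hz
    rw [List.mem_append, List.mem_reverse] at hz
    rcases hz with hz | hz
    · exact hP.out z hz
    · exact hQ.out z hz
  · have := hfull.1
    rwa [List.head?_append_of_ne_nil _ hM0] at this
  · simpa using hfull.2.2.2
  · simp only [List.length_append, List.length_cons, List.length_nil, zero_add,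
      List.length_reverse, Nat.odd_add_one, Nat.not_odd_iff_even, Nat.even_add] at c1 c2 ⊢
    rw [← c1, ← c2, ← heq]
    cases f x <;> cases f h <;> cases f h' <;> simp

/-- A set `B ⊇ H` whose colouring extends that of `H` and all of whose pairs are linked. -/
structure IsBlock (G : SimpleGraph V) (H : Finset V) (χ : V → Bool) (B : Finset V)
    (f : V → Bool) : Prop where
  subset : H ⊆ B
  agree : ∀ x ∈ H, f x = χ x
  linked : ∀ x ∈ B, ∀ y ∈ B, x ≠ y → Linked G H B f x y

lemma isBlock_self (G : SimpleGraph V) (H : Finset V) (χ : V → Bool) : IsBlock G H χ H χ := by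
  refine ⟨Subset.rfl, fun _ _ => rfl, fun x hx y hy hxy => ?_⟩
  have key : ∀ z ∈ H, IsLeg G H H χ z [] z := fun z hz =>
    ⟨hz, by simpa using hz, by simp, by simp, by simp, by simp⟩
  exact ⟨[], x, [], y, key x hx, key y hy, by simpa using hxy⟩

lemma IsWrongEar.congr (hf : ∀ x ∈ H, f x = χ x) {a b : V} {M : List V}
    (h : IsWrongEar G H f a b M) : IsWrongEar G H χ a b M :=
  ⟨h.1, by rw [← hf a h.1.left_mem, ← hf b h.1.right_mem]; exact h.2⟩

lemma IsBlock.proper (hB : IsBlock G H χ B f) (hno : ∀ a b M, ¬ IsWrongEar G H χ a b M)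
    (hpr : ∀ x ∈ H, ∀ y ∈ H, G.Adj x y → χ x ≠ χ y) :
    ∀ x ∈ B, ∀ y ∈ B, G.Adj x y → f x ≠ f y := fun x hx y hy hxy =>
  color_ne_of_linked (fun a b M hw => hno a b M (hw.congr hB.agree))
    (fun a ha b hb hab => by rw [hB.agree a ha, hB.agree b hb]; exact hpr a ha b hb hab)
    (hB.linked x hx y hy hxy.ne) hxy

variable [DecidableEq V]

/-- A block can be enlarged by an ear. -/
lemma IsBlock.exists_of_isEar (hB : IsBlock G H χ B f) (hno : ∀ a b M, ¬ IsWrongEar G H χ a b M)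
    (hpr : ∀ x ∈ H, ∀ y ∈ H, G.Adj x y → χ x ≠ χ y) {x y : V} {Z : List V}
    (hZ : IsEar G B x y Z) : ∃ g, IsBlock G H χ (B ∪ Z.toFinset) g := by
  obtain ⟨g, hg, hch⟩ := exists_alternating_coloring (G := G) f (x := x) (Z := Z)
    (List.isChain_cons.2 ⟨hZ.head, hZ.chain⟩)
    (List.nodup_cons.2 ⟨fun e => hZ.out x e hZ.left_mem, hZ.nodup⟩)
  have hgB : ∀ v ∈ B, g v = f v := fun v hv => hg v fun e => hZ.out v e hv
  have hag : ∀ v ∈ H, g v = χ v := fun v hv => by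
    rw [hgB v (hB.subset hv), hB.agree v hv]
  have hsub : B ⊆ B ∪ Z.toFinset := subset_union_left
  have hZmem : ∀ z ∈ Z, z ∈ B ∪ Z.toFinset ∧ z ∉ B := fun z hz => ⟨by simp [hz], hZ.out z hz⟩
  have hlink : ∀ u ∈ B, ∀ v ∈ B, u ≠ v → Linked G H B g u v := fun u hu v hv huv =>
    (hB.linked u hu v hv huv).mono Subset.rfl hgB
  have left_leg : ∀ {s t : List V} {u h : V} {P : List V}, Z = s ++ u :: t →
      IsLeg G H B g x P h →
      IsLeg G H (B ∪ Z.toFinset) g u ((u :: s.reverse) ++ P) h := by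
    intro s t u h P e hP
    have e' : u :: s.reverse = (s ++ [u]).reverse := by simp
    have hmem : ∀ z ∈ u :: s.reverse, z ∈ Z := by
      intro z hz; rw [e]; simp only [List.mem_cons, List.mem_reverse, List.mem_append] at hz ⊢; tauto
    refine hP.prolong hB.subset hsub (fun z hz => hZmem z (hmem z hz)) ?_ ?_ (by simp)
    · have hn := hZ.nodup
      rw [e, ← List.singleton_append, ← List.append_assoc] at hn
      rw [e', List.nodup_reverse]
      exact hn.of_append_left
    · have e2 : (u :: s.reverse) ++ [x] = (x :: (s ++ [u])).reverse := by simp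
      rw [e2]
      apply isChain_reverse_properAdj
      have e3 : x :: Z = (x :: (s ++ [u])) ++ t := by simp [e]
      rw [e3] at hch
      exact hch.left_of_append
  have hlast : ∀ z ∈ Z.getLast?, g z ≠ g y := by
    intro z hz
    obtain ⟨s, rfl⟩ : ∃ s, Z = s ++ [z] := List.getLast?_eq_some_iff.1 hz
    obtain ⟨P, h, Q, h', hP, hQ, hd⟩ := hlink x hZ.left_mem y hZ.right_mem hZ.ne
    refine color_ne_of_linked (B := B ∪ (s ++ [z]).toFinset)
      (fun a b M hw => hno a b M (hw.congr hag))
      (fun a ha b hb hab => by rw [hag a ha, hag b hb]; exact hpr a ha b hb hab)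
      ⟨_, h, Q, h', left_leg (s := s) (t := []) rfl hP, hQ.mono hsub fun _ _ => rfl, ?_⟩
      (hZ.last z hz)
    intro w hw hw'
    rw [List.append_assoc, List.mem_append] at hw
    rcases hw with hw | hw
    · exact hZ.out w (by simp at hw ⊢; tauto) (hQ.subset w hw')
    · exact hd w hw hw'
  have hch' : (Z ++ [y]).IsChain (ProperAdj G g) := by
    rw [List.isChain_cons] at hch
    rw [List.isChain_append]
    refine ⟨hch.2, by simp, fun z hz w hw => ?_⟩
    simp only [List.head?_cons, Option.mem_def, Option.some.injEq] at hw
    subst hw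
    exact ⟨hZ.last z hz, hlast z hz⟩
  have right_leg : ∀ {s t : List V} {u h : V} {P : List V}, Z = s ++ u :: t →
      IsLeg G H B g y P h → IsLeg G H (B ∪ Z.toFinset) g u ((u :: t) ++ P) h := by
    intro s t u h P e hP
    have hmem : ∀ z ∈ u :: t, z ∈ Z := by
      intro z hz; rw [e]; exact List.mem_append_right _ hz
    refine hP.prolong hB.subset hsub (fun z hz => hZmem z (hmem z hz)) ?_ ?_ (by simp)
    · have hn := hZ.nodup
      rw [e] at hn
      exact hn.of_append_right
    · rw [e, List.append_assoc] at hch'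
      exact hch'.right_of_append
  have mixed : ∀ u ∈ Z, ∀ v ∈ B, Linked G H (B ∪ Z.toFinset) g u v := by
    intro u hu v hv
    obtain ⟨s, t, e⟩ := List.append_of_mem hu
    by_cases hvx : v = x
    · obtain ⟨P, h, Q, h', hP, hQ, hd⟩ := hlink y hZ.right_mem v hv (by rw [hvx]; exact hZ.ne.symm)
      refine ⟨_, h, Q, h', right_leg e hP, hQ.mono hsub fun _ _ => rfl, ?_⟩
      intro w hw hw'
      rw [List.append_assoc, List.mem_append] at hw
      rcases hw with hw | hw
      · exact hZ.out w (by rw [e]; exact List.mem_append_right _ hw) (hQ.subset w hw')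
      · exact hd w hw hw'
    · obtain ⟨P, h, Q, h', hP, hQ, hd⟩ := hlink x hZ.left_mem v hv (Ne.symm hvx)
      refine ⟨_, h, Q, h', left_leg e hP, hQ.mono hsub fun _ _ => rfl, ?_⟩
      intro w hw hw'
      rw [List.append_assoc, List.mem_append] at hw
      rcases hw with hw | hw
      · refine hZ.out w ?_ (hQ.subset w hw')
        rw [e]; simp only [List.mem_cons, List.mem_reverse, List.mem_append] at hw ⊢; tauto
      · exact hd w hw hw'
  have ordered : ∀ {s t w : List V} {u v : V}, Z = s ++ u :: (t ++ v :: w) →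
      Linked G H (B ∪ Z.toFinset) g u v := by
    intro s t w u v e
    obtain ⟨P, h, Q, h', hP, hQ, hd⟩ := hlink x hZ.left_mem y hZ.right_mem hZ.ne
    have e2 : Z = (s ++ u :: t) ++ v :: w := by simp [e]
    refine ⟨_, h, _, h', left_leg e hP, right_leg e2 hQ, ?_⟩
    have hn := hZ.nodup
    have hout := hZ.out
    intro a ha ha'
    rw [List.append_assoc, List.mem_append] at ha ha'
    have hmem1 : a ∈ u :: s.reverse → a ∈ s ++ u :: t := by
      simp only [List.mem_cons, List.mem_reverse, List.mem_append]; tauto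
    rcases ha with ha | ha <;> rcases ha' with ha' | ha'
    · rw [e2, List.nodup_append] at hn
      exact hn.2.2 a (hmem1 ha) a ha' rfl
    · exact hout a (by rw [e2]; exact List.mem_append_left _ (hmem1 ha)) (hQ.subset a ha')
    · exact hout a (by rw [e2]; exact List.mem_append_right _ ha') (hP.subset a ha)
    · exact hd a ha ha'
  refine ⟨g, hB.subset.trans hsub, hag, fun u hu v hv huv => ?_⟩
  rw [mem_union, List.mem_toFinset] at hu hv
  rcases hu with hu | hu <;> rcases hv with hv | hv
  · exact (hlink u hu v hv huv).mono hsub fun _ _ => rfl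
  · exact (mixed v hv u hu).symm
  · exact mixed u hu v hv
  · obtain ⟨s, t, e⟩ := List.append_of_mem hu
    rw [e, List.mem_append, List.mem_cons] at hv
    rcases hv with hv | hv | hv
    · obtain ⟨s₁, s₂, e'⟩ := List.append_of_mem hv
      have e2 : Z = s₁ ++ v :: (s₂ ++ u :: t) := by rw [e, e']; simp
      exact (ordered e2).symm
    · exact absurd hv.symm huv
    · obtain ⟨t₁, t₂, e'⟩ := List.append_of_mem hv
      exact ordered (by rw [e, e'])

/-- In the absence of wrong ears there is a bipartite set containing `H` without ears. -/
lemma exists_block [Fintype V] (hno : ∀ a b M, ¬ IsWrongEar G H χ a b M)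
    (hpr : ∀ x ∈ H, ∀ y ∈ H, G.Adj x y → χ x ≠ χ y) :
    ∃ (B : Finset V) (f : V → Bool), H ⊆ B ∧ (∀ x ∈ B, ∀ y ∈ B, G.Adj x y → f x ≠ f y) ∧
      ∀ x y Z, ¬ IsEar G B x y Z := by
  classical
  obtain ⟨B, hB, hmax⟩ := exists_max_image
    ((univ : Finset (Finset V)).filter fun B => ∃ f, IsBlock G H χ B f) card
    ⟨H, mem_filter.2 ⟨mem_univ _, χ, isBlock_self G H χ⟩⟩
  obtain ⟨f, hf⟩ := (mem_filter.1 hB).2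
  refine ⟨B, f, hf.subset, hf.proper hno hpr, fun x y Z hZ => ?_⟩
  obtain ⟨g, hg⟩ := hf.exists_of_isEar hno hpr hZ
  have h1 := hmax _ (mem_filter.2 ⟨mem_univ _, g, hg⟩)
  obtain ⟨z, hz⟩ := List.exists_mem_of_ne_nil _ hZ.ne_nil
  have h2 : B ⊂ B ∪ Z.toFinset := by
    refine Finset.ssubset_iff_subset_ne.2 ⟨subset_union_left, fun e => hZ.out z hz ?_⟩
    rw [e]; simp [hz]
  exact absurd (card_lt_card h2) (by omega)

/-- Outside a set without ears, connected pieces attach to at most one vertex. -/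
lemma exists_attachment (hB : B.Nonempty) (hear : ∀ x y Z, ¬ IsEar G B x y Z) :
    ∃ att : V → V, (∀ x, att x ∈ B) ∧ (∀ x ∉ B, ∀ b ∈ B, G.Adj x b → b = att x) ∧
      ∀ x ∉ B, ∀ y ∉ B, G.Adj x y → att x = att y := by
  classical
  obtain ⟨b₀, hb₀⟩ := hB
  let R : V → V → Prop := fun x b => b ∈ B ∧ ∃ (y : V) (w : G.Walk x y),
    (∀ z ∈ w.support, z ∉ B) ∧ G.Adj y b
  have uniq : ∀ x b b', R x b → R x b' → b = b' := by
    rintro x b b' ⟨hb, y, w, hw, hyb⟩ ⟨hb', y', w', hw', hyb'⟩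
    by_contra hne
    set p := (w.reverse.append w').bypass with hp
    have hpp : p.IsPath := SimpleGraph.Walk.bypass_isPath _
    have hps : ∀ z ∈ p.support, z ∉ B := by
      intro z hz
      have := SimpleGraph.Walk.support_bypass_subset_support _ hz
      rw [SimpleGraph.Walk.mem_support_append_iff, SimpleGraph.Walk.support_reverse,
        List.mem_reverse] at this
      exact this.elim (hw z) (hw' z)
    refine hear b b' p.support ⟨hb, hb', hne, p.support_ne_nil, hpp.support_nodup, hps,
      p.isChain_adj_support, ?_, ?_⟩
    · intro z hz
      rw [List.head?_eq_some_head p.support_ne_nil, SimpleGraph.Walk.head_support] at hz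
      cases hz
      exact hyb.symm
    · intro z hz
      rw [List.getLast?_eq_some_getLast p.support_ne_nil, SimpleGraph.Walk.getLast_support] at hz
      cases hz
      exact hyb'
  refine ⟨fun x => if h : ∃ b, R x b then h.choose else b₀, fun x => ?_, fun x hx b hb hxb => ?_,
    fun x hx y hy hxy => ?_⟩
  · dsimp only
    split_ifs with h
    · exact h.choose_spec.1
    · exact hb₀
  · have h : ∃ b, R x b := ⟨b, hb, x, .nil, by simpa using hx, hxb⟩
    dsimp only
    rw [dif_pos h]
    exact uniq x _ _ ⟨hb, x, .nil, by simpa using hx, hxb⟩ h.choose_spec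
  · have tr : ∀ {x y b}, x ∉ B → G.Adj x y → R y b → R x b := by
      rintro x y b hx hxy ⟨hb, z, w, hw, hzb⟩
      refine ⟨hb, z, .cons hxy w, ?_, hzb⟩
      intro v hv
      rw [SimpleGraph.Walk.support_cons, List.mem_cons] at hv
      rcases hv with rfl | hv
      · exact hx
      · exact hw v hv
    dsimp only
    by_cases h : ∃ b, R x b
    · have h' : ∃ b, R y b := h.imp fun b hb => tr hy hxy.symm hb
      rw [dif_pos h, dif_pos h']
      exact uniq x _ _ h.choose_spec (tr hx hxy h'.choose_spec)
    · have h' : ¬ ∃ b, R y b := fun h' => h (h'.imp fun b hb => tr hx hxy hb)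
      rw [dif_neg h, dif_neg h']

end Block

section Extremal

/-- A graph that looks like a Turán graph with a suspended clique is isomorphic to one. -/
lemma exists_iso_turanSuspAt {n q : ℕ} (hq : q ≤ n) {G : SimpleGraph (Fin n)} (cl : Fin n → Fin 3)
    (v : Fin n) (hv : cl v ≠ 2) (h0 : (univ.filter fun x => cl x = 0).card = q / 2)
    (h1 : (univ.filter fun x => cl x = 1).card = q - q / 2)
    (hadj : ∀ x y, G.Adj x y ↔ x ≠ y ∧ ((cl x = 0 ∧ cl y = 1) ∨ (cl x = 1 ∧ cl y = 0) ∨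
      ((x = v ∨ cl x = 2) ∧ (y = v ∨ cl y = 2)))) :
    ∃ v0 : ℕ, v0 < q ∧ Nonempty (G ≃g turanSuspAt n q v0) := by
  classical
  set cl' : Fin n → Fin 3 := fun i => if (i : ℕ) < q / 2 then 0 else if (i : ℕ) < q then 1 else 2
    with hcl'
  have e0 : ∀ i, cl' i = 0 ↔ (i : ℕ) < q / 2 := by
    intro i; simp only [hcl']; split_ifs <;> simp_all
  have e2 : ∀ i, cl' i = 2 ↔ q ≤ (i : ℕ) := by
    intro i; simp only [hcl']; split_ifs <;> simp <;> omega
  have e1 : ∀ i, cl' i = 1 ↔ q / 2 ≤ (i : ℕ) ∧ (i : ℕ) < q := by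
    intro i; simp only [hcl']; split_ifs <;> simp <;> omega
  have tot : ∀ c : Fin n → Fin 3, (univ.filter fun x => c x = 0).card +
      (univ.filter fun x => c x = 1).card + (univ.filter fun x => c x = 2).card = n := by
    intro c
    have := card_eq_sum_card_fiberwise (s := univ) (t := univ) (f := c) (fun _ _ => mem_univ _)
    rw [Fin.sum_univ_three] at this
    simpa using this.symm
  have d0 : (univ.filter fun x => cl' x = 0).card = q / 2 := by
    simp only [e0]
    rw [Fin.card_filter_val_lt]; omega
  have d2 : (univ.filter fun x => cl' x = 2).card = n - q := by
    have := card_filter_add_card_filter_not (s := (univ : Finset (Fin n))) (fun x => (x : ℕ) < q)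
    rw [Fin.card_filter_val_lt, card_univ, Fintype.card_fin] at this
    simp only [e2]
    simp only [not_lt] at this
    omega
  have t := tot cl
  have t' := tot cl'
  have hc : ∀ c, (univ.filter fun x => cl x = c).card = (univ.filter fun x => cl' x = c).card := by
    intro c
    fin_cases c
    · exact h0.trans d0.symm
    · change (univ.filter fun x => cl x = 1).card = (univ.filter fun x => cl' x = 1).card
      omega
    · change (univ.filter fun x => cl x = 2).card = (univ.filter fun x => cl' x = 2).card
      omega
  have eq : ∀ c, Nonempty ({x // cl x = c} ≃ {x // cl' x = c}) := fun c =>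
    ⟨Fintype.equivOfCardEq (by rw [Fintype.card_subtype, Fintype.card_subtype]; exact hc c)⟩
  let e : Fin n ≃ Fin n := Equiv.ofFiberEquiv fun c => (eq c).some
  have he : ∀ x, cl' (e x) = cl x := fun x => Equiv.ofFiberEquiv_map _ x
  have hev : ((e v : Fin n) : ℕ) < q := by
    have := he v
    by_contra hcon
    exact hv (this ▸ (e2 _).2 (not_lt.1 hcon))
  refine ⟨(e v : ℕ), hev, ⟨⟨e, ?_⟩⟩⟩
  intro x y
  have k0 : ∀ z, ((e z : Fin n) : ℕ) < q / 2 ↔ cl z = 0 := fun z => by rw [← e0, he]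
  have k1 : ∀ z, (q / 2 ≤ ((e z : Fin n) : ℕ) ∧ ((e z : Fin n) : ℕ) < q) ↔ cl z = 1 :=
    fun z => by rw [← e1, he]
  have k2 : ∀ z, q ≤ ((e z : Fin n) : ℕ) ↔ cl z = 2 := fun z => by rw [← e2, he]
  rw [turanSuspAt, SimpleGraph.fromRel_adj, hadj]
  simp only [k0, k1, k2, Fin.val_inj, e.injective.eq_iff, ne_eq]
  tauto

variable {V : Type*} {G : SimpleGraph V} [DecidableRel G.Adj]

lemma adj_of_card_le_degIn {x : V} {T : Finset V} (h : (T.card : ℤ) ≤ degIn G x T) :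
    ∀ y ∈ T, G.Adj x y := by
  rw [degIn_eq_card] at h
  have := eq_of_subset_of_card_le (filter_subset (G.Adj x) T) (by exact_mod_cast h)
  intro y hy
  rw [← this] at hy
  exact (mem_filter.1 hy).2

lemma degIn_eq_of_sum_le {N T : Finset V} {c : ℤ} (h : ∀ x ∈ N, degIn G x T ≤ c)
    (hs : N.card * c ≤ adjPairs G N T) : ∀ x ∈ N, degIn G x T = c := by
  have hs' : ∑ x ∈ N, c = adjPairs G N T :=
    le_antisymm (by simpa using hs) (by simpa using sum_degIn_le h)
  intro x hx
  exact (sum_eq_sum_iff_of_le h).1 hs'.symm x hx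

lemma adj_of_card_mul_card_le {S T : Finset V} (h : (S.card * T.card : ℤ) ≤ adjPairs G S T) :
    ∀ x ∈ S, ∀ y ∈ T, G.Adj x y := fun x hx =>
  adj_of_card_le_degIn (degIn_eq_of_sum_le (fun x _ => degIn_le_card x T) h x hx).ge

lemma degIn_le_one {x b : V} {B : Finset V} (h : ∀ y ∈ B, G.Adj x y → y = b) :
    degIn G x B ≤ 1 := by
  have := degIn_le_card_of_forall (G := G) (x := x) (T := B) (U := {b}) (by simpa using h)
  simpa using this

variable [DecidableEq V]

lemma adj_of_card_mul_pred_le {S : Finset V}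
    (h : (S.card * (S.card - 1) : ℤ) ≤ adjPairs G S S) :
    ∀ x ∈ S, ∀ y ∈ S, x ≠ y → G.Adj x y := by
  intro x hx y hy hxy
  have h1 := degIn_eq_of_sum_le (fun x hx => degIn_self_mem hx) h x hx
  have h2 : degIn G x (S.erase x) = degIn G x S := by
    rw [degIn_eq_card, degIn_eq_card]
    congr 2
    ext z
    simp only [mem_filter, mem_erase]
    exact ⟨fun hz => ⟨hz.1.2, hz.2⟩, fun hz => ⟨⟨hz.2.ne', hz.1⟩, hz.2⟩⟩
  refine adj_of_card_le_degIn (T := S.erase x) ?_ y (mem_erase.2 ⟨hxy.symm, hy⟩)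
  have := card_erase_add_one hx
  omega

lemma adjPairs_compl_add [Fintype V] (B : Finset V) :
    adjPairs G univ univ = adjPairs G B B + 2 * adjPairs G Bᶜ B + adjPairs G Bᶜ Bᶜ := by
  rw [← union_compl B, adjPairs_union_self disjoint_compl_right, adjPairs_comm B Bᶜ]
  ring

/-- A dense graph without a cycle of length `2 * k + 1` has a dense bipartite core. -/
lemma exists_denseCore [Fintype V] {k : ℕ} (hk : 2 ≤ k) (hn : 100 * k ≤ Fintype.card V)
    (hD : 4802 * (Fintype.card V : ℤ) ^ 2 ≤ 10000 * adjPairs G univ univ)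
    (hno : ¬ ∃ (v : V) (w : G.Walk v v), w.IsCycle ∧ w.length = 2 * k + 1) :
    ∃ (H : Finset V) (χ : V → Bool), DenseCore G k H χ ∧
      81 * (Fintype.card V : ℤ) ≤ 100 * H.card := by
  obtain ⟨S, hmax, hdeg, hout⟩ := exists_dense_core G
  have h1 := hmax univ
  rw [card_univ] at h1
  have h2 : 2200 * (S.card : ℤ) ^ 2 + 201 * (Fintype.card V : ℤ) ^ 2
      ≤ 5000 * adjPairs G S S := by nlinarith
  obtain ⟨χ, hχ⟩ := exists_twoColoring_of_dense hk hn h2 hdeg hno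
  have h3 := two_mul_adjPairs_le_sq hχ
  have h4 : (100 * k : ℤ) ≤ Fintype.card V := by exact_mod_cast hn
  have h5 : 81 * (Fintype.card V : ℤ) ≤ 100 * S.card := by nlinarith
  exact ⟨S, χ, ⟨hk, hχ, hdeg, hout, hmax, by linarith, hno⟩, h5⟩

lemma familyG_of_attachment {n r : ℕ} {G : SimpleGraph (Fin n)} {B : Finset (Fin n)}
    {f : Fin n → Bool} {att : Fin n → Fin n}
    (hpr : ∀ x ∈ B, ∀ y ∈ B, G.Adj x y → f x ≠ f y) (hB : ∀ x, att x ∈ B)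
    (hin : ∀ x ∉ B, ∀ b ∈ B, G.Adj x b → b = att x)
    (hout : ∀ x ∉ B, ∀ y ∉ B, G.Adj x y → att x = att y) (hc : Bᶜ.card ≤ r - 2) :
    FamilyG n r G := by
  classical
  have hW : univ.biUnion (fun i => Bᶜ.filter fun x => att x = i) = Bᶜ := by
    ext x; simp
  refine ⟨n, fun i => Bᶜ.filter fun x => att x = i, fun i => if i ∈ B then i else att i,
    ?_, ?_, ?_, ?_, ?_, ?_⟩
  · intro i j hij
    rw [disjoint_left]
    intro x hx hx'
    exact hij ((mem_filter.1 hx).2.symm.trans (mem_filter.1 hx').2)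
  · rwa [hW]
  · intro i
    rw [hW, notMem_compl]
    dsimp only
    split_ifs with h
    exacts [h, hB i]
  · refine ⟨{x | f x = true}, fun x y hxy hx hy => ?_⟩
    rw [hW, notMem_compl] at hx hy
    have := hpr x hx y hy hxy
    simp only [Set.mem_ofPred_eq]
    revert this
    cases f x <;> cases f y <;> simp
  · intro i j hij x hx y hy hxy
    rw [mem_filter, mem_compl] at hx hy
    exact hij (hx.2.symm.trans ((hout x hx.1 y hy.1 hxy).trans hy.2))
  · intro i x hx y hxy hy
    rw [hW, notMem_compl] at hy
    rw [mem_filter, mem_compl] at hx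
    have := hin x hx.1 y hy hxy
    rw [← hx.2]
    dsimp only
    rwa [if_pos (hB x)]

lemma exists_iso_of_attachment {n q : ℕ} {G : SimpleGraph (Fin n)} [DecidableRel G.Adj]
    {B : Finset (Fin n)} {f : Fin n → Bool} {att : Fin n → Fin n}
    (hpr : ∀ x ∈ B, ∀ y ∈ B, G.Adj x y → f x ≠ f y) (hB : ∀ x, att x ∈ B)
    (hin : ∀ x ∉ B, ∀ b ∈ B, G.Adj x b → b = att x)
    (hout : ∀ x ∉ B, ∀ y ∉ B, G.Adj x y → att x = att y) (hq : B.card = q) (hqn : q < n)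
    (hD : 2 * ((q ^ 2 / 4 : ℕ) : ℤ) + (n - q) * (n - q + 1) ≤ adjPairs G univ univ) :
    ∃ v0 : ℕ, v0 < q ∧ Nonempty (G ≃g turanSuspAt n q v0) := by
  have hw : Bᶜ.card + q = n := by
    rw [← hq, card_compl, Fintype.card_fin]
    have := card_le_univ B
    rw [Fintype.card_fin] at this
    omega
  have hwz : (Bᶜ.card : ℤ) = n - q := by omega
  obtain ⟨c, hc⟩ : ∃ c, (side B f c).card ≤ (side B f !c).card := by
    rcases le_total (side B f true).card (side B f false).card with h | h
    exacts [⟨true, h⟩, ⟨false, h⟩]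
  have hs := card_side_add B f c
  rw [hq] at hs
  have t1 := adjPairs_compl_add (G := G) B
  rw [adjPairs_eq_side hpr c] at t1
  have t2 := adjPairs_le (G := G) (side B f c) (side B f !c)
  have deg1 : ∀ x ∈ Bᶜ, degIn G x B ≤ 1 := fun x hx =>
    degIn_le_one (hin x (mem_compl.1 hx))
  have t3 := sum_degIn_le deg1
  have t4 := adjPairs_self_le (G := G) Bᶜ
  have t5 : (side B f c).card * (side B f !c).card ≤ q ^ 2 / 4 := by
    rw [Nat.le_div_iff_mul_le (by norm_num), ← hs]
    zify
    nlinarith [sq_nonneg (((side B f c).card : ℤ) - (side B f !c).card)]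
  have t5' : ((side B f c).card * (side B f !c).card : ℤ) ≤ ((q ^ 2 / 4 : ℕ) : ℤ) := by
    exact_mod_cast t5
  rw [hwz] at t3 t4
  have p1 : ((side B f c).card * (side B f !c).card : ℤ)
      ≤ adjPairs G (side B f c) (side B f !c) := by nlinarith
  have p2 : (Bᶜ.card * 1 : ℤ) ≤ adjPairs G Bᶜ B := by rw [hwz]; nlinarith
  have p3 : (Bᶜ.card * (Bᶜ.card - 1) : ℤ) ≤ adjPairs G Bᶜ Bᶜ := by rw [hwz]; nlinarith
  have p4 : q ^ 2 / 4 ≤ (side B f c).card * (side B f !c).card := by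
    zify; push_cast at *; nlinarith
  have hcard : (side B f c).card = q / 2 ∧ (side B f !c).card = q - q / 2 := by
    generalize (side B f c).card = a at *
    generalize (side B f !c).card = b at *
    have h4 : q ^ 2 ≤ 4 * (a * b) + 3 := by omega
    have : b ≤ a + 1 := by
      by_contra hcon
      obtain ⟨d, rfl⟩ : ∃ d, b = a + 2 + d := ⟨b - (a + 2), by omega⟩
      rw [← hs] at h4
      nlinarith
    omega
  have a1 := adj_of_card_mul_card_le p1
  have a2 := degIn_eq_of_sum_le deg1 p2
  have a3 := adj_of_card_mul_pred_le p3
  obtain ⟨x₀, hx₀⟩ : Bᶜ.Nonempty := card_pos.1 (by omega)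
  have hatt : ∀ x ∈ Bᶜ, att x = att x₀ := by
    intro x hx
    by_cases e : x = x₀
    · rw [e]
    · exact hout x (mem_compl.1 hx) x₀ (mem_compl.1 hx₀) (a3 x hx x₀ hx₀ e)
  have hadj : ∀ x ∉ B, ∀ b ∈ B, G.Adj x b ↔ b = att x₀ := by
    intro x hx b hb
    have hx' := mem_compl.2 hx
    constructor
    · intro h
      rw [hin x hx b hb h, hatt x hx']
    · rintro rfl
      by_contra hcon
      have := a2 x hx'
      rw [degIn_eq_zero] at this
      · omega
      · intro y hy hxy
        have e := hin x hx y hy hxy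
        rw [hatt x hx'] at e
        exact hcon (e ▸ hxy)
  refine exists_iso_turanSuspAt hqn.le
    (fun x => if x ∈ B then (if f x = c then 0 else 1) else 2) (att x₀) ?_ ?_ ?_ ?_
  · simp only [hB, if_true]
    split_ifs <;> decide
  · rw [← hcard.1]
    congr 1
    ext x
    simp only [mem_filter, mem_univ, true_and, mem_side]
    split_ifs <;> simp_all
  · rw [← hcard.2]
    congr 1
    ext x
    simp only [mem_filter, mem_univ, true_and, mem_side]
    split_ifs with g1 g2 <;> simp [*]
    exact Bool.eq_not.2 g2
  · intro x y
    by_cases hx : x ∈ B <;> by_cases hy : y ∈ B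
    · have h1 := hpr x hx y hy
      have h2 := a1 x
      have h3 := a1 y
      simp only [mem_side, hx, hy, true_and, if_true] at h2 h3 ⊢
      have : ∀ z, (if f z = c then (0 : Fin 3) else 1) ≠ 2 := by
        intro z; split_ifs <;> decide
      simp only [this, or_false]
      constructor
      · intro hxy
        refine ⟨hxy.ne, ?_⟩
        have := h1 hxy
        by_cases g : f x = c <;> by_cases g' : f y = c <;> simp [g, g']
        · exact absurd (g.trans g'.symm) this
        · exact absurd ((Bool.eq_not.2 g).trans (Bool.eq_not.2 g').symm) this
      · rintro ⟨hne, h | h | h⟩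
        · have e1 : f x = c := by by_contra g; simp [g] at h
          have e2 : f y ≠ c := by intro g; simp [g] at h
          exact h2 e1 y ⟨hy, Bool.eq_not.2 e2⟩
        · have e1 : f y = c := by by_contra g; simp [g] at h
          have e2 : f x ≠ c := by intro g; simp [g] at h
          exact (h3 e1 x ⟨hx, Bool.eq_not.2 e2⟩).symm
        · exact absurd (h.1.trans h.2.symm) hne
    · rw [G.adj_comm, hadj y hy x hx]
      simp only [hx, hy, if_true, if_false]
      constructor
      · rintro rfl
        exact ⟨fun e => hy (e ▸ hx), by simp⟩
      · rintro ⟨-, h | h | h⟩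
        · simp at h
        · simp at h
        · refine h.1.resolve_right ?_
          split_ifs <;> decide
    · rw [hadj x hx y hy]
      simp only [hx, hy, if_true, if_false]
      constructor
      · rintro rfl
        exact ⟨fun e => hx (e ▸ hy), by simp⟩
      · rintro ⟨-, h | h | h⟩
        · simp at h
        · simp at h
        · refine h.2.resolve_right ?_
          split_ifs <;> decide
    · simp only [hx, hy, if_false]
      exact ⟨fun h => ⟨h.ne, by simp⟩, fun h => a3 x (mem_compl.2 hx) y (mem_compl.2 hy) h.1⟩

lemma sq_sub_one_le (q : ℕ) : q ^ 2 ≤ 4 * (q ^ 2 / 4) + 1 := by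
  have : q ^ 2 % 4 ≤ 1 := by
    rw [Nat.pow_mod]
    have : q % 4 < 4 := Nat.mod_lt _ (by norm_num)
    interval_cases q % 4 <;> simp
  omega

/-- A vertex set whose complement attaches through single vertices has large complement only if
the graph has few edges. -/
lemma adjPairs_univ_le_of_attachment [Fintype V] {B : Finset V} {f : V → Bool} {att : V → V}
    (hpr : ∀ x ∈ B, ∀ y ∈ B, G.Adj x y → f x ≠ f y)
    (hin : ∀ x ∉ B, ∀ b ∈ B, G.Adj x b → b = att x) :
    2 * adjPairs G univ univ
      ≤ (B.card : ℤ) ^ 2 + 2 * (Bᶜ.card : ℤ) * (Bᶜ.card + 1) := by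
  have h1 := adjPairs_compl_add (G := G) B
  have h2 := two_mul_adjPairs_le_sq hpr
  have h3 := adjPairs_self_le (G := G) Bᶜ
  have h4 := sum_degIn_le (G := G) (N := Bᶜ) (T := B) (c := 1)
    fun x hx => degIn_le_one (hin x (mem_compl.1 hx))
  rw [h1]
  nlinarith

end Extremal

end OddCycle

/-- Corollary.
If `r ≥ 3` and `G` is an `n`-vertex graph with `e(G) ≥ ⌊(n-r+1)²/4⌋ + C(r,2)`, and `G` is
neither in `𝒢_{n,r}` nor obtained from `T_{n-r+1,2}` by suspending `K_r`, then `G`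
contains a cycle `C_{2k+1}` for every `k` with `r ≤ 2k` and `100 k ≤ n`. -/
theorem stmt_1 (r n : ℕ) (hr3 : 3 ≤ r) (G : SimpleGraph (Fin n))
    (he : (n - r + 1) ^ 2 / 4 + r.choose 2 ≤ G.edgeSet.ncard)
    (h1 : ¬ FamilyG n r G)
    (h2 : ¬ ∃ v0 : ℕ, v0 < n - r + 1 ∧ Nonempty (G ≃g turanSuspAt n (n - r + 1) v0))
    (k : ℕ) (hk : r ≤ 2 * k) (hn : 100 * k ≤ n) :
    ∃ (v : Fin n) (w : G.Walk v v), w.IsCycle ∧ w.length = 2 * k + 1 := by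
  classical
  by_contra hno
  have hk2 : 2 ≤ k := by omega
  have hD := OddCycle.adjPairs_univ (G := G)
  set D := OddCycle.adjPairs G Finset.univ Finset.univ with hDdef
  obtain ⟨q, hq⟩ : ∃ q, q = n - r + 1 := ⟨_, rfl⟩
  rw [← hq] at he h2
  have hqz : (q : ℤ) = n - r + 1 := by omega
  have hch : 2 * ((r.choose 2 : ℕ) : ℤ) = r * (r - 1) := by
    have h := Nat.div_mul_cancel (Nat.even_mul_pred_self r).two_dvd
    rw [← Nat.choose_two_right] at h
    zify [show 1 ≤ r by omega] at h
    linarith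
  have hez : (((q ^ 2 / 4 : ℕ) : ℤ)) + (r.choose 2 : ℕ) ≤ G.edgeSet.ncard := by exact_mod_cast he
  have hfl : (q : ℤ) ^ 2 ≤ 4 * ((q ^ 2 / 4 : ℕ) : ℤ) + 1 := by
    exact_mod_cast OddCycle.sq_sub_one_le q
  have hD1 : ((n : ℤ) - r + 1) ^ 2 - 1 + 2 * r * (r - 1) ≤ 2 * D := by
    rw [← hqz]; linarith
  have hkz : (r : ℤ) ≤ 2 * k := by exact_mod_cast hk
  have hnz : (100 * k : ℤ) ≤ n := by exact_mod_cast hn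
  have hr0 : (3 : ℤ) ≤ r := by exact_mod_cast hr3
  have hE : ((Fintype.card (Fin n) : ℤ) - 2 * k + 1) ^ 2 - 1 + 4 * k * (2 * k - 1) ≤ 2 * D := by
    rw [Fintype.card_fin]
    refine le_trans ?_ hD1
    nlinarith [mul_nonneg (sub_nonneg.2 hkz) (show (0 : ℤ) ≤ 2 * (n + 1) - r - 2 * k
      - 2 * (2 * k + r - 1) by linarith)]
  have hD2 : 4802 * (Fintype.card (Fin n) : ℤ) ^ 2 ≤ 10000 * D := by
    rw [Fintype.card_fin]
    have g : (98 * n : ℤ) ≤ 100 * (n - r + 1) := by linarith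
    have g' : (98 * n : ℤ) * (98 * n) ≤ (100 * (n - r + 1)) * (100 * (n - r + 1)) :=
      mul_self_le_mul_self (by positivity) g
    nlinarith
  obtain ⟨H, χ, hH, hHn⟩ := OddCycle.exists_denseCore hk2 (by simpa using hn) hD2 hno
  obtain ⟨B, f, hHB, hpr, hear⟩ := OddCycle.exists_block (hH.not_isWrongEar hE) hH.proper
  have hHc := Finset.card_le_card hHB
  have hHl := hH.large
  obtain ⟨att, hB, hin, hout⟩ :=
    OddCycle.exists_attachment (Finset.card_pos.1 (by omega)) hear
  have hw : B.card + Bᶜ.card = n := by rw [Finset.card_add_card_compl, Fintype.card_fin]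
  have hwz : (B.card : ℤ) = n - Bᶜ.card := by omega
  rcases lt_trichotomy Bᶜ.card (r - 1) with hlt | heq | hgt
  · exact h1 (OddCycle.familyG_of_attachment hpr hB hin hout (by omega))
  · refine h2 (OddCycle.exists_iso_of_attachment hpr hB hin hout (by omega) (by omega) ?_)
    rw [← hDdef, hqz]
    linarith
  · have h3 := OddCycle.adjPairs_univ_le_of_attachment hpr hin
    rw [← hDdef, hwz] at h3
    have h4 : (r : ℤ) ≤ Bᶜ.card := by omega
    rw [Fintype.card_fin] at hHn
    have h5 : (100 * Bᶜ.card : ℤ) ≤ 19 * n := by omega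
    have h6 : (2 : ℤ) ≤ 2 * n + 4 - 3 * r - 3 * (Bᶜ.card + 1) := by linarith
    have h7 : (1 : ℤ) ≤ Bᶜ.card + 1 - r := by linarith
    nlinarith [mul_le_mul h7 h6 (by norm_num) (by linarith)]
end

section
/- Let k ≥ 2, 3 ≤ r ≤ 2k and n ≥ 100k be integers. If G is an n-vertex C_{2k+1}-free simple graph with chromatic number χ(G) ≥ r, then e(G) ≤ ⌊(n−r+1)²/4⌋ + C(r,2), with equality if and only if G is obtained from the bipartite Turán graph T_{n−r+1,2} by suspending K_r (i.e., G is obtained from T_{n−r+1,2} and K_r by sharing exactly one vertex). -/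
section

open Finset

namespace SimpleGraph

variable {V : Type*} {G : SimpleGraph V}

/-- In a `C_{2k+1}`-free graph the ends of a path of length `2k` are not adjacent. -/
theorem CycleFree.not_adj_of_isPath {k : ℕ} (hG : G.CycleFree (2 * k + 1)) (hk : 1 ≤ k)
    {a b : V} (p : G.Walk a b) (hp : p.IsPath) (hl : p.length = 2 * k) : ¬ G.Adj b a := by
  intro hba
  refine hG (Walk.cons hba p) ?_ (by simp [hl])
  rw [Walk.cons_isCycle_iff]
  refine ⟨hp, ?_⟩
  cases p with
  | nil => simp at hl; omega
  | cons h q =>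
    rw [Walk.cons_isPath_iff] at hp
    intro hm
    rw [Walk.edges_cons, List.mem_cons] at hm
    rcases hm with hm | hm
    · rw [Sym2.eq_swap, Sym2.congr_right] at hm
      subst hm
      have := (Walk.isPath_iff_nil.1 hp.1).length_eq_zero
      simp at hl; omega
    · exact hp.2 (q.snd_mem_support_of_mem_edges hm)

variable [DecidableRel G.Adj]

variable (G) in
/-- The neighbours of `v` lying in `S`. -/
def nbIn (S : Finset V) (v : V) : Finset V := S.filter (G.Adj v)

@[simp] theorem mem_nbIn {S : Finset V} {v w : V} : w ∈ G.nbIn S v ↔ w ∈ S ∧ G.Adj v w := by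
  simp [nbIn]

theorem nbIn_mono {S T : Finset V} (h : S ⊆ T) (v : V) : G.nbIn S v ⊆ G.nbIn T v :=
  filter_subset_filter _ h

theorem nbIn_subset (S : Finset V) (v : V) : G.nbIn S v ⊆ S := filter_subset _ _

variable [DecidableEq V]

variable (G) in
/-- `S` has at least `L` elements, and any two of them have at least `L` common neighbours
in `T`. -/
def Linked (L : ℕ) (T S : Finset V) : Prop :=
  L ≤ #S ∧ ∀ x ∈ S, ∀ y ∈ S, x ≠ y → L ≤ #(G.nbIn T x ∩ G.nbIn T y)

theorem Linked.exists_isPath {L : ℕ} {T S : Finset V} (hS : G.Linked L T S) {j : ℕ} (hj : 1 ≤ j)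
    {F : Finset V} (hF : #F + 2 * j ≤ L) {x y : V} (hx : x ∈ S) (hy : y ∈ S) (hxy : x ≠ y)
    (hxF : x ∉ F) (hyF : y ∉ F) :
    ∃ p : G.Walk x y, p.IsPath ∧ p.length = 2 * j ∧ ∀ z ∈ p.support, z ∉ F := by
  induction j, hj using Nat.le_induction generalizing F x with
  | base =>
    obtain ⟨z, hz, hzF⟩ := exists_mem_notMem_of_card_lt_card
      (show #F < #(G.nbIn T x ∩ G.nbIn T y) by have := hS.2 x hx y hy hxy; omega)
    simp only [mem_inter, mem_nbIn] at hz
    refine ⟨Walk.cons hz.1.2 (Walk.cons hz.2.2.symm Walk.nil), ?_, by simp, ?_⟩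
    · have h1 := hz.1.2.ne
      have h2 := hz.2.2.ne
      simp [Walk.isPath_def, h1, h2.symm, hxy]
    · simp [hxF, hyF, hzF]
  | succ j hj ih =>
    obtain ⟨x', hx', hx'F⟩ := exists_mem_notMem_of_card_lt_card
      (show #(insert x (insert y F)) < #S by
        have := hS.1
        have := card_insert_le x (insert y F)
        have := card_insert_le y F
        omega)
    simp only [mem_insert, not_or] at hx'F
    obtain ⟨z, hz, hzF⟩ := exists_mem_notMem_of_card_lt_card
      (show #(insert y F) < #(G.nbIn T x ∩ G.nbIn T x') by
        have := hS.2 x hx x' hx' (Ne.symm hx'F.1)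
        have := card_insert_le y F
        omega)
    simp only [mem_inter, mem_nbIn] at hz
    simp only [mem_insert, not_or] at hzF
    have hc : #(insert x (insert z F)) + 2 * j ≤ L := by
      have := card_insert_le x (insert z F)
      have := card_insert_le z F
      omega
    have hzx' := hz.2.2.ne
    obtain ⟨p, hp, hl, hs⟩ := ih hc hx' hx'F.2.1 (by simp [hx'F.1, hzx', hx'F.2.2])
      (by simp [Ne.symm hxy, Ne.symm hzF.1, hyF])
    have hzp : z ∉ p.support := fun h => hs z h (by simp)
    have hxp : x ∉ p.support := fun h => hs x h (by simp)
    refine ⟨Walk.cons hz.1.2 (Walk.cons hz.2.2.symm p), ?_, by simp [hl]; ring, ?_⟩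
    · simp [Walk.cons_isPath_iff, hp, hzp, hxp, hz.1.2.ne]
    · intro v hv
      simp only [Walk.support_cons, List.mem_cons] at hv
      rcases hv with rfl | rfl | hv
      · exact hxF
      · exact hzF.2
      · exact fun h => hs v hv (by simp [h])

variable {k : ℕ} {S T : Finset V}

theorem Linked.not_adj (hS : G.Linked (2 * k) T S) (hG : G.CycleFree (2 * k + 1)) (hk : 1 ≤ k)
    {x y : V} (hx : x ∈ S) (hy : y ∈ S) : ¬ G.Adj x y := by
  intro h
  obtain ⟨p, hp, hl, -⟩ := hS.exists_isPath hk (F := ∅) (by simp) hx hy h.ne (by simp) (by simp)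
  exact hG.not_adj_of_isPath hk p hp hl h.symm

/-- A `C_{2k+1}`-free graph has no path of length three with its ends in a linked set. -/
theorem Linked.no_ear_three (hS : G.Linked (2 * k) T S) (hG : G.CycleFree (2 * k + 1))
    (hk : 2 ≤ k) {x y a b : V} (hx : x ∈ S) (hy : y ∈ S) (hxy : x ≠ y) (hxa : G.Adj x a)
    (hab : G.Adj a b) (hby : G.Adj b y) (hay : a ≠ y) (hbx : b ≠ x) : False := by
  obtain ⟨p, hp, hl, hs⟩ := hS.exists_isPath (j := k - 1) (by omega) (F := {a, b})
    (by have := card_le_two (a := a) (b := b); omega) hx hy hxy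
    (by simp [hxa.ne, hbx.symm]) (by simp [hay.symm, hby.ne'])
  have ha : a ∉ p.support := fun h => hs a h (by simp)
  have hb : b ∉ p.support := fun h => hs b h (by simp)
  refine hG.not_adj_of_isPath (by omega) (Walk.cons hab.symm (Walk.cons hxa.symm p)) ?_ ?_ hby.symm
  · simp [Walk.cons_isPath_iff, hp, ha, hb, hab.ne']
  · simp [hl]; omega

/-- A `C_{2k+1}`-free graph, `k ≥ 3`, has no path of length five with its ends in a
linked set. -/
theorem Linked.no_ear_five (hS : G.Linked (2 * k) T S) (hG : G.CycleFree (2 * k + 1))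
    (hk : 3 ≤ k) {x y a b c d : V} (hx : x ∈ S) (hy : y ∈ S) (hxa : G.Adj x a)
    (hab : G.Adj a b) (hbc : G.Adj b c) (hcd : G.Adj c d) (hdy : G.Adj d y)
    (hn : [x, a, b, c, d, y].Nodup) : False := by
  simp only [List.nodup_cons, List.mem_cons, List.not_mem_nil, or_false, not_or] at hn
  obtain ⟨⟨-, hxb, hxc, hxd, hxy⟩, ⟨-, hac, had, hay⟩, ⟨-, hbd, hby⟩, ⟨-, hcy⟩, -, -⟩ := hn
  obtain ⟨p, hp, hl, hs⟩ := hS.exists_isPath (j := k - 2) (by omega) (F := {a, b, c, d})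
    (by have := card_le_four (a := a) (b := b) (c := c) (d := d); omega) hx hy hxy
    (by simp [hxa.ne, hxb, hxc, hxd]) (by simp [Ne.symm hay, Ne.symm hby, Ne.symm hcy, hdy.ne'])
  have ha : a ∉ p.support := fun h => hs a h (by simp)
  have hb : b ∉ p.support := fun h => hs b h (by simp)
  have hc : c ∉ p.support := fun h => hs c h (by simp)
  have hd : d ∉ p.support := fun h => hs d h (by simp)
  refine hG.not_adj_of_isPath (by omega) (Walk.cons hcd.symm (Walk.cons hbc.symm
    (Walk.cons hab.symm (Walk.cons hxa.symm p)))) ?_ ?_ hdy.symm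
  · simp [Walk.cons_isPath_iff, hp, ha, hb, hc, hd, hab.ne', hbc.ne', hcd.ne', Ne.symm hac,
      Ne.symm had, Ne.symm hbd]
  · simp [hl]; omega

/-- Vertices with two neighbours each in a linked set are not adjacent. -/
theorem Linked.not_adj_of_two_le (hS : G.Linked (2 * k) T S) (hG : G.CycleFree (2 * k + 1))
    (hk : 2 ≤ k) {a b : V} (ha : 2 ≤ #(G.nbIn S a)) (hb : 2 ≤ #(G.nbIn S b)) : ¬ G.Adj a b := by
  intro hab
  obtain ⟨x, hx⟩ := card_pos.1 (show 0 < #(G.nbIn S a) by omega)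
  obtain ⟨y, hy, hyx⟩ := exists_mem_ne (show 1 < #(G.nbIn S b) by omega) x
  rw [mem_nbIn] at hx hy
  refine hS.no_ear_three hG hk hx.1 hy.1 hyx.symm hx.2.symm hab hy.2 ?_ ?_
  · rintro rfl
    exact hS.not_adj hG (by omega) hx.1 hy.1 hx.2.symm
  · rintro rfl
    exact hS.not_adj hG (by omega) hx.1 hy.1 hy.2

/-- A set with enough vertices whose degrees into itself are large contains long paths. -/
theorem exists_isPath_of_le_nbIn {d : ℕ} (hS : S.Nonempty) (hd : ∀ a ∈ S, d ≤ #(G.nbIn S a))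
    {j : ℕ} (hj : j ≤ d) :
    ∃ a b : V, ∃ p : G.Walk a b, p.IsPath ∧ p.length = j ∧ ∀ z ∈ p.support, z ∈ S := by
  induction j with
  | zero =>
    obtain ⟨a, ha⟩ := hS
    exact ⟨a, a, Walk.nil, by simp, by simp, by simp [ha]⟩
  | succ j ih =>
    obtain ⟨a, b, p, hp, hl, hs⟩ := ih (by omega)
    have hlt : #(p.support.toFinset.erase a) < #(G.nbIn S a) := by
      rw [card_erase_of_mem (by simp)]
      have h1 := List.toFinset_card_le p.support
      have h2 := hd a (hs a (by simp))
      rw [Walk.length_support] at h1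
      omega
    obtain ⟨c, hc, hcp⟩ := exists_mem_notMem_of_card_lt_card hlt
    rw [mem_nbIn] at hc
    refine ⟨c, b, Walk.cons hc.2.symm p, ?_, by simp [hl], ?_⟩
    · rw [Walk.cons_isPath_iff]
      refine ⟨hp, fun h => hcp ?_⟩
      simp [hc.2.ne', h]
    · intro z hz
      simp only [Walk.support_cons, List.mem_cons] at hz
      rcases hz with rfl | hz
      · exact hc.1
      · exact hs z hz

/-- Inside a neighbourhood of a `C_{2k+1}`-free graph some degree is small. -/
theorem CycleFree.exists_nbIn_lt (hG : G.CycleFree (2 * k + 1)) (hk : 1 ≤ k) {v : V}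
    (hS : S.Nonempty) (hv : ∀ a ∈ S, G.Adj v a) : ∃ a ∈ S, #(G.nbIn S a) < 2 * k := by
  by_contra! h
  obtain ⟨a, b, p, hp, hl, hs⟩ := exists_isPath_of_le_nbIn hS h (j := 2 * k - 1) (by omega)
  have ha := hv a (hs a (by simp))
  have hb := hv b (hs b (by simp))
  refine hG.not_adj_of_isPath hk (Walk.cons ha p) ?_ (by simp [hl]; omega) hb.symm
  rw [Walk.cons_isPath_iff]
  exact ⟨hp, fun h => (hv v (hs v h)).ne rfl⟩


variable (G) in
/-- The number of ordered pairs of adjacent vertices in `S ×ˢ T`. -/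
def pairs (S T : Finset V) : ℕ := ∑ s ∈ S, #(G.nbIn T s)

omit [DecidableEq V] in
theorem pairs_comm (S T : Finset V) : G.pairs S T = G.pairs T S := by
  simp only [pairs, nbIn, card_filter]
  rw [sum_comm]
  simp only [G.adj_comm]

theorem pairs_union_left {S S' : Finset V} (h : Disjoint S S') (T : Finset V) :
    G.pairs (S ∪ S') T = G.pairs S T + G.pairs S' T := sum_union h

theorem pairs_union_right {T T' : Finset V} (S : Finset V) (h : Disjoint T T') :
    G.pairs S (T ∪ T') = G.pairs S T + G.pairs S T' := by
  rw [pairs_comm, pairs_union_left h, pairs_comm T, pairs_comm T']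

theorem pairs_union_self {S T : Finset V} (h : Disjoint S T) :
    G.pairs (S ∪ T) (S ∪ T) = G.pairs S S + 2 * G.pairs S T + G.pairs T T := by
  rw [pairs_union_left h, pairs_union_right _ h, pairs_union_right _ h, pairs_comm T S]
  ring

theorem pairs_insert_self {a : V} {S : Finset V} (h : a ∉ S) :
    G.pairs (insert a S) (insert a S) = G.pairs S S + 2 * #(G.nbIn S a) := by
  have h1 : Disjoint {a} S := by simpa using h
  rw [insert_eq, pairs_union_self h1]
  simp [pairs, nbIn, filter_singleton]
  ring

omit [DecidableEq V] in
theorem nbIn_eq_empty_of_forall {v : V} (h : ∀ w ∈ S, ¬ G.Adj v w) : G.nbIn S v = ∅ := by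
  ext w; simpa using h w

omit [DecidableEq V] in
theorem pairs_eq_zero (h : ∀ v ∈ S, ∀ w ∈ T, ¬ G.Adj v w) : G.pairs S T = 0 :=
  sum_eq_zero fun v hv => by rw [nbIn_eq_empty_of_forall (h v hv), card_empty]

omit [DecidableEq V] in
theorem pairs_le_mul (S T : Finset V) : G.pairs S T ≤ #S * #T := by
  rw [← smul_eq_mul]
  exact sum_le_card_nsmul _ _ _ fun v _ => card_le_card (nbIn_subset _ _)

/-- The neighbourhood of a vertex of a `C_{2k+1}`-free graph spans few edges. -/
theorem CycleFree.pairs_self_le (hG : G.CycleFree (2 * k + 1)) (hk : 1 ≤ k) {v : V}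
    (hv : ∀ a ∈ S, G.Adj v a) : G.pairs S S ≤ 4 * k * #S := by
  induction S using Finset.strongInduction with
  | H S ih =>
    rcases S.eq_empty_or_nonempty with rfl | hS
    · simp [pairs]
    · obtain ⟨a, ha, hlt⟩ := hG.exists_nbIn_lt hk hS hv
      have h1 := ih (S.erase a) (erase_ssubset ha) fun b hb => hv b (mem_of_mem_erase hb)
      have h2 := pairs_insert_self (G := G) (notMem_erase a S)
      rw [insert_erase ha] at h2
      have h3 := card_le_card (nbIn_mono (G := G) (erase_subset a S) a)
      have h4 := card_erase_add_one ha
      rw [← h4, mul_add]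
      omega

variable (G) in
/-- A set maximising `8 e(U) - 3 |U|² / 2` has large minimum degree, and outside vertices
have few neighbours in it. -/
theorem exists_optimal_subset [Fintype V] : ∃ U : Finset V,
    (∀ v ∈ U, 6 * #U ≤ 16 * #(G.nbIn U v) + 3) ∧
    (∀ v ∉ U, 16 * #(G.nbIn U v) ≤ 6 * #U + 3) ∧
    8 * G.pairs univ univ + 3 * #U ^ 2 ≤ 8 * G.pairs U U + 3 * Fintype.card V ^ 2 := by
  obtain ⟨U, -, hU⟩ := exists_max_image (univ : Finset (Finset V))
    (fun U => 8 * (G.pairs U U : ℤ) - 3 * (#U : ℤ) ^ 2) univ_nonempty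
  refine ⟨U, fun v hv => ?_, fun v hv => ?_, ?_⟩
  · have h := hU (U.erase v) (mem_univ _)
    have h2 := pairs_insert_self (G := G) (notMem_erase v U)
    rw [insert_erase hv] at h2
    have h3 := card_le_card (nbIn_mono (G := G) (erase_subset v U) v)
    have h4 := card_erase_add_one hv
    rw [h2, ← h4] at h
    rw [← h4]
    push_cast at h
    zify at h3 ⊢
    nlinarith
  · have h := hU (insert v U) (mem_univ _)
    rw [pairs_insert_self hv, card_insert_of_notMem hv] at h
    push_cast at h
    zify
    nlinarith
  · have h := hU univ (mem_univ _)
    rw [card_univ] at h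
    zify
    linarith

/-- Passing from a linked set to the vertices with two neighbours in it. -/
theorem Linked.filter_two_le {U : Finset V} (hS : G.Linked (2 * k) T S)
    (hG : G.CycleFree (2 * k + 1)) (hk : 2 ≤ k)
    (hU : ∀ v ∈ U, 6 * #U ≤ 16 * #(G.nbIn U v) + 3) (hm : 83 * k ≤ #U) (hSU : S ⊆ U)
    (hS' : 36 ≤ #S) :
    G.Linked (2 * k) U (U.filter fun v => 2 ≤ #(G.nbIn S v)) ∧
      17 * #U ≤ 50 * #(U.filter fun v => 2 ≤ #(G.nbIn S v)) := by
  set Y := U.filter fun v => 2 ≤ #(G.nbIn S v) with hY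
  have hcard : 17 * #U ≤ 50 * #Y := by
    have h1 : #S * (6 * #U) ≤ 16 * G.pairs S U + #S * 3 := by
      rw [pairs, mul_sum, ← smul_eq_mul, ← smul_eq_mul (a := #S) (b := 3), ← sum_const, ← sum_const,
        ← sum_add_distrib]
      exact sum_le_sum fun v hv => hU v (hSU hv)
    have h2 : G.pairs S U ≤ #Y * #S + #U := by
      rw [pairs_comm, pairs, ← sum_filter_add_sum_filter_not U fun v => 2 ≤ #(G.nbIn S v)]
      refine add_le_add ?_ ?_
      · rw [← smul_eq_mul]
        exact sum_le_card_nsmul _ _ _ fun v _ => card_le_card (nbIn_subset _ _)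
      · calc _ ≤ #(U.filter fun v => ¬ 2 ≤ #(G.nbIn S v)) • 1 :=
              sum_le_card_nsmul _ _ _ fun v hv => by
                have := (mem_filter.1 hv).2
                omega
          _ ≤ #U := by simpa using card_filter_le _ _
    by_contra! hlt
    have h3 : 166 ≤ #U := by omega
    have h4 : 50 * (#Y * #S) + #S ≤ 17 * #U * #S := by nlinarith
    nlinarith
  refine ⟨⟨by omega, fun y hy y' hy' _ => ?_⟩, hcard⟩
  have hind : ∀ y ∈ Y, G.nbIn U y ⊆ U \ Y := by
    intro y hy z hz
    rw [mem_nbIn] at hz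
    rw [mem_sdiff]
    refine ⟨hz.1, fun hzY => ?_⟩
    exact hS.not_adj_of_two_le hG hk (mem_filter.1 hy).2 (mem_filter.1 hzY).2 hz.2
  have h1 := card_le_card (union_subset (hind y hy) (hind y' hy'))
  have h2 := card_union_add_card_inter (G.nbIn U y) (G.nbIn U y')
  rw [card_sdiff_of_subset (show Y ⊆ U from filter_subset _ _)] at h1
  have h3 := card_le_card (show Y ⊆ U from filter_subset _ _)
  have h4 := hU y (mem_filter.1 hy).1
  have h5 := hU y' (mem_filter.1 hy').1
  omega

/-- A subset of large minimum degree that contains a large linked set is bipartite with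
linked classes. -/
theorem Linked.exists_bipartition {U : Finset V} (hS : G.Linked (2 * k) T S)
    (hG : G.CycleFree (2 * k + 1)) (hk : 2 ≤ k)
    (hU : ∀ v ∈ U, 6 * #U ≤ 16 * #(G.nbIn U v) + 3) (hm : 83 * k ≤ #U) (hSU : S ⊆ U)
    (hS' : 36 ≤ #S) :
    ∃ X Y : Finset V, X ∪ Y = U ∧ Disjoint X Y ∧ G.Linked (2 * k) U X ∧ G.Linked (2 * k) U Y ∧
      (∀ x ∈ X, 2 ≤ #(G.nbIn Y x)) ∧ ∀ y ∈ Y, 2 ≤ #(G.nbIn X y) := by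
  obtain ⟨h1, h1'⟩ := hS.filter_two_le hG hk hU hm hSU hS'
  set Y₀ := U.filter fun v => 2 ≤ #(G.nbIn S v)
  have hY₀ : Y₀ ⊆ U := filter_subset _ _
  obtain ⟨h2, h2'⟩ := h1.filter_two_le hG hk hU hm hY₀ (by omega)
  set X := U.filter fun v => 2 ≤ #(G.nbIn Y₀ v) with hX
  have hXU : X ⊆ U := filter_subset _ _
  obtain ⟨h3, -⟩ := h2.filter_two_le hG hk hU hm hXU (by omega)
  set Y := U.filter fun v => 2 ≤ #(G.nbIn X v) with hY
  have hYU : Y ⊆ U := filter_subset _ _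
  have hdisj : ∀ (A : Finset V) {B : Finset V}, G.Linked (2 * k) U B →
      (∀ v ∈ A, 2 ≤ #(G.nbIn B v)) → Disjoint B A := by
    intro A B hB hA
    rw [disjoint_right]
    intro v hvA hvB
    obtain ⟨w, hw⟩ := card_pos.1 (show 0 < #(G.nbIn B v) by have := hA v hvA; omega)
    rw [mem_nbIn] at hw
    exact hB.not_adj hG (by omega) hvB hw.1 hw.2
  have hd₀ : Disjoint Y₀ X := hdisj X h1 fun v hv => (mem_filter.1 hv).2
  have hd : Disjoint X Y := hdisj Y h2 fun v hv => (mem_filter.1 hv).2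
  have hun : X ∪ Y = U := by
    refine subset_antisymm (union_subset hXU hYU) fun v hv => ?_
    by_contra hv'
    have hv₁ : ¬ 2 ≤ #(G.nbIn Y₀ v) := fun h => hv' (mem_union_left _ (mem_filter.2 ⟨hv, h⟩))
    have hv₂ : ¬ 2 ≤ #(G.nbIn X v) := fun h => hv' (mem_union_right _ (mem_filter.2 ⟨hv, h⟩))
    have h4 : G.nbIn U v ⊆ G.nbIn X v ∪ (G.nbIn Y₀ v ∪ (U \ (Y₀ ∪ X))) := by
      intro w hw
      simp only [mem_union, mem_nbIn, mem_sdiff] at hw ⊢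
      tauto
    have h5 := card_le_card h4
    have h6 := card_union_le (G.nbIn X v) (G.nbIn Y₀ v ∪ (U \ (Y₀ ∪ X)))
    have h7 := card_union_le (G.nbIn Y₀ v) (U \ (Y₀ ∪ X))
    rw [card_sdiff_of_subset (union_subset hY₀ hXU), card_union_of_disjoint hd₀] at h7
    have h8 := hU v hv
    have h9 := card_le_card hXU
    have h10 := card_le_card hY₀
    have h11 := card_le_card (union_subset hY₀ hXU)
    rw [card_union_of_disjoint hd₀] at h11
    omega
  refine ⟨X, Y, hun, hd, h2, h3, fun x hx => ?_, fun y hy => (mem_filter.1 hy).2⟩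
  have h4 : G.nbIn U x ⊆ G.nbIn Y x := by
    intro w hw
    rw [mem_nbIn] at hw ⊢
    refine ⟨?_, hw.2⟩
    have := hw.1
    rw [← hun, mem_union] at this
    exact this.resolve_left fun hwX => h2.not_adj hG (by omega) hx hwX hw.2
  have h5 := card_le_card h4
  have h6 := hU x (hXU hx)
  omega

theorem pairs_bipartite {X Y : Finset V} (hd : Disjoint X Y) (hX : ∀ x ∈ X, ∀ y ∈ X, ¬ G.Adj x y)
    (hY : ∀ x ∈ Y, ∀ y ∈ Y, ¬ G.Adj x y) :
    G.pairs (X ∪ Y) (X ∪ Y) = 2 * G.pairs X Y := by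
  rw [pairs_union_self hd, pairs_eq_zero hX, pairs_eq_zero hY]
  ring

/-- A vertex of maximum degree yields an upper bound for the number of edges. -/
theorem CycleFree.pairs_self_le_of_max {U : Finset V} (hG : G.CycleFree (2 * k + 1)) (hk : 1 ≤ k)
    {v : V} (hmax : ∀ u ∈ U, #(G.nbIn U u) ≤ #(G.nbIn U v)) :
    G.pairs U U ≤ 4 * k * #(G.nbIn U v) + 2 * (#U - #(G.nbIn U v)) * #(G.nbIn U v) := by
  set A := G.nbIn U v with hA
  have hAU : A ⊆ U := nbIn_subset _ _
  have h1 : G.pairs A A ≤ 4 * k * #A := hG.pairs_self_le hk (v := v) fun a ha => (mem_nbIn.1 ha).2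
  have h2 := pairs_union_self (G := G) (disjoint_sdiff (s := A) (t := U))
  have h3 := pairs_union_right (G := G) (U \ A) (disjoint_sdiff (s := A) (t := U))
  rw [union_sdiff_of_subset hAU] at h2 h3
  have h4 : G.pairs (U \ A) U ≤ #(U \ A) * #A := by
    rw [← smul_eq_mul]
    exact sum_le_card_nsmul _ _ _ fun u hu => hmax u (mem_sdiff.1 hu).1
  rw [card_sdiff_of_subset hAU] at h4
  rw [pairs_comm (U \ A) A] at h3
  rw [mul_assoc 2]
  omega

/-- The neighbours of a vertex of large degree contain a large linked set. -/
theorem CycleFree.exists_linked {U : Finset V} (hG : G.CycleFree (2 * k + 1)) (hk : 2 ≤ k)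
    (hU : ∀ v ∈ U, 6 * #U ≤ 16 * #(G.nbIn U v) + 3) (hm : 83 * k ≤ #U) {v : V}
    (hv : 12 * #U ≤ 25 * #(G.nbIn U v)) : ∃ S ⊆ U, 36 ≤ #S ∧ G.Linked (2 * k) U S := by
  set A := G.nbIn U v with hA
  have hAU : A ⊆ U := nbIn_subset _ _
  have h1 : G.pairs A A ≤ 4 * k * #A := hG.pairs_self_le (by omega) (v := v)
    fun a ha => (mem_nbIn.1 ha).2
  set S := A.filter fun a => 10 * #(G.nbIn A a) ≤ #U with hS
  have hSA : S ⊆ A := filter_subset _ _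
  have h2 : #(A \ S) * #U ≤ 10 * G.pairs A A := by
    calc #(A \ S) * #U ≤ ∑ a ∈ A \ S, 10 * #(G.nbIn A a) := by
          rw [← smul_eq_mul]
          refine card_nsmul_le_sum _ _ _ fun a ha => ?_
          simp only [hS, mem_sdiff, mem_filter] at ha
          have : ¬ 10 * #(G.nbIn A a) ≤ #U := fun h => ha.2 ⟨ha.1, h⟩
          omega
      _ ≤ ∑ a ∈ A, 10 * #(G.nbIn A a) := sum_le_sum_of_subset sdiff_subset
      _ = _ := by rw [pairs, mul_sum]
  have h3 : 83 * #(A \ S) ≤ 40 * #A := by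
    by_contra! hlt
    have h4 : #(A \ S) * #U ≤ 40 * k * #A := by linarith
    have h5 : 83 * k * #(A \ S) ≤ #U * #(A \ S) := Nat.mul_le_mul_right _ hm
    have h6 : 40 * #A * k < 83 * #(A \ S) * k := Nat.mul_lt_mul_of_pos_right hlt (by omega)
    nlinarith
  have h4 := card_sdiff_add_card_eq_card hSA
  refine ⟨S, hSA.trans hAU, by omega, by omega, fun x hx y hy _ => ?_⟩
  have hsub : ∀ a ∈ S, 6 * #U ≤ 16 * #(G.nbIn (U \ A) a) + 16 * #(G.nbIn A a) + 3 ∧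
      10 * #(G.nbIn A a) ≤ #U := by
    intro a ha
    have h5 := hU a (hAU (hSA ha))
    have h6 : G.nbIn U a ⊆ G.nbIn (U \ A) a ∪ G.nbIn A a := by
      intro w hw
      simp only [mem_union, mem_nbIn, mem_sdiff] at hw ⊢
      tauto
    have h7 := (card_le_card h6).trans (card_union_le _ _)
    exact ⟨by omega, (mem_filter.1 ha).2⟩
  have h5 := card_union_add_card_inter (G.nbIn (U \ A) x) (G.nbIn (U \ A) y)
  have h6 := card_le_card (union_subset (nbIn_subset (G := G) (U \ A) x) (nbIn_subset (G := G) (U \ A) y))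
  rw [card_sdiff_of_subset hAU] at h6
  have h7 := card_le_card (inter_subset_inter (nbIn_mono (G := G) (sdiff_subset (s := U) (t := A)) x)
    (nbIn_mono (G := G) (sdiff_subset (s := U) (t := A)) y))
  have h8 := hsub x hx
  have h9 := hsub y hy
  have h10 := card_le_card hAU
  omega

/-- A dense `C_{2k+1}`-free graph has a large bipartite core. -/
theorem CycleFree.exists_core [Fintype V] (hG : G.CycleFree (2 * k + 1)) (hk : 2 ≤ k)
    (hn : 100 * k ≤ Fintype.card V) (he : 12 * Fintype.card V ^ 2 ≤ 25 * G.pairs univ univ) :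
    ∃ X Y : Finset V, Disjoint X Y ∧ G.Linked (2 * k) (X ∪ Y) X ∧ G.Linked (2 * k) (X ∪ Y) Y ∧
      (∀ x ∈ X, 2 ≤ #(G.nbIn Y x)) ∧ (∀ y ∈ Y, 2 ≤ #(G.nbIn X y)) ∧
      (∀ v ∉ X ∪ Y, 16 * #(G.nbIn (X ∪ Y) v) ≤ 6 * #(X ∪ Y) + 3) ∧
      21 * Fintype.card V ^ 2 ≤ 25 * #(X ∪ Y) ^ 2 := by
  obtain ⟨U, hU, hU', hUe⟩ := G.exists_optimal_subset
  set n := Fintype.card V with hn'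
  have hne : U.Nonempty := by
    rw [nonempty_iff_ne_empty]
    rintro rfl
    rw [show G.pairs ∅ ∅ = 0 from rfl, card_empty] at hUe
    have : 0 < n := by omega
    nlinarith
  obtain ⟨v, hv, hmax⟩ := exists_max_image U (fun v => #(G.nbIn U v)) hne
  have h1 := hG.pairs_self_le_of_max (by omega) hmax
  have h2 : G.pairs U U ≤ #U * #(G.nbIn U v) := by
    rw [← smul_eq_mul]
    exact sum_le_card_nsmul _ _ _ hmax
  have hΔ : #(G.nbIn U v) ≤ #U := card_le_card (nbIn_subset _ _)
  have hm : 83 * n ≤ 100 * #U := by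
    zify [hΔ] at h1 hUe he hn ⊢
    by_contra! hlt
    set m : ℤ := ((#U : ℕ) : ℤ)
    set d : ℤ := ((#(G.nbIn U v) : ℕ) : ℤ)
    have h3 : 2 * (G.pairs U U : ℤ) ≤ (m + 2 * k) ^ 2 := by nlinarith [sq_nonneg (m + 2 * k - 2 * d)]
    have h4 : (0 : ℤ) ≤ m := by positivity
    have h5 : (0 : ℤ) ≤ k := by positivity
    have h6 : (2 : ℤ) ≤ k := by exact_mod_cast hk
    have h7 : 84 * (n : ℤ) ^ 2 ≤ 100 * (m ^ 2 + 16 * m * k + 16 * k ^ 2) := by nlinarith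
    have h8 : m * (100 * k) ≤ m * n := by gcongr
    have h9 : (100 * (k : ℤ)) ^ 2 ≤ n ^ 2 := by gcongr
    nlinarith
  have hd : 12 * #U ≤ 25 * #(G.nbIn U v) := by
    have hm0 : 0 < #U := card_pos.2 hne
    have h3 : #U ≤ n := card_le_univ U
    have h4 : 12 * #U ^ 2 ≤ 25 * G.pairs U U := by nlinarith
    by_contra! hlt
    nlinarith
  obtain ⟨S, hSU, hS, hSl⟩ := hG.exists_linked hk hU (by omega) hd
  obtain ⟨X, Y, rfl, hXY, hX, hY, hX2, hY2⟩ := hSl.exists_bipartition hG hk hU (by omega) hSU hS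
  refine ⟨X, Y, hXY, hX, hY, hX2, hY2, hU', ?_⟩
  have h3 := pairs_bipartite hXY (fun x hx y hy => hX.not_adj hG (by omega) hx hy)
    (fun x hx y hy => hY.not_adj hG (by omega) hx hy)
  have h4 := G.pairs_le_mul X Y
  rw [h3, card_union_of_disjoint hXY] at hUe
  rw [card_union_of_disjoint hXY]
  have h5 : 4 * (#X * #Y) ≤ (#X + #Y) ^ 2 := by
    zify; nlinarith [sq_nonneg ((#X : ℤ) - #Y)]
  nlinarith

/-- Greedy colouring of a bipartite graph together with a few further vertices. -/
theorem colorable_of_bipartite_union {P Q R : Finset V} {s : ℕ} (hs : 2 ≤ s)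
    (hall : ∀ v, v ∈ P ∨ v ∈ Q ∨ v ∈ R) (hPQ : Disjoint P Q) (hPQR : Disjoint (P ∪ Q) R)
    (hP : ∀ x ∈ P, ∀ y ∈ P, ¬ G.Adj x y) (hQ : ∀ x ∈ Q, ∀ y ∈ Q, ¬ G.Adj x y)
    (h : #R + 2 ≤ s ∨ #R + 1 ≤ s ∧ ∀ r ∈ R, ∀ p ∈ P, ∀ q ∈ Q, G.Adj r p → ¬ G.Adj r q) :
    G.Colorable s := by
  obtain ⟨s, rfl⟩ : ∃ s', s = s' + 2 := ⟨s - 2, by omega⟩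
  have key : ∀ T ⊆ R, ∃ f : V → Fin (s + 2), (∀ p ∈ P, f p = 0) ∧ (∀ q ∈ Q, f q = 1) ∧
      ∀ u ∈ P ∪ Q ∪ T, ∀ v ∈ P ∪ Q ∪ T, G.Adj u v → f u ≠ f v := by
    intro T
    induction T using Finset.induction_on with
    | empty =>
      refine fun _ => ⟨fun v => if v ∈ P then 0 else 1, by simp +contextual, fun q hq => ?_, ?_⟩
      · simp [disjoint_right.1 hPQ hq]
      · intro u hu v hv huv
        simp only [union_empty, mem_union] at hu hv
        have h1 := hP u
        have h2 := hQ u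
        by_cases huP : u ∈ P <;> by_cases hvP : v ∈ P <;> simp [huP, hvP]
        · exact h1 huP v hvP huv
        · exact h2 (hu.resolve_left huP) v (hv.resolve_left hvP) huv
    | insert a T ha ih =>
      intro hT
      obtain ⟨f, hfP, hfQ, hf⟩ := ih ((subset_insert a T).trans hT)
      have haR : a ∈ R := hT (mem_insert_self a T)
      have haPQ : a ∉ P ∪ Q := disjoint_right.1 hPQR haR
      have hcard := card_le_card hT
      rw [card_insert_of_notMem ha] at hcard
      obtain ⟨C, hC, hC0, hC1⟩ : ∃ C : Finset (Fin (s + 2)), #C + #T < s + 2 ∧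
          (∀ p ∈ P, G.Adj a p → 0 ∈ C) ∧ ∀ q ∈ Q, G.Adj a q → 1 ∈ C := by
        rcases h with h | ⟨h, h'⟩
        · refine ⟨{0, 1}, ?_, by simp, by simp⟩
          have := card_le_two (a := (0 : Fin (s + 2))) (b := 1)
          omega
        · by_cases hex : ∃ p ∈ P, G.Adj a p
          · obtain ⟨p, hp, hap⟩ := hex
            exact ⟨{0}, by simp; omega, by simp, fun q hq haq => (h' a haR p hp q hq hap haq).elim⟩
          · push Not at hex
            exact ⟨{1}, by simp; omega, fun p hp hap => (hex p hp hap).elim, by simp⟩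
      obtain ⟨c, -, hc⟩ := exists_mem_notMem_of_card_lt_card
        (show #(C ∪ T.image f) < #(univ : Finset (Fin (s + 2))) by
          have h1 := card_union_le C (T.image f)
          have h2 := card_image_le (s := T) (f := f)
          rw [card_univ, Fintype.card_fin]
          omega)
      simp only [mem_union, mem_image, not_or, not_exists, not_and] at hc
      have hne : ∀ v ∈ P ∪ Q ∪ T, G.Adj a v → c ≠ f v := by
        intro v hv hav
        simp only [mem_union] at hv
        rcases hv with (hv | hv) | hv
        · rw [hfP v hv]; rintro rfl; exact hc.1 (hC0 v hv hav)
        · rw [hfQ v hv]; rintro rfl; exact hc.1 (hC1 v hv hav)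
        · exact fun h => hc.2 v hv h.symm
      have hmem : ∀ v ∈ P ∪ Q ∪ insert a T, v ≠ a → v ∈ P ∪ Q ∪ T := by
        intro v hv hva
        simp only [mem_union, mem_insert, hva, false_or] at hv ⊢
        exact hv
      simp only [mem_union, not_or] at haPQ
      refine ⟨Function.update f a c, fun p hp => ?_, fun q hq => ?_, fun u hu v hv huv => ?_⟩
      · rw [Function.update_of_ne (by rintro rfl; exact haPQ.1 hp), hfP p hp]
      · rw [Function.update_of_ne (by rintro rfl; exact haPQ.2 hq), hfQ q hq]
      · by_cases hua : u = a
        · subst hua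
          rw [Function.update_self, Function.update_of_ne huv.ne']
          exact hne v (hmem v hv huv.ne') huv
        · rw [Function.update_of_ne hua]
          by_cases hva : v = a
          · subst hva
            rw [Function.update_self]
            exact (hne u (hmem u hu hua) huv.symm).symm
          · rw [Function.update_of_ne hva]
            exact hf u (hmem u hu hua) v (hmem v hv hva) huv
  obtain ⟨f, -, -, hf⟩ := key R Subset.rfl
  refine ⟨Coloring.mk f fun {u v} huv => hf u ?_ v ?_ huv⟩
  · simpa [or_assoc] using hall u
  · simpa [or_assoc] using hall v

/-- Non-adjacent subsets `A ⊆ X` and `B ⊆ Y` leave `#A * #B` pairs without an edge. -/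
theorem pairs_add_mul_le {X Y A B : Finset V} (hA : A ⊆ X) (hB : B ⊆ Y)
    (h : ∀ x ∈ A, ∀ y ∈ B, ¬ G.Adj x y) : G.pairs X Y + #A * #B ≤ #X * #Y := by
  have h1 := pairs_union_left (G := G) (disjoint_sdiff (s := A) (t := X)) Y
  have h2 := pairs_union_right (G := G) A (disjoint_sdiff (s := B) (t := Y))
  rw [union_sdiff_of_subset hA] at h1
  rw [union_sdiff_of_subset hB, pairs_eq_zero h] at h2
  have h3 := G.pairs_le_mul A (Y \ B)
  have h4 := G.pairs_le_mul (X \ A) Y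
  rw [card_sdiff_of_subset hB] at h3
  rw [card_sdiff_of_subset hA] at h4
  have h5 := card_le_card hA
  have h6 := card_le_card hB
  zify [h5, h6] at *
  nlinarith

variable (G) in
/-- A pair of disjoint linked sets in which every vertex has two neighbours in the other set. -/
structure IsCore (k : ℕ) (X Y : Finset V) : Prop where
  disj : Disjoint X Y
  linked_left : G.Linked (2 * k) (X ∪ Y) X
  linked_right : G.Linked (2 * k) (X ∪ Y) Y
  two_le_left : ∀ x ∈ X, 2 ≤ #(G.nbIn Y x)
  two_le_right : ∀ y ∈ Y, 2 ≤ #(G.nbIn X y)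

variable (G) in
/-- The vertices outside `X ∪ Y` with at least two neighbours in `X ∪ Y`, some of them in `Y`. -/
def attached [Fintype V] (X Y : Finset V) : Finset V :=
  univ.filter fun v => v ∉ X ∪ Y ∧ 2 ≤ #(G.nbIn (X ∪ Y) v) ∧ ∃ y ∈ Y, G.Adj v y

namespace IsCore

variable {X Y : Finset V}

theorem symm (c : G.IsCore k X Y) : G.IsCore k Y X :=
  ⟨c.disj.symm, union_comm X Y ▸ c.linked_right, union_comm X Y ▸ c.linked_left,
    c.two_le_right, c.two_le_left⟩

theorem not_adj (c : G.IsCore k X Y) (hG : G.CycleFree (2 * k + 1)) (hk : 2 ≤ k) {x y : V}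
    (hx : x ∈ X) (hy : y ∈ X) : ¬ G.Adj x y := c.linked_left.not_adj hG (by omega) hx hy

theorem not_adj_both (c : G.IsCore k X Y) (hG : G.CycleFree (2 * k + 1)) (hk : 2 ≤ k) {v x y : V}
    (hv : v ∉ X ∪ Y) (hx : x ∈ X) (hy : y ∈ Y) (hvx : G.Adj v x) : ¬ G.Adj v y := by
  intro hvy
  rw [mem_union, not_or] at hv
  obtain ⟨x', hx', hne⟩ := exists_mem_ne (show 1 < #(G.nbIn X y) from c.two_le_right y hy) x
  rw [mem_nbIn] at hx'
  refine c.linked_left.no_ear_three hG hk hx hx'.1 hne.symm hvx.symm hvy hx'.2 ?_ ?_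
  · rintro rfl; exact hv.1 hx'.1
  · rintro rfl; exact Finset.disjoint_left.1 c.disj hx hy

theorem nbIn_eq (c : G.IsCore k X Y) (hG : G.CycleFree (2 * k + 1)) (hk : 2 ≤ k) {v y : V}
    (hv : v ∉ X ∪ Y) (hy : y ∈ Y) (hvy : G.Adj v y) : G.nbIn (X ∪ Y) v = G.nbIn Y v := by
  refine subset_antisymm (fun w hw => ?_) (nbIn_mono subset_union_right v)
  rw [mem_nbIn, mem_union] at hw
  rw [mem_nbIn]
  exact ⟨hw.1.resolve_left fun h => c.not_adj_both hG hk hv h hy hw.2 hvy, hw.2⟩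

/-- Two outside vertices attached to the same class are not adjacent. -/
theorem not_adj_of_attached (c : G.IsCore k X Y) (hG : G.CycleFree (2 * k + 1)) (hk : 2 ≤ k)
    {w u x : V} (hw : w ∉ X ∪ Y) (hu : u ∉ X ∪ Y) (hx : x ∈ X) (hwx : G.Adj w x)
    (hu2 : 2 ≤ #(G.nbIn X u)) : ¬ G.Adj w u := by
  intro hwu
  rw [mem_union, not_or] at hw hu
  obtain ⟨x', hx', hne⟩ := exists_mem_ne (show 1 < #(G.nbIn X u) from hu2) x
  rw [mem_nbIn] at hx'
  refine c.linked_left.no_ear_three hG hk hx hx'.1 hne.symm hwx.symm hwu hx'.2 ?_ ?_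
  · rintro rfl; exact hw.1 hx'.1
  · rintro rfl; exact hu.1 hx

/-- If an outside vertex is adjacent to vertices attached to either class, then the
neighbourhoods of these vertices span no edge. -/
theorem not_adj_nbIn (c : G.IsCore k X Y) (hG : G.CycleFree (2 * k + 1)) (hk : 2 ≤ k)
    {w p q : V} (hw : w ∉ X ∪ Y) (hp : p ∉ X ∪ Y) (hq : q ∉ X ∪ Y) (hwp : G.Adj w p)
    (hwq : G.Adj w q) (hq2 : 2 ≤ #(G.nbIn X q)) {x y : V}
    (hx : x ∈ G.nbIn X q) (hy : y ∈ G.nbIn Y p) : ¬ G.Adj x y := by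
  intro hxy
  have hpq : p ≠ q := by
    rintro rfl
    rw [mem_nbIn] at hx hy
    exact c.not_adj_both hG hk hp hx.1 hy.1 hx.2 hy.2
  obtain ⟨x', hx', hne⟩ := exists_mem_ne (show 1 < #(G.nbIn X q) from hq2) x
  rw [mem_nbIn] at hx hx' hy
  rw [mem_union, not_or] at hw hp hq
  have hX : ∀ {z v : V}, z ∈ X → v ∉ X → z ≠ v := by rintro z v hz hv rfl; exact hv hz
  have hY : ∀ {z v : V}, z ∈ Y → v ∉ Y → z ≠ v := by rintro z v hz hv rfl; exact hv hz
  have hyX : y ∉ X := disjoint_right.1 c.disj hy.1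
  rcases Nat.lt_or_ge 2 k with hk' | hk'
  · refine c.linked_left.no_ear_five hG hk' hx'.1 hx.1 hx'.2.symm hwq.symm hwp hy.2 hxy.symm ?_
    simp [hX hx'.1 hq.1, hX hx'.1 hw.1, hX hx'.1 hp.1, hX hx'.1 hyX, hne, hwq.ne', hpq.symm,
      (hY hy.1 hq.2).symm, (hX hx.1 hq.1).symm, hwp.ne, (hY hy.1 hw.2).symm, (hX hx.1 hw.1).symm,
      (hY hy.1 hp.2).symm, (hX hx.1 hp.1).symm, hxy.ne']
  · obtain rfl : k = 2 := by omega
    refine hG.not_adj_of_isPath (by omega) (Walk.cons hx.2.symm (Walk.cons hwq.symm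
      (Walk.cons hwp (Walk.cons hy.2 Walk.nil)))) ?_ (by simp) hxy.symm
    simp [Walk.isPath_def, hxy.ne, hwq.ne', hpq.symm,
      (hY hy.1 hq.2).symm, (hX hx.1 hq.1), hwp.ne, (hY hy.1 hw.2).symm, (hX hx.1 hw.1),
      (hY hy.1 hp.2).symm, (hX hx.1 hp.1)]

variable [Fintype V]

theorem mem_attached (c : G.IsCore k X Y) (hG : G.CycleFree (2 * k + 1)) (hk : 2 ≤ k) {v : V}
    (hv : v ∈ G.attached X Y) :
    v ∉ X ∪ Y ∧ 2 ≤ #(G.nbIn Y v) ∧ ∃ y ∈ Y, G.Adj v y := by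
  simp only [attached, mem_filter, mem_univ, true_and] at hv
  obtain ⟨h1, h2, y, hy, hvy⟩ := hv
  rw [c.nbIn_eq hG hk h1 hy hvy] at h2
  exact ⟨h1, h2, y, hy, hvy⟩

theorem not_adj_union_attached (c : G.IsCore k X Y) (hG : G.CycleFree (2 * k + 1)) (hk : 2 ≤ k)
    {u v : V} (hu : u ∈ X ∪ G.attached X Y) (hv : v ∈ X ∪ G.attached X Y) : ¬ G.Adj u v := by
  intro huv
  rw [mem_union] at hu hv
  rcases hu with hu | hu <;> rcases hv with hv | hv
  · exact c.not_adj hG hk hu hv huv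
  · obtain ⟨h1, -, y, hy, hvy⟩ := c.mem_attached hG hk hv
    exact c.not_adj_both hG hk h1 hu hy huv.symm hvy
  · obtain ⟨h1, -, y, hy, huy⟩ := c.mem_attached hG hk hu
    exact c.not_adj_both hG hk h1 hv hy huv huy
  · obtain ⟨h1, h2, y, hy, huy⟩ := c.mem_attached hG hk hu
    obtain ⟨h1', h2', -⟩ := c.mem_attached hG hk hv
    exact c.symm.not_adj_of_attached hG hk (by rwa [union_comm]) (by rwa [union_comm]) hy huy h2' huv

theorem disjoint_union_attached (c : G.IsCore k X Y) (hG : G.CycleFree (2 * k + 1)) (hk : 2 ≤ k) :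
    Disjoint (X ∪ G.attached X Y) (Y ∪ G.attached Y X) := by
  rw [Finset.disjoint_left]
  intro v hv hv'
  rw [mem_union] at hv hv'
  rcases hv with hv | hv <;> rcases hv' with hv' | hv'
  · exact Finset.disjoint_left.1 c.disj hv hv'
  · exact (c.symm.mem_attached hG hk hv').1 (mem_union_right _ hv)
  · exact (c.mem_attached hG hk hv).1 (mem_union_right _ hv')
  · obtain ⟨h1, -, y, hy, hvy⟩ := c.mem_attached hG hk hv
    obtain ⟨-, -, x, hx, hvx⟩ := c.symm.mem_attached hG hk hv'
    exact c.not_adj_both hG hk h1 hx hy hvx hvy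

/-- An outside vertex with neighbours in both colour classes. -/
theorem exists_attached_of_adj (c : G.IsCore k X Y) (hG : G.CycleFree (2 * k + 1)) (hk : 2 ≤ k)
    {w p q : V} (hw : w ∉ X ∪ Y) (hp : p ∈ X ∪ G.attached X Y) (hq : q ∈ Y ∪ G.attached Y X)
    (hwp : G.Adj w p) (hwq : G.Adj w q) : p ∈ G.attached X Y ∧ q ∈ G.attached Y X := by
  have hw' : w ∉ Y ∪ X := by rwa [union_comm]
  rw [mem_union] at hp hq
  rcases hp with hp | hp <;> rcases hq with hq | hq
  · exact (c.not_adj_both hG hk hw hp hq hwp hwq).elim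
  · obtain ⟨h1, h2, -⟩ := c.symm.mem_attached hG hk hq
    exact (c.not_adj_of_attached hG hk hw (by rwa [union_comm]) hp hwp h2 hwq).elim
  · obtain ⟨h1, h2, -⟩ := c.mem_attached hG hk hp
    exact (c.symm.not_adj_of_attached hG hk hw' (by rwa [union_comm]) hq hwq h2 hwp).elim
  · exact ⟨hp, hq⟩

end IsCore

theorem card_eq_of_count {n m l w s a p q b : ℕ} (hn : m + l + w = n) (hm : 91 * n ≤ 100 * m)
    (hsn : 50 * (s + 1) ≤ n) (hws : s ≤ w) (ha : 4 * a ≤ m ^ 2) (hp : 16 * p ≤ l * (6 * m + 3))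
    (hq : q ≤ w) (hb : b + (l + w) ≤ (l + w) ^ 2)
    (he : (n - s) ^ 2 + 2 * (s * (s + 1)) ≤ 2 * (2 * a + 2 * p + 2 * q + b) + 1) :
    l = 0 ∧ w = s := by
  obtain ⟨c, rfl⟩ : ∃ c, w = s + c := ⟨w - s, by omega⟩
  rw [show n - s = m + (l + c) by omega] at he
  suffices l + c = 0 by omega
  by_contra hA
  have hA : 1 ≤ l + c := by omega
  set A := l + c with hA'
  have hlA : l ≤ A := by omega
  rw [show l + (s + c) = s + A by omega] at hb
  have hbig : 2 * A + 8 * s + 10 ≤ m := by omega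
  have hq' : q + l ≤ s + A := by omega
  have hl3 : l * (6 * m + 3) ≤ A * (6 * m + 3) := Nat.mul_le_mul_right _ hlA
  zify at *
  nlinarith [mul_le_mul_of_nonneg_left hbig (show (0 : ℤ) ≤ A by omega)]

theorem false_of_count {n m l w s c q b : ℕ} (hn : m + l + w = n) (hm : 91 * n ≤ 100 * m)
    (hsn : 50 * (s + 1) ≤ n) (hws : w + 1 = s) (hl : 2 ≤ l)
    (ha : 16 * c ≤ 4 * m ^ 2 + (l - 2) * (6 * m + 3))
    (hq : q ≤ w) (hb : b + (l + w) ≤ (l + w) ^ 2)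
    (he : (n - s) ^ 2 + 2 * (s * (s + 1)) ≤ 2 * (2 * c + 2 * q + b) + 1) : False := by
  obtain ⟨d, rfl⟩ : ∃ d, l = d + 2 := ⟨l - 2, by omega⟩
  rw [show n - s = m + (d + 1) by omega] at he
  rw [show d + 2 + w = s + (d + 1) by omega] at hb
  rw [show d + 2 - 2 = d by omega] at ha
  have hbig : 2 * d + 8 * s + 10 ≤ m := by omega
  have hq' : q + 1 ≤ s := by omega
  zify at *
  nlinarith [mul_le_mul_of_nonneg_left hbig (show (0 : ℤ) ≤ d by omega)]

omit [DecidableEq V] in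
theorem pairs_self_add_card_le (S : Finset V) : G.pairs S S + #S ≤ #S ^ 2 := by
  have : ∀ v ∈ S, #(G.nbIn S v) + 1 ≤ #S := fun v hv =>
    card_lt_card ⟨nbIn_subset _ _, fun h => G.irrefl (mem_nbIn.1 (h hv)).2⟩
  have := sum_le_card_nsmul S (fun v => #(G.nbIn S v) + 1) _ this
  rw [sum_add_distrib, smul_eq_mul, ← sq] at this
  simpa [pairs] using this

theorem filter_two_le_eq_attached [Fintype V] (X Y : Finset V) :
    ((X ∪ Y)ᶜ.filter fun v => 2 ≤ #(G.nbIn (X ∪ Y) v)) =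
      G.attached X Y ∪ G.attached Y X := by
  ext v
  simp only [attached, mem_filter, mem_compl, mem_union, mem_univ, true_and, union_comm Y X]
  constructor
  · rintro ⟨h1, h2⟩
    obtain ⟨u, hu⟩ := card_pos.1 (show 0 < #(G.nbIn (X ∪ Y) v) by omega)
    rw [mem_nbIn, mem_union] at hu
    rcases hu with ⟨hu | hu, hvu⟩
    · exact Or.inr ⟨h1, h2, u, hu, hvu⟩
    · exact Or.inl ⟨h1, h2, u, hu, hvu⟩
  · rintro (⟨h1, h2, -⟩ | ⟨h1, h2, -⟩) <;> exact ⟨h1, h2⟩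

namespace IsCore

variable {X Y : Finset V}

/-- The number of adjacent pairs, split according to the core and the vertices outside it. -/
theorem pairs_univ_eq [Fintype V] (c : G.IsCore k X Y) (hG : G.CycleFree (2 * k + 1)) (hk : 2 ≤ k)
    {L W : Finset V} (hLW : Disjoint L W) (hO : (X ∪ Y)ᶜ = L ∪ W) :
    G.pairs univ univ = 2 * G.pairs X Y + 2 * G.pairs L (X ∪ Y) + 2 * G.pairs W (X ∪ Y) +
      G.pairs (X ∪ Y)ᶜ (X ∪ Y)ᶜ := by
  rw [← union_compl (X ∪ Y), pairs_union_self disjoint_compl_right, pairs_comm (X ∪ Y) (X ∪ Y)ᶜ,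
    pairs_bipartite c.disj (fun x hx y hy => c.not_adj hG hk hx hy)
      (fun x hx y hy => c.symm.not_adj hG hk hx hy)]
  nth_rewrite 1 [hO]
  rw [pairs_union_left hLW]
  ring

/-- A `C_{2k+1}`-free graph with many edges and large chromatic number has no vertices with two
neighbours in its core. -/
theorem card_compl [Fintype V] (c : G.IsCore k X Y) (hG : G.CycleFree (2 * k + 1)) (hk : 2 ≤ k)
    {s n : ℕ} (hn : Fintype.card V = n) (hs : 2 ≤ s) (hsn : 50 * (s + 1) ≤ n)
    (hcol : ¬ G.Colorable s)
    (hU : ∀ v ∉ X ∪ Y, 16 * #(G.nbIn (X ∪ Y) v) ≤ 6 * #(X ∪ Y) + 3)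
    (hm : 91 * n ≤ 100 * #(X ∪ Y))
    (he : (n - s) ^ 2 + 2 * (s * (s + 1)) ≤ 2 * G.pairs univ univ + 1) :
    #(X ∪ Y)ᶜ = s ∧ ∀ v ∉ X ∪ Y, #(G.nbIn (X ∪ Y) v) ≤ 1 := by
  set U := X ∪ Y with hUdef
  set L := Uᶜ.filter fun v => 2 ≤ #(G.nbIn U v) with hL
  set W := Uᶜ.filter fun v => ¬ 2 ≤ #(G.nbIn U v) with hW
  have hLW : Disjoint L W := disjoint_filter_filter_not _ _ _
  have hO : Uᶜ = L ∪ W := (filter_union_filter_not_eq _ _).symm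
  have hcardO : #Uᶜ = #L + #W := by rw [hO, card_union_of_disjoint hLW]
  have hcard : #U + #L + #W = n := by
    rw [← hn, ← card_add_card_compl U, hcardO, add_assoc]
  have hXY : #X + #Y = #U := (card_union_of_disjoint c.disj).symm
  have hmul : 4 * (#X * #Y) ≤ #U ^ 2 := by
    rw [← hXY]; zify; nlinarith [sq_nonneg ((#X : ℤ) - #Y)]
  have ha := G.pairs_le_mul X Y
  have hp : ∀ {M : Finset V}, M ⊆ L → 16 * G.pairs M U ≤ #M * (6 * #U + 3) := by
    intro M hM
    rw [pairs, mul_sum, ← smul_eq_mul (#M)]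
    refine sum_le_card_nsmul _ _ _ fun v hv => hU v ?_
    simpa using (mem_filter.1 (hM hv)).1
  have hWle : ∀ v ∈ W, #(G.nbIn U v) ≤ 1 := fun v hv => by
    have := (mem_filter.1 hv).2
    omega
  have hq : G.pairs W U ≤ #W := by
    simpa [pairs] using sum_le_card_nsmul W _ 1 hWle
  have hb := G.pairs_self_add_card_le Uᶜ
  rw [hcardO] at hb
  rw [c.pairs_univ_eq hG hk hLW hO, ← hUdef] at he
  rcases Nat.lt_or_ge #W s with hws | hws
  · exfalso
    have hLatt : L = G.attached X Y ∪ G.attached Y X := filter_two_le_eq_attached X Y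
    have hPQ := c.disjoint_union_attached hG hk
    have hall : ∀ v, v ∈ X ∪ G.attached X Y ∨ v ∈ Y ∪ G.attached Y X ∨ v ∈ W := by
      intro v
      have : v ∈ U ∪ (L ∪ W) := by rw [← hO]; simp
      rw [hLatt] at this
      simp only [hUdef, mem_union] at this ⊢
      tauto
    have hdis : Disjoint (X ∪ G.attached X Y ∪ (Y ∪ G.attached Y X)) W := by
      rw [show X ∪ G.attached X Y ∪ (Y ∪ G.attached Y X) = U ∪ L by
        rw [hLatt, hUdef]; ext; simp only [mem_union]; tauto]
      rw [disjoint_union_left]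
      exact ⟨(disjoint_compl_right (a := U)).mono_right (filter_subset _ _), hLW⟩
    have key := fun h => hcol (colorable_of_bipartite_union hs hall hPQ hdis
      (fun _ hx _ hy => c.not_adj_union_attached hG hk hx hy)
      (fun _ hx _ hy => c.symm.not_adj_union_attached hG hk hx hy) h)
    obtain ⟨w, hwW, p, hp', q, hq', hwp, hwq⟩ : ∃ w ∈ W, ∃ p ∈ X ∪ G.attached X Y,
        ∃ q ∈ Y ∪ G.attached Y X, G.Adj w p ∧ G.Adj w q := by
      by_contra! h
      exact key (Or.inr ⟨hws, h⟩)
    have hw : w ∉ X ∪ Y := by simpa [hUdef] using (mem_filter.1 hwW).1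
    obtain ⟨hpa, hqa⟩ := c.exists_attached_of_adj hG hk hw hp' hq' hwp hwq
    obtain ⟨hpo, hp2, yp, hyp, hpyp⟩ := c.mem_attached hG hk hpa
    obtain ⟨hqo, hq2, xq, hxq, hqxq⟩ := c.symm.mem_attached hG hk hqa
    have hpq : p ≠ q := by rintro rfl; exact Finset.disjoint_left.1 hPQ hp' hq'
    have hnon := pairs_add_mul_le (nbIn_subset X q) (nbIn_subset Y p)
      fun x hx y hy => c.not_adj_nbIn hG hk hw hpo (by rwa [union_comm]) hwp hwq hq2 hx hy
    have hsub : {p, q} ⊆ L := by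
      rw [hLatt, insert_subset_iff, singleton_subset_iff]
      exact ⟨mem_union_left _ hpa, mem_union_right _ hqa⟩
    have hpair : #({p, q} : Finset V) = 2 := card_pair hpq
    have h2L := card_le_card hsub
    have hsplit := pairs_union_left (G := G) (disjoint_sdiff (s := {p, q}) (t := L)) U
    have hrest := hp (sdiff_subset (s := L) (t := {p, q}))
    rw [union_sdiff_of_subset hsub, pairs, pairs, sum_pair hpq, hUdef,
      c.nbIn_eq hG hk hpo hyp hpyp, union_comm X Y,
      c.symm.nbIn_eq hG hk hqo hxq hqxq, union_comm Y X, ← hUdef] at hsplit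
    rw [card_sdiff_of_subset hsub, hpair] at hrest
    refine false_of_count (c := G.pairs X Y + G.pairs L U) hcard hm hsn ?_ (by omega) ?_ hq hb
      (by omega)
    · have : ¬ #W + 2 ≤ s := fun h => key (Or.inl h)
      omega
    · change G.pairs L U = _ + G.pairs (L \ {p, q}) U at hsplit
      have := Nat.add_le_mul hq2 hp2
      omega
  · obtain ⟨hl, hw⟩ := card_eq_of_count hcard hm hsn hws (by omega) (hp Subset.rfl) hq hb (by omega)
    rw [card_eq_zero] at hl
    refine ⟨by rw [hcardO, hl, hw]; simp, fun v hv => hWle v ?_⟩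
    rw [hl, empty_union] at hO
    rw [← hO]; simpa using hv

end IsCore

variable (G) in
/-- `G` consists of a complete bipartite graph with classes `X`, `Y` and a clique on the remaining
vertices, all of which have `v₀` as their only neighbour in `X ∪ Y`. -/
structure IsSuspension (X Y : Finset V) (v₀ : V) : Prop where
  disj : Disjoint X Y
  mem : v₀ ∈ X ∪ Y
  not_adj_left : ∀ x ∈ X, ∀ y ∈ X, ¬ G.Adj x y
  not_adj_right : ∀ x ∈ Y, ∀ y ∈ Y, ¬ G.Adj x y
  adj : ∀ x ∈ X, ∀ y ∈ Y, G.Adj x y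
  adj_iff : ∀ w ∉ X ∪ Y, ∀ u ∈ X ∪ Y, G.Adj w u ↔ u = v₀
  clique : ∀ w ∉ X ∪ Y, ∀ w' ∉ X ∪ Y, w ≠ w' → G.Adj w w'

omit [DecidableRel G.Adj] in
theorem IsSuspension.symm {X Y : Finset V} {v₀ : V} (h : G.IsSuspension X Y v₀) :
    G.IsSuspension Y X v₀ where
  disj := h.disj.symm
  mem := union_comm X Y ▸ h.mem
  not_adj_left := h.not_adj_right
  not_adj_right := h.not_adj_left
  adj x hx y hy := (h.adj y hy x hx).symm
  adj_iff := union_comm X Y ▸ h.adj_iff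
  clique := union_comm X Y ▸ h.clique

omit [DecidableEq V] in
theorem eq_of_sum_eq_of_le {f : V → ℕ} {d : ℕ} (hf : ∀ v ∈ S, f v ≤ d)
    (h : #S * d ≤ ∑ v ∈ S, f v) : ∀ v ∈ S, f v = d := by
  have := (sum_eq_sum_iff_of_le hf).1 (le_antisymm (sum_le_sum hf) (by simpa using h))
  exact this

theorem IsCore.isSuspension [Fintype V] {X Y : Finset V} (c : G.IsCore k X Y)
    (hG : G.CycleFree (2 * k + 1)) (hk : 2 ≤ k) {s : ℕ} (hs : 2 ≤ s) (hcol : ¬ G.Colorable s)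
    (hcard : #(X ∪ Y)ᶜ = s) (hXY : #X * #Y ≤ G.pairs X Y)
    (hdeg : ∀ v ∉ X ∪ Y, #(G.nbIn (X ∪ Y) v) = 1)
    (hclique : ∀ w ∉ X ∪ Y, ∀ w' ∉ X ∪ Y, w ≠ w' → G.Adj w w') :
    ∃ v₀, G.IsSuspension X Y v₀ := by
  have hopp : ∀ w₁ ∉ X ∪ Y, ∀ w₂ ∉ X ∪ Y, ∀ x ∈ X, ∀ y ∈ Y, G.Adj w₁ x → ¬ G.Adj w₂ y := by
    intro w₁ hw₁ w₂ hw₂ x hx y hy hwx hwy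
    have hne : w₁ ≠ w₂ := by rintro rfl; exact c.not_adj_both hG hk hw₁ hx hy hwx hwy
    have hw₁' := hw₁
    have hw₂' := hw₂
    rw [mem_union, not_or] at hw₁' hw₂'
    refine hcol (colorable_of_bipartite_union (P := insert w₂ X) (Q := insert w₁ Y)
      (R := ((X ∪ Y)ᶜ.erase w₁).erase w₂) hs ?_ ?_ ?_ ?_ ?_ (Or.inl ?_))
    · intro v
      simp only [mem_insert, mem_erase, mem_compl, mem_union]
      tauto
    · rw [disjoint_insert_left, disjoint_insert_right, mem_insert]
      exact ⟨by simp [hne.symm, hw₂'.2], hw₁'.1, c.disj⟩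
    · rw [Finset.disjoint_left]
      intro v
      simp only [mem_insert, mem_erase, mem_compl, mem_union]
      tauto
    · have h : ∀ z ∈ X, ¬ G.Adj w₂ z := fun z hz h => c.not_adj_both hG hk hw₂ hz hy h hwy
      intro u hu v hv huv
      rw [mem_insert] at hu hv
      rcases hu with rfl | hu <;> rcases hv with rfl | hv
      · exact G.irrefl huv
      · exact h v hv huv
      · exact h u hu huv.symm
      · exact c.not_adj hG hk hu hv huv
    · have h : ∀ z ∈ Y, ¬ G.Adj w₁ z := fun z hz h => c.not_adj_both hG hk hw₁ hx hz hwx h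
      intro u hu v hv huv
      rw [mem_insert] at hu hv
      rcases hu with rfl | hu <;> rcases hv with rfl | hv
      · exact G.irrefl huv
      · exact h v hv huv
      · exact h u hu huv.symm
      · exact c.symm.not_adj hG hk hu hv huv
    · rw [card_erase_of_mem (by simp only [mem_erase, mem_compl]; exact ⟨hne.symm, hw₂⟩),
        card_erase_of_mem (by simpa using hw₁)]
      omega
  have hsame : ∀ {X Y : Finset V}, G.IsCore k X Y → ∀ w₁ ∉ X, ∀ w₂ ∉ X, G.Adj w₁ w₂ →
      ∀ x ∈ X, ∀ x' ∈ X, G.Adj w₁ x → G.Adj w₂ x' → x = x' := by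
    intro X Y c w₁ hw₁ w₂ hw₂ hw x hx x' hx' hwx hwx'
    by_contra hne
    refine c.linked_left.no_ear_three hG hk hx hx' hne hwx.symm hw hwx' ?_ ?_
    · rintro rfl; exact hw₁ hx'
    · rintro rfl; exact hw₂ hx
  obtain ⟨w₀, hw₀⟩ := card_pos.1 (show 0 < #(X ∪ Y)ᶜ by omega)
  rw [mem_compl] at hw₀
  obtain ⟨v₀, hv₀⟩ := card_eq_one.1 (hdeg w₀ hw₀)
  have hv₀' : v₀ ∈ G.nbIn (X ∪ Y) w₀ := by simp [hv₀]
  rw [mem_nbIn] at hv₀'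
  have huniq : ∀ w ∉ X ∪ Y, ∀ u ∈ X ∪ Y, G.Adj w u → u = v₀ := by
    intro w hw u hu hwu
    by_cases hww : w = w₀
    · subst hww
      have : u ∈ G.nbIn (X ∪ Y) w := mem_nbIn.2 ⟨hu, hwu⟩
      simpa [hv₀] using this
    · have hadj := hclique w hw w₀ hw₀ hww
      obtain ⟨hv, hwv⟩ := hv₀'
      have hw' := hw
      have hw₀' := hw₀
      rw [mem_union, not_or] at hw' hw₀'
      rw [mem_union] at hu hv
      rcases hu with hu | hu <;> rcases hv with hv | hv
      · exact hsame c w hw'.1 w₀ hw₀'.1 hadj u hu v₀ hv hwu hwv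
      · exact (hopp w hw w₀ hw₀ u hu v₀ hv hwu hwv).elim
      · exact (hopp w₀ hw₀ w hw v₀ hv u hu hwv hwu).elim
      · exact hsame c.symm w hw'.2 w₀ hw₀'.2 hadj u hu v₀ hv hwu hwv
  refine ⟨v₀, c.disj, hv₀'.1, fun _ hx _ hy => c.not_adj hG hk hx hy,
    fun _ hx _ hy => c.symm.not_adj hG hk hx hy, fun x hx y hy => ?_, fun w hw u hu => ?_, hclique⟩
  · have := eq_of_sum_eq_of_le (fun v _ => card_le_card (nbIn_subset Y v)) hXY x hx
    have := eq_of_subset_of_card_le (nbIn_subset Y x) this.ge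
    rw [← this, mem_nbIn] at hy
    exact hy.2
  · refine ⟨huniq w hw u hu, ?_⟩
    rintro rfl
    obtain ⟨z, hz⟩ := card_pos.1 (show 0 < #(G.nbIn (X ∪ Y) w) by rw [hdeg w hw]; omega)
    rw [mem_nbIn] at hz
    rw [← huniq w hw z hz.1 hz.2]
    exact hz.2

theorem two_mul_choose_two (t : ℕ) : 2 * (t + 1).choose 2 = t * (t + 1) := by
  rw [Nat.choose_two_right, Nat.mul_div_cancel' (Nat.even_mul_pred_self _).two_dvd,
    Nat.add_sub_cancel, mul_comm]

theorem card_div_two {x y q : ℕ} (h : x + y = q) (hmul : q ^ 2 / 4 ≤ x * y) :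
    x = q / 2 ∨ y = q / 2 := by
  subst h
  rcases le_total x y with hxy | hxy
  · left
    obtain ⟨d, rfl⟩ := Nat.exists_eq_add_of_le hxy
    have : d ≤ 1 := by
      by_contra! hd
      rw [show (x + (x + d)) ^ 2 = d * d + 4 * (x * (x + d)) by ring,
        Nat.add_mul_div_left _ _ (by omega)] at hmul
      have := Nat.mul_le_mul hd hd
      omega
    omega
  · right
    obtain ⟨d, rfl⟩ := Nat.exists_eq_add_of_le hxy
    have : d ≤ 1 := by
      by_contra! hd
      rw [show (y + d + y) ^ 2 = d * d + 4 * ((y + d) * y) by ring,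
        Nat.add_mul_div_left _ _ (by omega)] at hmul
      have := Nat.mul_le_mul hd hd
      omega
    omega

/-- A `C_{2k+1}`-free graph that is not `s`-colourable and has the maximum possible number of
edges is a suspension of a balanced complete bipartite graph. -/
theorem CycleFree.exists_isSuspension [Fintype V] (hG : G.CycleFree (2 * k + 1)) (hk : 2 ≤ k)
    {s q : ℕ} (hn : 100 * k ≤ Fintype.card V) (hs : 2 ≤ s) (hsk : s + 1 ≤ 2 * k)
    (hq : q + s = Fintype.card V) (hcol : ¬ G.Colorable s)
    (he : 2 * (q ^ 2 / 4 + (s + 1).choose 2) ≤ G.pairs univ univ) :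
    G.pairs univ univ = 2 * (q ^ 2 / 4 + (s + 1).choose 2) ∧
      ∃ X Y v₀, G.IsSuspension X Y v₀ ∧ #X = q / 2 ∧ #X + #Y = q := by
  have hch := two_mul_choose_two s
  have hq4 : q ^ 2 ≤ 4 * (q ^ 2 / 4) + 1 := by
    rcases Nat.even_or_odd' q with ⟨j, rfl | rfl⟩
    · rw [mul_pow]; omega
    · rw [show (2 * j + 1) ^ 2 = 1 + 4 * (j ^ 2 + j) by ring]; omega
  have he' : q ^ 2 + 2 * (s * (s + 1)) ≤ 2 * G.pairs univ univ + 1 := by omega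
  obtain ⟨X, Y, hd, hX, hY, hX2, hY2, hU, hm⟩ := hG.exists_core hk hn (by
    have h1 : 49 * Fintype.card V + 50 ≤ 50 * q := by omega
    nlinarith)
  have c : G.IsCore k X Y := ⟨hd, hX, hY, hX2, hY2⟩
  obtain ⟨hcard, hdeg⟩ := c.card_compl hG hk rfl hs (by omega) hcol hU
    (by by_contra! h; nlinarith) (by rwa [← hq, Nat.add_sub_cancel])
  have hsum : #X + #Y = q := by
    have := card_add_card_compl (X ∪ Y)
    rw [card_union_of_disjoint hd] at this
    omega
  have hpairs := c.pairs_univ_eq hG hk (disjoint_empty_left _) (empty_union (X ∪ Y)ᶜ).symm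
  rw [pairs_eq_zero (by simp : ∀ v ∈ (∅ : Finset V), ∀ w ∈ X ∪ Y, ¬ G.Adj v w)] at hpairs
  have hdeg' : ∀ v ∈ (X ∪ Y)ᶜ, #(G.nbIn (X ∪ Y) v) ≤ 1 := fun v hv => hdeg v (mem_compl.1 hv)
  have h1 : G.pairs (X ∪ Y)ᶜ (X ∪ Y) ≤ s := by
    have := sum_le_card_nsmul _ _ 1 hdeg'
    rwa [hcard, smul_eq_mul, mul_one] at this
  have hlt : ∀ v ∈ (X ∪ Y)ᶜ, G.nbIn (X ∪ Y)ᶜ v ⊆ (X ∪ Y)ᶜ.erase v := fun v _ u hu => by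
    rw [mem_nbIn] at hu
    exact mem_erase.2 ⟨hu.2.ne', hu.1⟩
  have hle : ∀ v ∈ (X ∪ Y)ᶜ, #(G.nbIn (X ∪ Y)ᶜ v) ≤ s - 1 := fun v hv => by
    rw [← hcard, ← card_erase_of_mem hv]
    exact card_le_card (hlt v hv)
  have h2 : G.pairs (X ∪ Y)ᶜ (X ∪ Y)ᶜ ≤ s * (s - 1) := by
    have := sum_le_card_nsmul _ _ _ hle
    rwa [hcard, smul_eq_mul] at this
  have h3 := G.pairs_le_mul X Y
  have h4 : #X * #Y ≤ q ^ 2 / 4 := by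
    rw [Nat.le_div_iff_mul_le (by omega), ← hsum]
    zify; nlinarith [sq_nonneg ((#X : ℤ) - #Y)]
  have h5 : s * (s + 1) = s * (s - 1) + 2 * s := by
    obtain ⟨j, rfl⟩ : ∃ j, s = j + 1 := ⟨s - 1, by omega⟩
    rw [Nat.add_sub_cancel]; ring
  have hdeg1 := eq_of_sum_eq_of_le hdeg' (by
    change _ ≤ G.pairs (X ∪ Y)ᶜ (X ∪ Y); rw [hcard]; omega)
  have hdeg2 := eq_of_sum_eq_of_le hle (by
    change _ ≤ G.pairs (X ∪ Y)ᶜ (X ∪ Y)ᶜ; rw [hcard]; omega)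
  obtain ⟨v₀, h⟩ := c.isSuspension hG hk hs hcol hcard (by omega)
    (fun v hv => hdeg1 v (mem_compl.2 hv)) (fun w hw w' hw' hne => by
      have := eq_of_subset_of_card_le (hlt w (mem_compl.2 hw)) (by
        rw [hdeg2 w (mem_compl.2 hw), card_erase_of_mem (mem_compl.2 hw), hcard])
      exact (mem_nbIn.1 (this ▸ mem_erase.2 ⟨hne.symm, mem_compl.2 hw'⟩)).2)
  refine ⟨by omega, ?_⟩
  rcases card_div_two hsum (by omega) with hx | hy
  · exact ⟨X, Y, v₀, h, hx, hsum⟩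
  · exact ⟨Y, X, v₀, h.symm, hy, by omega⟩

theorem IsSuspension.pairs_univ [Fintype V] {X Y : Finset V} {v₀ : V} (h : G.IsSuspension X Y v₀) :
    G.pairs univ univ = 2 * (#X * #Y) + #(X ∪ Y)ᶜ * (#(X ∪ Y)ᶜ + 1) := by
  have h1 : G.pairs X Y = #X * #Y := by
    rw [pairs, ← smul_eq_mul]
    refine sum_const_nat fun x hx => ?_
    rw [nbIn, filter_true_of_mem (h.adj x hx)]
  have h2 : G.pairs (X ∪ Y)ᶜ (X ∪ Y) = #(X ∪ Y)ᶜ * 1 := by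
    refine sum_const_nat fun w hw => card_eq_one.2 ⟨v₀, ?_⟩
    ext u
    rw [mem_nbIn, mem_singleton]
    exact ⟨fun hu => (h.adj_iff w (mem_compl.1 hw) u hu.1).1 hu.2,
      fun hu => ⟨hu ▸ h.mem, (h.adj_iff w (mem_compl.1 hw) u (hu ▸ h.mem)).2 hu⟩⟩
  have h3 : G.pairs (X ∪ Y)ᶜ (X ∪ Y)ᶜ = #(X ∪ Y)ᶜ * (#(X ∪ Y)ᶜ - 1) := by
    refine sum_const_nat fun w hw => ?_
    rw [← card_erase_of_mem hw]
    congr 1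
    ext u
    rw [mem_nbIn, mem_erase]
    exact ⟨fun hu => ⟨hu.2.ne', hu.1⟩,
      fun hu => ⟨hu.2, h.clique w (mem_compl.1 hw) u (mem_compl.1 hu.2) hu.1.symm⟩⟩
  rw [← union_compl (X ∪ Y), pairs_union_self disjoint_compl_right, pairs_comm (X ∪ Y) (X ∪ Y)ᶜ,
    pairs_bipartite h.disj h.not_adj_left h.not_adj_right, h1, h2, h3]
  rcases Nat.eq_zero_or_pos #(X ∪ Y)ᶜ with h0 | h0
  · rw [h0]
  · obtain ⟨j, hj⟩ : ∃ j, #(X ∪ Y)ᶜ = j + 1 := ⟨_, (Nat.sub_add_cancel h0).symm⟩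
    rw [hj, Nat.add_sub_cancel]; ring

omit [DecidableEq V] in
theorem pairs_univ_eq_ncard [Fintype V] : G.pairs univ univ = 2 * G.edgeSet.ncard := by
  rw [Set.ncard_eq_toFinset_card', ← edgeFinset, ← sum_degrees_eq_twice_card_edges]
  refine sum_congr rfl fun v _ => ?_
  rw [nbIn, ← neighborFinset_eq_filter, card_neighborFinset_eq_degree]

end SimpleGraph

open SimpleGraph

theorem card_filter_fin {n a b : ℕ} (hb : b ≤ n) :
    #{i : Fin n | a ≤ (i : ℕ) ∧ (i : ℕ) < b} = b - a := by
  rw [← Nat.card_Ico, ← card_map Fin.valEmbedding]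
  congr 1
  ext j
  simp only [mem_map, mem_filter, mem_univ, true_and, Fin.valEmbedding_apply, mem_Ico]
  exact ⟨by rintro ⟨i, hi, rfl⟩; exact hi, fun hj => ⟨⟨j, by omega⟩, hj, rfl⟩⟩

theorem turanSuspAt_isSuspension {n q : ℕ} {v₀ : Fin n} (hv₀ : (v₀ : ℕ) < q) :
    (turanSuspAt n q v₀).IsSuspension {i : Fin n | 0 ≤ (i : ℕ) ∧ (i : ℕ) < q / 2}
      {i : Fin n | q / 2 ≤ (i : ℕ) ∧ (i : ℕ) < q} v₀ := by
  constructor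
  · rw [Finset.disjoint_left]; simp; omega
  all_goals
    simp only [turanSuspAt, fromRel_adj, mem_filter, mem_univ, true_and, mem_union, ne_eq,
      Fin.ext_iff]
    omega

theorem SimpleGraph.IsSuspension.nonempty_iso {V V' : Type*} [DecidableEq V] [Fintype V]
    [DecidableEq V'] [Fintype V'] {G : SimpleGraph V} {G' : SimpleGraph V'} {X Y : Finset V}
    {X' Y' : Finset V'} {v₀ : V} (h : G.IsSuspension X Y v₀) (e : V ≃ V')
    (h' : G'.IsSuspension X' Y' (e v₀)) (hX : ∀ v, e v ∈ X' ↔ v ∈ X) (hY : ∀ v, e v ∈ Y' ↔ v ∈ Y) :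
    Nonempty (G ≃g G') := by
  refine ⟨e, fun {u v} => ?_⟩
  have hU : ∀ v, e v ∈ X' ∪ Y' ↔ v ∈ X ∪ Y := fun v => by rw [mem_union, mem_union, hX, hY]
  by_cases hu : u ∈ X ∪ Y <;> by_cases hv : v ∈ X ∪ Y
  · rw [mem_union] at hu hv
    rcases hu with hu | hu <;> rcases hv with hv | hv
    · exact iff_of_false (h'.not_adj_left _ ((hX u).2 hu) _ ((hX v).2 hv))
        (h.not_adj_left u hu v hv)
    · exact iff_of_true (h'.adj _ ((hX u).2 hu) _ ((hY v).2 hv)) (h.adj u hu v hv)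
    · exact iff_of_true (h'.adj _ ((hX v).2 hv) _ ((hY u).2 hu)).symm (h.adj v hv u hu).symm
    · exact iff_of_false (h'.not_adj_right _ ((hY u).2 hu) _ ((hY v).2 hv))
        (h.not_adj_right u hu v hv)
  · rw [G.adj_comm, G'.adj_comm, h.adj_iff v hv u hu,
      h'.adj_iff _ (mt (hU v).1 hv) _ ((hU u).2 hu), e.apply_eq_iff_eq]
  · rw [h.adj_iff u hu v hv, h'.adj_iff _ (mt (hU u).1 hu) _ ((hU v).2 hv), e.apply_eq_iff_eq]
  · by_cases huv : u = v
    · subst huv; exact iff_of_false G'.irrefl G.irrefl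
    · exact iff_of_true (h'.clique _ (mt (hU u).1 hu) _ (mt (hU v).1 hv) (e.injective.ne huv))
        (h.clique u hu v hv huv)

/-- Two pairs of disjoint finsets with equal cardinalities are related by a bijection. -/
theorem exists_equiv_mem_iff {V V' : Type*} [DecidableEq V] [Fintype V]
    [DecidableEq V'] [Fintype V'] {X Y : Finset V} {X' Y' : Finset V'}
    (hV : Fintype.card V = Fintype.card V') (hd : Disjoint X Y) (hd' : Disjoint X' Y')
    (hX : #X = #X') (hY : #Y = #Y') :
    ∃ e : V ≃ V', (∀ v, e v ∈ X' ↔ v ∈ X) ∧ ∀ v, e v ∈ Y' ↔ v ∈ Y := by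
  let f : V → Bool × Bool := fun v => (v ∈ X, v ∈ Y)
  let f' : V' → Bool × Bool := fun v => (v ∈ X', v ∈ Y')
  have hfib : ∀ b, Nonempty ({v // f v = b} ≃ {v // f' v = b}) := by
    intro b
    refine ⟨Fintype.equivOfCardEq ?_⟩
    rw [Fintype.card_subtype, Fintype.card_subtype]
    rcases b with ⟨b₁, b₂⟩
    have hc := card_union_of_disjoint hd
    have hc' := card_union_of_disjoint hd'
    have ha := card_add_card_compl (X ∪ Y)
    have ha' := card_add_card_compl (X' ∪ Y')
    cases b₁ <;> cases b₂
    · have h1 : ({v | f v = (false, false)} : Finset V) = (X ∪ Y)ᶜ := by ext; simp [f]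
      have h2 : ({v | f' v = (false, false)} : Finset V') = (X' ∪ Y')ᶜ := by ext; simp [f']
      rw [h1, h2]
      omega
    · have h1 : ({v | f v = (false, true)} : Finset V) = Y := by
        ext v; simpa [f] using fun h => disjoint_right.1 hd h
      have h2 : ({v | f' v = (false, true)} : Finset V') = Y' := by
        ext v; simpa [f'] using fun h => disjoint_right.1 hd' h
      rw [h1, h2, hY]
    · have h1 : ({v | f v = (true, false)} : Finset V) = X := by
        ext v; simpa [f] using fun h => Finset.disjoint_left.1 hd h
      have h2 : ({v | f' v = (true, false)} : Finset V') = X' := by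
        ext v; simpa [f'] using fun h => Finset.disjoint_left.1 hd' h
      rw [h1, h2, hX]
    · have h1 : ({v | f v = (true, true)} : Finset V) = ∅ := by
        ext v; simpa [f] using fun h => Finset.disjoint_left.1 hd h
      have h2 : ({v | f' v = (true, true)} : Finset V') = ∅ := by
        ext v; simpa [f'] using fun h => Finset.disjoint_left.1 hd' h
      rw [h1, h2, card_empty, card_empty]
  let E := fun b => (hfib b).some
  refine ⟨Equiv.ofFiberEquiv E, fun v => ?_, fun v => ?_⟩
  · have := congrArg Prod.fst (Equiv.ofFiberEquiv_map E v)
    simpa [f, f'] using this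
  · have := congrArg Prod.snd (Equiv.ofFiberEquiv_map E v)
    simpa [f, f'] using this

theorem ncard_edgeSet_turanSuspAt {n q : ℕ} (hq : q ≤ n) {v₀ : Fin n} (hv₀ : (v₀ : ℕ) < q) :
    (turanSuspAt n q v₀).edgeSet.ncard = q ^ 2 / 4 + (n - q + 1).choose 2 := by
  classical
  have h := turanSuspAt_isSuspension hv₀
  have h1 := h.pairs_univ
  have h2 := card_add_card_compl (({i | 0 ≤ (i : ℕ) ∧ (i : ℕ) < q / 2} : Finset (Fin n)) ∪
    ({i | q / 2 ≤ (i : ℕ) ∧ (i : ℕ) < q} : Finset (Fin n)))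
  rw [card_union_of_disjoint h.disj, card_filter_fin (by omega), card_filter_fin hq,
    Fintype.card_fin] at h2
  rw [card_filter_fin (by omega), card_filter_fin hq, pairs_univ_eq_ncard] at h1
  obtain ⟨t, rfl⟩ := Nat.exists_eq_add_of_le hq
  rw [show #_ = t by omega] at h1
  have hch := two_mul_choose_two t
  have hq4 : q ^ 2 / 4 = (q / 2 - 0) * (q - q / 2) := by
    rcases Nat.even_or_odd' q with ⟨j, rfl | rfl⟩
    · rw [show 2 * j / 2 - 0 = j by omega, show 2 * j - 2 * j / 2 = j by omega,
        show (2 * j) ^ 2 = 4 * (j * j) by ring, Nat.mul_div_cancel_left _ (by omega)]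
    · rw [show (2 * j + 1) / 2 - 0 = j by omega, show 2 * j + 1 - (2 * j + 1) / 2 = j + 1 by omega,
        show (2 * j + 1) ^ 2 = 1 + 4 * (j * (j + 1)) by ring]
      omega
  rw [hq4, Nat.add_sub_cancel_left]
  omega

theorem SimpleGraph.IsSuspension.exists_iso_turanSuspAt {n q : ℕ} (hq : q ≤ n)
    {G : SimpleGraph (Fin n)} {X Y : Finset (Fin n)} {v₀ : Fin n} (h : G.IsSuspension X Y v₀)
    (hX : #X = q / 2) (hXY : #X + #Y = q) :
    ∃ v₀ : ℕ, v₀ < q ∧ Nonempty (G ≃g turanSuspAt n q v₀) := by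
  obtain ⟨e, heX, heY⟩ := exists_equiv_mem_iff (X := X) (Y := Y)
    (X' := {i : Fin n | 0 ≤ (i : ℕ) ∧ (i : ℕ) < q / 2})
    (Y' := {i : Fin n | q / 2 ≤ (i : ℕ) ∧ (i : ℕ) < q}) rfl h.disj
    (by rw [Finset.disjoint_left]; simp; omega)
    (by rw [card_filter_fin (by omega)]; omega) (by rw [card_filter_fin hq]; omega)
  have hv₀ : (e v₀ : ℕ) < q := by
    have h1 := heX v₀
    have h2 := heY v₀
    have h3 := h.mem
    simp only [mem_filter, mem_univ, true_and, mem_union] at h1 h2 h3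
    rcases h3 with h3 | h3
    · have := (h1.2 h3).2
      omega
    · exact (h2.2 h3).2
  exact ⟨e v₀, hv₀, h.nonempty_iso e (turanSuspAt_isSuspension hv₀) heX heY⟩

end

/-- Corollary: `C_{2k+1}`-free graphs with chromatic number at least `r`.
If `k ≥ 2`, `3 ≤ r ≤ 2k`, `n ≥ 100 k`, and `G` is an `n`-vertex `C_{2k+1}`-free graph with
`χ(G) ≥ r`, then `e(G) ≤ ⌊(n-r+1)²/4⌋ + C(r,2)`, with equality iff `G` is obtained from
`T_{n-r+1,2}` and `K_r` by sharing exactly one vertex. -/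
theorem stmt_2 (k r n : ℕ) (hk : 2 ≤ k) (hr3 : 3 ≤ r) (hr : r ≤ 2 * k)
    (hn : 100 * k ≤ n) (G : SimpleGraph (Fin n))
    (hfree : G.CycleFree (2 * k + 1))
    (hchi : (r : ℕ∞) ≤ G.chromaticNumber) :
    G.edgeSet.ncard ≤ (n - r + 1) ^ 2 / 4 + r.choose 2 ∧
    (G.edgeSet.ncard = (n - r + 1) ^ 2 / 4 + r.choose 2 ↔
      ∃ v0 : ℕ, v0 < n - r + 1 ∧ Nonempty (G ≃g turanSuspAt n (n - r + 1) v0)) := by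
  classical
  have hs : r - 1 + 1 = r := by omega
  have hrn : r ≤ n := by omega
  have hcol : ¬ G.Colorable (r - 1) := fun h => by
    have := Nat.cast_le.1 (hchi.trans h.chromaticNumber_le)
    omega
  have key : (n - r + 1) ^ 2 / 4 + r.choose 2 ≤ G.edgeSet.ncard →
      G.edgeSet.ncard = (n - r + 1) ^ 2 / 4 + r.choose 2 ∧
        ∃ X Y v₀, G.IsSuspension X Y v₀ ∧ X.card = (n - r + 1) / 2 ∧
          X.card + Y.card = n - r + 1 := by
    intro he
    have := hfree.exists_isSuspension hk (s := r - 1) (q := n - r + 1) (by simpa using hn)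
      (by omega) (by omega) (by rw [Fintype.card_fin]; omega) hcol
      (by rw [hs, SimpleGraph.pairs_univ_eq_ncard]; omega)
    rw [hs, SimpleGraph.pairs_univ_eq_ncard] at this
    exact ⟨by omega, this.2⟩
  refine ⟨?_, fun he => ?_, ?_⟩
  · by_contra! h
    exact h.ne' (key h.le).1
  · obtain ⟨-, X, Y, v₀, h, hX, hXY⟩ := key he.ge
    exact h.exists_iso_turanSuspAt (by omega) hX hXY
  · rintro ⟨v₀, hv₀, ⟨φ⟩⟩
    have h := ncard_edgeSet_turanSuspAt (n := n) (q := n - r + 1) (v₀ := ⟨v₀, by omega⟩)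
      (by omega) hv₀
    rw [show n - (n - r + 1) + 1 = r by omega] at h
    rw [← h]
    exact Nat.card_congr φ.mapEdgeSet
end
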